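/- arXiv:math/0608245 — 3 statements merged into one kernel-verified Lean document; each statement's English description precedes it below -/
import Mathlib

section
/- Let r and t be integers with 1 ≤ t ≤ r−1, let n ≥ 2r+2, and let π = (d_1, d_2, ..., d_n) be an n-term graphic sequence with d_{r−t} ≥ r. If d_{2r+2} ≥ r−1, then π is potentially K_{r+1} − K_{1,t}-graphic. -/
open SimpleGraph Finset
open scoped Classical

/-- `G` contains a copy of `H` as a subgraph. -/
def ContainsCopy {α β : Type*} (G : SimpleGraph α) (H : SimpleGraph β) : Prop :=
  ∃ f : β ↪ α, ∀ u v, H.Adj u v → G.Adj (f u) (f v)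

/-- `G` is a realization of the degree sequence `d` (vertex `i` has degree `d i`). -/
def IsRealization {n : ℕ} (G : SimpleGraph (Fin n)) (d : Fin n → ℕ) : Prop :=
  ∀ i, G.degree i = d i

/-- `d` is a graphic sequence: it is nonincreasing and is the degree sequence of a
simple graph on `n` vertices. -/
def IsGraphic {n : ℕ} (d : Fin n → ℕ) : Prop :=
  Antitone d ∧ ∃ G : SimpleGraph (Fin n), IsRealization G d

/-- `d` is potentially `H`-graphic: some realization of `d` contains a copy of `H`. -/
def PotentiallyGraphic {n : ℕ} (d : Fin n → ℕ) {β : Type*} (H : SimpleGraph β) : Prop :=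
  ∃ G : SimpleGraph (Fin n), IsRealization G d ∧ ContainsCopy G H

/-- The set of even integers `l` such that every `n`-term graphic sequence with degree sum
at least `l` is potentially `H`-graphic; `σ(H, n)` is the least element of this set. -/
def SigmaSet {β : Type*} (H : SimpleGraph β) (n : ℕ) : Set ℕ :=
  {l | Even l ∧ ∀ d : Fin n → ℕ, IsGraphic d → l ≤ ∑ i, d i → PotentiallyGraphic d H}

/-- `K_m - H`: the complete graph on `m` vertices minus the edge set of a copy of `H`. -/
def KsubH (m k : ℕ) (h : k ≤ m) (H : SimpleGraph (Fin k)) : SimpleGraph (Fin m) :=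
  (⊤ : SimpleGraph (Fin m)) \ H.map (Fin.castLEEmb h)

/-- `Z₄ = K₄ - P₂`: the complete graph on 4 vertices minus two adjacent edges. -/
def Z4 : SimpleGraph (Fin 4) :=
  (⊤ : SimpleGraph (Fin 4)) \ SimpleGraph.fromEdgeSet {s(0, 1), s(1, 2)}

/-- The cycle on 4 vertices. -/
def C4 : SimpleGraph (Fin 4) :=
  SimpleGraph.fromEdgeSet {s(0, 1), s(1, 2), s(2, 3), s(3, 0)}

/-- 1-indexed access `d_i` to a finite sequence (0 outside the range). -/
def nth {n : ℕ} (d : Fin n → ℕ) (i : ℕ) : ℕ :=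
  if h : i - 1 < n then d ⟨i - 1, h⟩ else 0

/-- The star `K_{1,t}` on `t + 1` vertices: vertex `0` joined to the `t` other vertices. -/
def starGraph (t : ℕ) : SimpleGraph (Fin (t + 1)) :=
  SimpleGraph.fromEdgeSet {e | ∃ i : Fin (t + 1), i ≠ 0 ∧ e = s(0, i)}

/-- A 0/1 matrix supported on the relation `R` with prescribed row and column sums `a` exists as
soon as the cut condition holds for all sets `S` of rows and `T` of columns. -/
theorem exists_relation_of_cut {V : Type*} [Fintype V] [DecidableEq V] (R : V → V → Prop)
    (a : V → ℕ)
    (h : ∀ S T : Finset V,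
      ∑ i ∈ S, a i ≤ ∑ j ∈ T, a j + #{e ∈ S ×ˢ Tᶜ | R e.1 e.2}) :
    ∃ M : V → V → Prop, (∀ i j, M i j → R i j) ∧
      (∀ i, #{j | M i j} = a i) ∧ ∀ j, #{i | M i j} = a j := by
  let P := {e : V × V // R e.1 e.2}
  let St := Σ i : V, Fin (a i)
  let nb : St ⊕ P → Finset (P ⊕ St) := Sum.elim
    (fun s => (univ.filter fun e : P => e.1.1 = s.1).disjSum ∅)
    (fun e => ({e} : Finset P).disjSum (univ.filter fun s : St => s.1 = e.1.2))
  have card_stubs : ∀ T : Finset V, #(univ.filter fun s : St => s.1 ∈ T) = ∑ j ∈ T, a j := by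
    intro T
    have : (univ.filter fun s : St => s.1 ∈ T) = T.sigma fun j => (univ : Finset (Fin (a j))) := by
      ext s
      exact ⟨fun hs => mem_sigma.2 ⟨(mem_filter.1 hs).2, mem_univ _⟩,
        fun hs => mem_filter.2 ⟨mem_univ _, (mem_sigma.1 hs).1⟩⟩
    rw [this, Finset.card_sigma]; simp
  have hall : ∀ X : Finset (St ⊕ P), #X ≤ #(X.biUnion nb) := by
    intro X
    let S : Finset V := X.toLeft.image Sigma.fst
    let T : Finset V := X.toRight.image fun e => e.1.2
    have h1 : #X.toLeft ≤ ∑ i ∈ S, a i := by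
      rw [← card_stubs]
      refine card_le_card fun s hs => ?_
      exact mem_filter.2 ⟨mem_univ _, mem_image_of_mem Sigma.fst hs⟩
    have h2 : (X.toRight ∪ univ.filter fun e : P => e.1.1 ∈ S ∧ e.1.2 ∈ Tᶜ).disjSum
        (univ.filter fun s : St => s.1 ∈ T) ⊆ X.biUnion nb := by
      intro z hz
      rcases z with e | s
      · simp only [inl_mem_disjSum, mem_union, mem_toRight, mem_filter, mem_univ, true_and] at hz
        rcases hz with hz | ⟨hz, -⟩
        · exact mem_biUnion.2 ⟨_, hz, by simp [nb]⟩
        · obtain ⟨s, hs, hse⟩ := mem_image.1 hz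
          exact mem_biUnion.2 ⟨Sum.inl s, by simpa using hs, by simp [nb, hse]⟩
      · simp only [inr_mem_disjSum, mem_filter, mem_univ, true_and] at hz
        obtain ⟨e, he, hes⟩ := mem_image.1 hz
        exact mem_biUnion.2 ⟨Sum.inr e, by simpa using he, by simp [nb, hes]⟩
    have h3 := card_le_card h2
    rw [card_disjSum, card_stubs, card_union_of_disjoint] at h3
    · have h4 : #(univ.filter fun e : P => e.1.1 ∈ S ∧ e.1.2 ∈ Tᶜ)
          = #{e ∈ S ×ˢ Tᶜ | R e.1 e.2} := by
        refine card_bij (fun e _ => e.1) ?_ ?_ ?_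
        · intro e he
          simp only [mem_filter, mem_univ, true_and] at he
          simp only [mem_filter, mem_product]
          exact ⟨he, e.2⟩
        · intro e _ e' _ hee
          exact Subtype.ext hee
        · intro e he
          simp only [mem_filter, mem_product] at he
          exact ⟨⟨e, he.2⟩, by simpa using he.1, rfl⟩
      have h5 := h S T
      have h6 := X.card_toLeft_add_card_toRight
      omega
    · rw [Finset.disjoint_left]
      intro e he he'
      simp only [mem_filter, mem_univ, true_and, mem_compl] at he'
      exact he'.2 (mem_image_of_mem (fun e : P => e.1.2) he)
  obtain ⟨φ, hinj, hφ⟩ := (Finset.all_card_le_biUnion_card_iff_exists_injective nb).1 hall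
  obtain ⟨M, hM⟩ : ∃ M : V → V → Prop, ∀ i j, M i j ↔
      ∃ (hR : R i j) (s : St), φ (Sum.inr ⟨(i, j), hR⟩) = Sum.inr s := ⟨_, fun _ _ => Iff.rfl⟩
  have hrow : ∀ i, a i ≤ #{j | M i j} := by
    intro i
    have hst : ∀ k : Fin (a i), ∃ e : P, φ (Sum.inl ⟨i, k⟩) = Sum.inl e ∧ e.1.1 = i := by
      intro k
      have hk := hφ (Sum.inl ⟨i, k⟩)
      rcases hz : φ (Sum.inl ⟨i, k⟩) with e | s
      · exact ⟨e, rfl, by simpa [hz, nb] using hk⟩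
      · simp [hz, nb] at hk
    choose ψ hψ hψi using hst
    have hc : #(univ : Finset (Fin (a i))) ≤ #{j | M i j} := by
      refine card_le_card_of_injOn (fun k => (ψ k).1.2) ?_ ?_
      · intro k _
        have hR : R i (ψ k).1.2 := by
          have := (ψ k).2
          rwa [hψi k] at this
        have he : (⟨(i, (ψ k).1.2), hR⟩ : P) = ψ k := Subtype.ext (Prod.ext (hψi k).symm rfl)
        simp only [coe_filter, mem_univ, true_and, Set.mem_ofPred_eq]
        refine (hM _ _).2 ⟨hR, ?_⟩
        rw [he]
        have hk := hφ (Sum.inr (ψ k))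
        rcases hz : φ (Sum.inr (ψ k)) with e | s
        · have : e = ψ k := by simpa [hz, nb] using hk
          have h' := hinj (hz.trans ((congrArg Sum.inl this).trans (hψ k).symm))
          exact absurd h' (by simp)
        · exact ⟨s, rfl⟩
      · intro k _ k' _ hkk
        have : ψ k = ψ k' := Subtype.ext (Prod.ext ((hψi k).trans (hψi k').symm) hkk)
        have h' := hinj ((hψ k).trans ((congrArg Sum.inl this).trans (hψ k').symm))
        exact eq_of_heq (Sigma.mk.inj (Sum.inl.inj h')).2
    simpa using hc
  have hcol : ∀ j, #{i | M i j} ≤ a j := by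
    intro j
    have hst : ∀ i : {i // M i j}, ∃ k : Fin (a j), ∃ hR : R i.1 j,
        φ (Sum.inr ⟨(i.1, j), hR⟩) = Sum.inr ⟨j, k⟩ := by
      rintro ⟨i, hi⟩
      obtain ⟨hR, ⟨j', k⟩, hs⟩ := (hM _ _).1 hi
      have hk := hφ (Sum.inr ⟨(i, j), hR⟩)
      have : j' = j := by simpa [hs, nb] using hk
      subst this
      exact ⟨k, hR, hs⟩
    choose ψ hR hψ using hst
    have hψinj : Function.Injective ψ := by
      intro i i' hii
      have h' := hinj ((hψ i).trans ((congrArg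
        (fun k => (Sum.inr ⟨j, k⟩ : P ⊕ St)) hii).trans (hψ i').symm))
      exact Subtype.ext (Prod.mk.inj (Subtype.mk.inj (Sum.inr.inj h'))).1
    have := Fintype.card_le_of_injective ψ hψinj
    rwa [Fintype.card_fin, Fintype.card_subtype] at this
  have htot : ∑ i, #{j | M i j} = ∑ j, #{i | M i j} := by
    simp only [card_filter]
    exact sum_comm
  have e1 : ∑ i, a i ≤ ∑ i, #{j | M i j} := sum_le_sum fun i _ => hrow i
  have e2 : ∑ j, #{i | M i j} ≤ ∑ j, a j := sum_le_sum fun j _ => hcol j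
  refine ⟨M, fun i j hij => ((hM i j).1 hij).1, fun i => ?_, fun j => ?_⟩
  · exact ((sum_eq_sum_iff_of_le fun i _ => hrow i).1 (by omega) i (mem_univ i)).symm
  · exact (sum_eq_sum_iff_of_le fun j _ => hcol j).1 (by omega) j (mem_univ j)

/-- The symmetric 0/1 matrix of the single edge `pq`. -/
def edgeMatrix {V : Type*} [DecidableEq V] (p q : V) (i j : V) : ℤ :=
  (if i = p ∧ j = q then 1 else 0) + if i = q ∧ j = p then 1 else 0

theorem edgeMatrix_comm {V : Type*} [DecidableEq V] (p q i j : V) :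
    edgeMatrix p q i j = edgeMatrix p q j i := by
  unfold edgeMatrix
  rw [add_comm]
  congr 1 <;> simp only [and_comm]

theorem edgeMatrix_of_ne {V : Type*} [DecidableEq V] {p q : V} (hpq : p ≠ q) (i j : V) :
    edgeMatrix p q i j = if (i = p ∧ j = q) ∨ (i = q ∧ j = p) then 1 else 0 := by
  unfold edgeMatrix
  grind

theorem sum_edgeMatrix {V : Type*} [Fintype V] [DecidableEq V] (p q i : V) :
    ∑ j, edgeMatrix p q i j = (if i = p then 1 else 0) + if i = q then 1 else 0 := by
  unfold edgeMatrix
  rw [sum_add_distrib]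
  congr 1 <;> simp [ite_and]

/-- `κ` is the adjacency matrix of a simple graph. -/
def IsEdgeMatrix {V : Type*} (κ : V → V → ℤ) : Prop :=
  (∀ i j, κ i j = κ j i) ∧ (∀ i, κ i i = 0) ∧ ∀ i j, κ i j = 0 ∨ κ i j = 1

/-- `f` assigns `1` or `-1` to some edges of `κ` and `0` to all other pairs. -/
def IsSigning {V : Type*} (κ f : V → V → ℤ) : Prop :=
  (∀ i j, f i j = f j i) ∧ ∀ i j, |f i j| ≤ κ i j

theorem IsEdgeMatrix.sub_edgeMatrix {V : Type*} [DecidableEq V] {κ : V → V → ℤ}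
    (h : IsEdgeMatrix κ) {p q : V} (hpq : κ p q = 1) :
    IsEdgeMatrix fun i j => κ i j - edgeMatrix p q i j := by
  obtain ⟨h1, h2, h3⟩ := h
  have hne : p ≠ q := by rintro rfl; simp [h2] at hpq
  refine ⟨fun i j => by simp only [h1 i j, edgeMatrix_comm p q i j], fun i => ?_, fun i j => ?_⟩
  · simp only [edgeMatrix_of_ne hne]
    grind
  · simp only [edgeMatrix_of_ne hne]
    grind

theorem IsSigning.add_edgeMatrix {V : Type*} [DecidableEq V] {κ f : V → V → ℤ}
    {p q : V} (hne : p ≠ q) (hf : IsSigning (fun i j => κ i j - edgeMatrix p q i j) f) {ε : ℤ}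
    (hε : |ε| ≤ 1) : IsSigning κ fun i j => f i j + ε * edgeMatrix p q i j := by
  refine ⟨fun i j => by simp only [hf.1 i j, edgeMatrix_comm p q i j], fun i j => ?_⟩
  have h := hf.2 i j
  simp only [edgeMatrix_of_ne hne] at h ⊢
  split_ifs at h ⊢
  · have := abs_add_le (f i j) (ε * 1)
    rw [mul_one] at *
    linarith
  · simpa using h

/-- A trail between the two odd vertices `p` and `q`, with alternating signs, starting at `q`. -/
theorem exists_signing_of_odd {V : Type*} [Fintype V] [DecidableEq V] (N : ℕ) :
    ∀ (κ : V → V → ℤ), IsEdgeMatrix κ → ∑ i, ∑ j, κ i j ≤ N → ∀ p q, p ≠ q →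
      (∀ i, Odd (∑ j, κ i j) ↔ i = p ∨ i = q) → ∀ ε : ℤ, (ε = 1 ∨ ε = -1) →
      ∃ f, IsSigning κ f ∧ (∀ i, i ≠ p → i ≠ q → ∑ j, f i j = 0) ∧ ∑ j, f q j = ε ∧
        (∑ j, f p j = 1 ∨ ∑ j, f p j = -1) := by
  induction N with
  | zero =>
    intro κ hκ hN p q hpq hodd ε hε
    exfalso
    have h0 : ∀ i j, 0 ≤ κ i j := fun i j => by rcases hκ.2.2 i j with h | h <;> simp [h]
    have h1 : ∑ j, κ q j ≤ ∑ i, ∑ j, κ i j :=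
      single_le_sum (f := fun i => ∑ j, κ i j) (fun i _ => sum_nonneg fun j _ => h0 i j)
        (mem_univ q)
    have h2 : 0 ≤ ∑ j, κ q j := sum_nonneg fun j _ => h0 q j
    have h3 : ∑ j, κ q j = 0 := le_antisymm (by simpa using h1.trans hN) h2
    have := (hodd q).2 (Or.inr rfl)
    rw [h3] at this
    exact absurd this (by decide)
  | succ N ih =>
    intro κ hκ hN p q hpq hodd ε hε
    have hεabs : |ε| ≤ 1 := by rcases hε with rfl | rfl <;> simp
    obtain ⟨k, hk⟩ : ∃ k, κ q k = 1 := by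
      by_contra! hno
      have : ∑ j, κ q j = 0 := sum_eq_zero fun j _ => (hκ.2.2 q j).resolve_right (hno j)
      have h' := (hodd q).2 (Or.inr rfl)
      rw [this] at h'
      exact absurd h' (by decide)
    have hqk : q ≠ k := by rintro rfl; simp [hκ.2.1] at hk
    by_cases hkp : k = p
    · subst hkp
      refine ⟨fun i j => 0 + ε * edgeMatrix q k i j,
        IsSigning.add_edgeMatrix (f := fun _ _ => 0) hqk ⟨fun _ _ => rfl, fun i j => ?_⟩ hεabs,
        fun i h1 h2 => ?_, ?_, ?_⟩
      · rcases (hκ.sub_edgeMatrix hk).2.2 i j with h | h <;> simp [h]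
      · simp [← mul_sum, sum_edgeMatrix, h1, h2]
      · simp [← mul_sum, sum_edgeMatrix, hqk]
      · simpa [← mul_sum, sum_edgeMatrix, hqk.symm] using hε
    · have hrow : ∀ i, ∑ j, (κ i j - edgeMatrix q k i j)
          = ∑ j, κ i j - ((if i = q then 1 else 0) + if i = k then 1 else 0) := by
        intro i
        rw [sum_sub_distrib, sum_edgeMatrix]
      obtain ⟨f, hf, hf0, hfk, hfp⟩ := ih (fun i j => κ i j - edgeMatrix q k i j)
        (hκ.sub_edgeMatrix hk) (by
          simp only [hrow, sum_sub_distrib, sum_add_distrib, sum_ite_eq', mem_univ, if_true]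
          push_cast at hN
          linarith) p k (Ne.symm hkp) (by
          intro i
          rw [hrow]
          have := hodd i
          grind) (-ε) (by grind)
      refine ⟨_, hf.add_edgeMatrix hqk hεabs, fun i h1 h2 => ?_, ?_, ?_⟩
      · rw [sum_add_distrib, ← mul_sum, sum_edgeMatrix]
        by_cases hik : i = k
        · subst hik; simp [hfk, h2]
        · simp [hf0 i h1 hik, h2, hik]
      · rw [sum_add_distrib, ← mul_sum, sum_edgeMatrix, hf0 q hpq.symm hqk]
        simp [hqk]
      · rw [sum_add_distrib, ← mul_sum, sum_edgeMatrix]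
        simpa [hpq, Ne.symm hkp] using hfp

/-- In a graph with even degrees, a closed trail through the edge `pq` with alternating signs is
balanced everywhere except possibly at `p`. -/
theorem exists_signing_of_even {V : Type*} [Fintype V] [DecidableEq V] {κ : V → V → ℤ}
    (hκ : IsEdgeMatrix κ) (heven : ∀ i, Even (∑ j, κ i j)) {p q : V} (hpq : κ p q = 1) :
    ∃ f, IsSigning κ f ∧ (∀ i, i ≠ p → ∑ j, f i j = 0) ∧
      (∑ j, f p j = 0 ∨ ∑ j, f p j = 2) ∧ f p q = 1 := by
  have hne : p ≠ q := by rintro rfl; simp [hκ.2.1] at hpq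
  have hrow : ∀ i, ∑ j, (κ i j - edgeMatrix p q i j)
      = ∑ j, κ i j - ((if i = p then 1 else 0) + if i = q then 1 else 0) := by
    intro i
    rw [sum_sub_distrib, sum_edgeMatrix]
  obtain ⟨f, hf, hf0, hfq, hfp⟩ := exists_signing_of_odd
    (∑ i, ∑ j, (κ i j - edgeMatrix p q i j)).toNat _ (hκ.sub_edgeMatrix hpq)
    (Int.self_le_toNat _) p q hne (by
      intro i
      rw [hrow]
      have := heven i
      grind) (-1) (Or.inr rfl)
  refine ⟨_, hf.add_edgeMatrix (ε := 1) hne (by simp), fun i hi => ?_, ?_, ?_⟩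
  · rw [sum_add_distrib, ← mul_sum, sum_edgeMatrix]
    by_cases hiq : i = q
    · subst hiq; simp [hfq, hi]
    · simp [hf0 i hi hiq, hi, hiq]
  · rw [sum_add_distrib, ← mul_sum, sum_edgeMatrix]
    rcases hfp with h | h <;> simp [h, hne]
  · have h := hf.2 p q
    simp only [edgeMatrix_of_ne hne] at h ⊢
    have : f p q = 0 := by simpa [hpq] using h
    simp [this]

theorem even_sum_sum_of_symm {V : Type*} [Fintype V] [DecidableEq V] {y : V → V → ℤ}
    (hs : ∀ i j, y i j = y j i) (h0 : ∀ i, y i i = 0) : Even (∑ i, ∑ j, y i j) := by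
  rw [← ZMod.intCast_eq_zero_iff_even, ← Fintype.sum_prod_type' (f := y)]
  push_cast
  refine sum_involution (fun e _ => e.swap) ?_ ?_ (by simp) (by simp)
  · rintro ⟨i, j⟩ -
    simp only [Prod.swap_prod_mk, hs j i]
    exact CharTwo.add_self_eq_zero _
  · rintro ⟨i, j⟩ - hne hij
    obtain rfl : j = i := congrArg Prod.fst hij
    simp [h0] at hne

/-- `x / 2` is a half-integral subgraph of the complement of `F` with degrees `a`. -/
structure IsHalfIntegral {V : Type*} [Fintype V] (F : SimpleGraph V) (a : V → ℕ)
    (x : V → V → ℤ) : Prop where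
  symm : ∀ i j, x i j = x j i
  diag : ∀ i, x i i = 0
  adj : ∀ i j, F.Adj i j → x i j = 0
  range : ∀ i j, x i j = 0 ∨ x i j = 1 ∨ x i j = 2
  sum : ∀ i, ∑ j, x i j = 2 * a i

/-- The pairs on which `x / 2` is fractional. -/
def halfEdges {V : Type*} (x : V → V → ℤ) (i j : V) : ℤ := if x i j = 1 then 1 else 0

theorem IsHalfIntegral.isEdgeMatrix {V : Type*} [Fintype V] {F : SimpleGraph V} {a : V → ℕ}
    {x : V → V → ℤ} (hx : IsHalfIntegral F a x) : IsEdgeMatrix (halfEdges x) := by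
  refine ⟨fun i j => ?_, fun i => ?_, fun i j => ?_⟩
  · simp only [halfEdges, hx.symm i j]
  · simp [halfEdges, hx.diag]
  · unfold halfEdges
    split_ifs <;> simp

theorem IsHalfIntegral.sum_eq {V : Type*} [Fintype V] {F : SimpleGraph V} {a : V → ℕ}
    {x : V → V → ℤ} (hx : IsHalfIntegral F a x) (i : V) :
    ∑ j, halfEdges x i j + 2 * ∑ j, (if x i j = 2 then 1 else 0) = 2 * a i := by
  rw [← hx.sum i, mul_sum, ← sum_add_distrib]
  refine sum_congr rfl fun j _ => ?_
  unfold halfEdges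
  rcases hx.range i j with h | h | h <;> simp [h]

theorem IsHalfIntegral.even_halfEdges {V : Type*} [Fintype V] {F : SimpleGraph V} {a : V → ℕ}
    {x : V → V → ℤ} (hx : IsHalfIntegral F a x) (i : V) : Even (∑ j, halfEdges x i j) := by
  have := hx.sum_eq i
  exact ⟨a i - ∑ j, (if x i j = 2 then 1 else 0), by linarith⟩

theorem IsSigning.mono {V : Type*} {κ κ' f : V → V → ℤ} (hf : IsSigning κ f)
    (h : ∀ i j, κ i j ≤ κ' i j) : IsSigning κ' f :=
  ⟨hf.1, fun i j => (hf.2 i j).trans (h i j)⟩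

theorem IsSigning.eq_cases {V : Type*} {κ f : V → V → ℤ} (hκ : IsEdgeMatrix κ)
    (hf : IsSigning κ f) (i j : V) :
    f i j = 0 ∨ κ i j = 1 ∧ (f i j = 1 ∨ f i j = -1) := by
  have h := hf.2 i j
  rcases hκ.2.2 i j with h' | h' <;> rw [h', abs_le] at h <;> omega

theorem IsSigning.abs_eq {V : Type*} {κ f : V → V → ℤ} (hκ : IsEdgeMatrix κ)
    (hf : IsSigning κ f) (i j : V) : |f i j| = f i j + 2 * if f i j = -1 then 1 else 0 := by
  rcases hf.eq_cases hκ i j with h | ⟨-, h | h⟩ <;> simp [h]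

theorem IsEdgeMatrix.sub_abs {V : Type*} {κ f : V → V → ℤ} (hκ : IsEdgeMatrix κ)
    (hf : IsSigning κ f) : IsEdgeMatrix fun i j => κ i j - |f i j| := by
  refine ⟨fun i j => by simp only [hκ.1 i j, hf.1 i j], fun i => ?_, fun i j => ?_⟩
  · have := hf.2 i i
    have h2 := abs_nonneg (f i i)
    have h3 := hκ.2.1 i
    simp only
    omega
  · have := hf.2 i j
    have h2 := abs_nonneg (f i j)
    have h3 := hκ.2.2 i j
    simp only
    omega

theorem even_sum_sub_abs {V : Type*} [Fintype V] {κ f : V → V → ℤ} (hκ : IsEdgeMatrix κ)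
    (hf : IsSigning κ f) {i : V} (he : Even (∑ j, κ i j)) (he' : Even (∑ j, f i j)) :
    Even (∑ j, (κ i j - |f i j|)) := by
  rw [sum_sub_distrib, sum_congr rfl fun j _ => hf.abs_eq hκ i j, sum_add_distrib, ← mul_sum]
  exact he.sub (he'.add (even_two_mul _))

theorem card_halfEdges_lt {V : Type*} [Fintype V] {x x' : V → V → ℤ}
    (h : ∀ i j, x' i j = 1 → x i j = 1) {i j : V} (hx : x i j = 1) (hx' : x' i j ≠ 1) :
    #{e : V × V | x' e.1 e.2 = 1} < #{e : V × V | x e.1 e.2 = 1} := by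
  refine card_lt_card (Finset.ssubset_iff_of_subset ?_ |>.2 ⟨(i, j), ?_, ?_⟩)
  · intro e he
    simp only [mem_filter, mem_univ, true_and] at he ⊢
    exact h _ _ he
  · simpa using hx
  · simpa using hx'

/-- If any two vertices of `W` are non-adjacent in `F`, and outside `W` the complement of `F` is a
star centred at `c`, then the number of fractional pairs can be decreased. -/
theorem IsHalfIntegral.exists_lt {V : Type*} [Fintype V] [DecidableEq V] {F : SimpleGraph V}
    {a : V → ℕ} {x : V → V → ℤ} (hx : IsHalfIntegral F a x) (ha : Even (∑ i, a i)) {W : Set V}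
    (hW : ∀ i ∈ W, ∀ j ∈ W, ¬ F.Adj i j) {c : V}
    (hc : ∀ i ∉ W, ∀ j ∉ W, i ≠ j → ¬ F.Adj i j → i = c ∨ j = c)
    {i₀ j₀ : V} (h₀ : x i₀ j₀ = 1) :
    ∃ x', IsHalfIntegral F a x' ∧
      #{e : V × V | x' e.1 e.2 = 1} < #{e : V × V | x e.1 e.2 = 1} := by
  by_contra hno
  set κ := halfEdges x with hκdef
  have hκ : IsEdgeMatrix κ := hx.isEdgeMatrix
  have hκ1 : ∀ i j, κ i j = 1 → x i j = 1 := by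
    intro i j h
    by_contra h'
    simp [hκdef, halfEdges, h'] at h
  have balanced : ∀ f, IsSigning κ f → (∀ i, ∑ j, f i j = 0) → ∀ i j, f i j = 0 := by
    intro f hf hf0 i j
    by_contra hij
    have hcase := hf.eq_cases hκ
    refine hno ⟨fun i j => x i j + f i j, ⟨?_, ?_, ?_, ?_, ?_⟩,
      card_halfEdges_lt (x := x) (x' := fun i j => x i j + f i j)
        (i := i) (j := j) ?_ ?_ ?_⟩
    · intro i j; simp only [hx.symm i j, hf.1 i j]
    · intro i
      rcases hcase i i with h | ⟨h, -⟩
      · simp [h, hx.diag]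
      · simp [hκ.2.1] at h
    · intro i j hij
      rcases hcase i j with h | ⟨h, -⟩
      · simp [h, hx.adj i j hij]
      · have := hκ1 i j h; simp [hx.adj i j hij] at this
    · intro i j
      rcases hcase i j with h | ⟨h, h' | h'⟩
      · simpa [h] using hx.range i j
      · simp [hκ1 i j h, h']
      · simp [hκ1 i j h, h']
    · intro i
      rw [sum_add_distrib, hf0, hx.sum, add_zero]
    · intro i j h1
      rcases hcase i j with h | ⟨h, -⟩
      · simpa [h] using h1
      · exact hκ1 i j h
    · exact hκ1 i j ((hcase i j).resolve_left hij).1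
    · simpa [hκ1 i j ((hcase i j).resolve_left hij).1] using hij
  have based : ∀ κ', IsEdgeMatrix κ' → (∀ i j, κ' i j ≤ κ i j) → (∀ i, Even (∑ j, κ' i j)) →
      ∀ p q, κ' p q = 1 → ∃ f, IsSigning κ' f ∧ (∀ i, i ≠ p → ∑ j, f i j = 0) ∧
        ∑ j, f p j = 2 ∧ f p q = 1 := by
    intro κ' h1 h2 h3 p q hpq
    obtain ⟨f, hf, hf0, hfp, hfpq⟩ := exists_signing_of_even h1 h3 hpq
    refine ⟨f, hf, hf0, hfp.resolve_left fun hp => ?_, hfpq⟩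
    have := balanced f (hf.mono h2) (fun i => by
      by_cases hi : i = p
      · rw [hi, hp]
      · exact hf0 i hi) p q
    omega
  have even_of_based : ∀ (f : V → V → ℤ) p, (∀ i, i ≠ p → ∑ j, f i j = 0) → ∑ j, f p j = 2 →
      ∀ i, Even (∑ j, f i j) := by
    intro f p h0 hp i
    by_cases hi : i = p
    · rw [hi, hp]; decide
    · rw [h0 i hi]; decide
  have unique : ∀ f p, IsSigning κ f → (∀ i, i ≠ p → ∑ j, f i j = 0) → ∑ j, f p j = 2 →
      ∀ g, IsSigning (fun i j => κ i j - |f i j|) g → (∀ i, i ≠ p → ∑ j, g i j = 0) →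
        ∑ j, g p j = 2 → ∀ q, g p q ≠ 1 := by
    intro f p hf hf0 hfp g hg hg0 hgp q hq
    have h := balanced (fun i j => f i j - g i j)
      ⟨fun i j => by simp only [hf.1 i j, hg.1 i j], fun i j => by
        have h1 := abs_sub (f i j) (g i j)
        have h2 := hg.2 i j
        simp only at h2
        linarith⟩
      (fun i => by
        rw [sum_sub_distrib]
        by_cases hi : i = p
        · rw [hi, hfp, hgp, sub_self]
        · rw [hf0 i hi, hg0 i hi, sub_self]) p q
    have h2 := hg.2 p q
    simp only [hq, abs_one] at h2
    have h3 : f p q = 1 := by linarith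
    have h4 := hκ.2.2 p q
    rw [h3, abs_one] at h2
    omega
  have covers : ∀ f p, IsSigning κ f → (∀ i, i ≠ p → ∑ j, f i j = 0) → ∑ j, f p j = 2 →
      ∀ q, κ p q = 1 → f p q ≠ 0 := by
    intro f p hf hf0 hfp q hq hfq
    obtain ⟨g, hg, hg0, hgp, hgq⟩ := based _ (hκ.sub_abs hf)
      (fun i j => by simp) (fun i => even_sum_sub_abs hκ hf (hx.even_halfEdges i)
        (even_of_based f p hf0 hfp i)) p q (by simp [hq, hfq])
    exact unique f p hf hf0 hfp g hg hg0 hgp q hgq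
  have meets : ∀ κ', IsEdgeMatrix κ' → (∀ i j, κ' i j ≤ κ i j) → (∀ i, Even (∑ j, κ' i j)) →
      ∀ i j, κ' i j = 1 → ∃ p ∈ W, ∃ q, κ' p q = 1 := by
    intro κ' h1 h2 h3 i j hij
    have key : ∀ y, κ' y c = 1 → ∃ p ∈ W, ∃ q, κ' p q = 1 := by
      intro y hy
      by_contra! hcon
      have hout : ∀ p q, κ' p q = 1 → p ∉ W := fun p q hpq hp => hcon p hp q hpq
      have hyc : ∀ q, q ≠ c → κ' y q = 0 := by
        intro q hq
        refine (h1.2.2 y q).resolve_right fun h => ?_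
        have hyq : y ≠ q := by rintro rfl; simp [h1.2.1] at h
        have hκyq : κ y q = 1 := by
          have := h2 y q
          have := hκ.2.2 y q
          omega
        rcases hc y (hout _ _ h) q (hout q y (by rw [h1.1]; exact h)) hyq
          (fun hadj => by have := hκ1 _ _ hκyq; simp [hx.adj _ _ hadj] at this) with h' | h'
        · subst h'; simp [h1.2.1] at hy
        · exact hq h'
      have := h3 y
      rw [sum_eq_single c (fun q _ hq => hyc q hq) (by simp), hy] at this
      exact absurd this (by decide)
    by_cases hi : i ∈ W
    · exact ⟨i, hi, j, hij⟩
    by_cases hj : j ∈ W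
    · exact ⟨j, hj, i, by rw [h1.1]; exact hij⟩
    have hne : i ≠ j := by rintro rfl; simp [h1.2.1] at hij
    have hκij : κ i j = 1 := by
      have := h2 i j
      have := hκ.2.2 i j
      omega
    rcases hc i hi j hj hne
      (fun hadj => by have := hκ1 _ _ hκij; simp [hx.adj _ _ hadj] at this) with h' | h'
    · subst h'; exact key j (by rw [h1.1]; exact hij)
    · subst h'; exact key i hij
  obtain ⟨p₁, hp₁, q₁, hpq₁⟩ := meets κ hκ (fun _ _ => le_rfl) hx.even_halfEdges i₀ j₀
    (by simp [hκdef, halfEdges, h₀])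
  obtain ⟨f₁, hf₁, hf₁0, hf₁p, -⟩ :=
    based κ hκ (fun _ _ => le_rfl) hx.even_halfEdges p₁ q₁ hpq₁
  have hκ₁ := hκ.sub_abs hf₁
  have heven₁ : ∀ i, Even (∑ j, (κ i j - |f₁ i j|)) := fun i =>
    even_sum_sub_abs hκ hf₁ (hx.even_halfEdges i) (even_of_based f₁ p₁ hf₁0 hf₁p i)
  obtain ⟨i₁, j₁, hij₁⟩ : ∃ i j, κ i j - |f₁ i j| = 1 := by
    by_contra! hcon
    have hz : ∑ i, ∑ j, (κ i j - |f₁ i j|) = 0 :=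
      sum_eq_zero fun i _ => sum_eq_zero fun j _ => (hκ₁.2.2 i j).resolve_right (hcon i j)
    simp only [hf₁.abs_eq hκ, sum_sub_distrib, sum_add_distrib, ← mul_sum] at hz
    rw [sum_eq_single (f := fun i => ∑ j, f₁ i j) p₁ (fun i _ hi => hf₁0 i hi) (by simp),
      hf₁p] at hz
    have e1 := even_sum_sum_of_symm (y := fun i j => if f₁ i j = -1 then 1 else 0)
      (fun i j => by simp only [hf₁.1 i j]) (fun i => by
        have := (hf₁.eq_cases hκ i i)
        rw [hκ.2.1] at this
        have h0 : f₁ i i = 0 := by omega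
        simp [h0])
    have e2 := even_sum_sum_of_symm (y := fun i j => if x i j = 2 then 1 else 0)
      (fun i j => by simp only [hx.symm i j]) (fun i => by simp [hx.diag])
    have e3 : ∑ i, ∑ j, κ i j + 2 * ∑ i, ∑ j, (if x i j = 2 then 1 else 0)
        = 2 * ((∑ i, a i : ℕ) : ℤ) := by
      push_cast
      rw [mul_sum, mul_sum, ← sum_add_distrib]
      exact sum_congr rfl fun i _ => hx.sum_eq i
    obtain ⟨u, hu⟩ := e1
    obtain ⟨v, hv⟩ := e2
    obtain ⟨w, hw⟩ := ha
    rw [hv, hw] at e3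
    rw [hu] at hz
    push_cast at e3
    omega
  obtain ⟨p₂, hp₂, q₂, hpq₂⟩ := meets _ hκ₁ (fun i j => by simp) heven₁ i₁ j₁ hij₁
  obtain ⟨f₂, hf₂, hf₂0, hf₂p, hf₂q⟩ := based _ hκ₁ (fun i j => by simp) heven₁ p₂ q₂ hpq₂
  have hf₂κ : IsSigning κ f₂ := hf₂.mono fun i j => by simp
  have hdisj : ∀ i j, f₁ i j = 0 ∨ f₂ i j = 0 := by
    intro i j
    have h1 := hf₁.eq_cases hκ i j
    have h2 := hf₂.eq_cases hκ₁ i j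
    rcases h1 with h1 | ⟨h1, h1' | h1'⟩
    · exact Or.inl h1
    all_goals
      refine Or.inr (h2.resolve_right fun h => ?_)
      have := h.1
      simp [h1, h1'] at this
  have hp : p₁ ≠ p₂ := by
    rintro rfl
    exact unique f₁ p₁ hf₁ hf₁0 hf₁p f₂ hf₂ hf₂0 hf₂p q₂ hf₂q
  have hκp : κ p₁ p₂ ≠ 1 := by
    intro h
    have h1 := covers f₁ p₁ hf₁ hf₁0 hf₁p p₂ h
    have h2 := covers f₂ p₂ hf₂κ hf₂0 hf₂p p₁ (by rw [hκ.1]; exact h)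
    rw [hf₂.1] at h2
    rcases hdisj p₁ p₂ with h' | h'
    · exact h1 h'
    · exact h2 h'
  have hxp : x p₁ p₂ ≠ 1 := fun h => hκp (by simp [hκdef, halfEdges, h])
  obtain ⟨ε, hε, hrange⟩ : ∃ ε : ℤ, (ε = 1 ∨ ε = -1) ∧
      (x p₁ p₂ + 2 * ε = 0 ∨ x p₁ p₂ + 2 * ε = 2) := by
    rcases hx.range p₁ p₂ with h | h | h
    · exact ⟨1, by simp, by simp [h]⟩
    · exact absurd h hxp
    · exact ⟨-1, by simp, by simp [h]⟩
  have hf₁z : f₁ p₁ p₂ = 0 := (hf₁.eq_cases hκ p₁ p₂).resolve_right fun h => hκp h.1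
  have hf₂z : f₂ p₁ p₂ = 0 := (hf₂κ.eq_cases hκ p₁ p₂).resolve_right fun h => hκp h.1
  have hval : ∀ i j, (x i j - ε * f₁ i j - ε * f₂ i j + 2 * ε * edgeMatrix p₁ p₂ i j = x i j) ∨
      (x i j = 1 ∧ (x i j - ε * f₁ i j - ε * f₂ i j + 2 * ε * edgeMatrix p₁ p₂ i j = 0 ∨
        x i j - ε * f₁ i j - ε * f₂ i j + 2 * ε * edgeMatrix p₁ p₂ i j = 2)) ∨
      (i ∈ W ∧ j ∈ W ∧ i ≠ j ∧
       (x i j - ε * f₁ i j - ε * f₂ i j + 2 * ε * edgeMatrix p₁ p₂ i j = 0 ∨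
        x i j - ε * f₁ i j - ε * f₂ i j + 2 * ε * edgeMatrix p₁ p₂ i j = 2)) := by
    intro i j
    rw [edgeMatrix_of_ne hp]
    split_ifs with hij
    · right; right
      rcases hij with ⟨rfl, rfl⟩ | ⟨rfl, rfl⟩
      · refine ⟨hp₁, hp₂, hp, ?_⟩
        rw [hf₁z, hf₂z]
        simpa using hrange
      · refine ⟨hp₂, hp₁, hp.symm, ?_⟩
        rw [hf₁.1, hf₂.1, hx.symm, hf₁z, hf₂z]
        simpa using hrange
    · have h1 := hf₁.eq_cases hκ i j
      have h2 := hf₂κ.eq_cases hκ i j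
      have h3 := hκ1 i j
      rcases hdisj i j with h | h
      · rcases h2 with h2 | ⟨h2, h2' | h2'⟩
        · simp [h, h2]
        all_goals rcases hε with rfl | rfl <;> simp [h, h3 h2, h2']
      · rcases h1 with h1 | ⟨h1, h1' | h1'⟩
        · simp [h, h1]
        all_goals rcases hε with rfl | rfl <;> simp [h, h3 h1, h1']
  refine hno ⟨fun i j => x i j - ε * f₁ i j - ε * f₂ i j + 2 * ε * edgeMatrix p₁ p₂ i j,
    ⟨?_, ?_, ?_, ?_, ?_⟩, card_halfEdges_lt (x := x)
      (x' := fun i j => x i j - ε * f₁ i j - ε * f₂ i j + 2 * ε * edgeMatrix p₁ p₂ i j)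
      (i := p₂) (j := q₂) ?_ ?_ ?_⟩
  · intro i j
    simp only [hx.symm i j, hf₁.1 i j, hf₂.1 i j, edgeMatrix_comm p₁ p₂ i j]
  · intro i
    have h := hx.diag i
    rcases hval i i with h' | h' | h'
    · exact h'.trans h
    · omega
    · exact absurd rfl h'.2.2.1
  · intro i j hij
    have h := hx.adj i j hij
    rcases hval i j with h' | h' | h'
    · exact h'.trans h
    · omega
    · exact absurd hij (hW i h'.1 j h'.2.1)
  · intro i j
    have h := hx.range i j
    rcases hval i j with h' | h' | h'
    · rw [h']; exact h
    · omega
    · omega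
  · intro i
    simp only [sum_add_distrib, sum_sub_distrib, ← mul_sum, sum_edgeMatrix, hx.sum]
    by_cases h1 : i = p₁
    · subst h1
      rw [hf₁p, hf₂0 i hp]
      simp [hp]; ring
    · by_cases h2 : i = p₂
      · subst h2
        rw [hf₂p, hf₁0 i h1]
        simp [h1]; ring
      · rw [hf₁0 i h1, hf₂0 i h2]
        simp [h1, h2]
  · intro i j h
    rcases hval i j with h' | h' | h'
    · exact h'.symm.trans h
    · exact h'.1
    · omega
  · exact hκ1 _ _ ((hf₂κ.eq_cases hκ p₂ q₂).resolve_left (by omega)).1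
  · intro h
    have hx1 : x p₂ q₂ = 1 := hκ1 _ _ ((hf₂κ.eq_cases hκ p₂ q₂).resolve_left (by omega)).1
    have hq : q₂ ≠ p₁ := by
      rintro rfl
      rw [hx.symm] at hx1
      exact hxp hx1
    have h1 : f₁ p₂ q₂ = 0 := (hdisj p₂ q₂).resolve_right (by omega)
    rw [h1, hf₂q, hx1, edgeMatrix_of_ne hp] at h
    simp [hq, hp.symm] at h
    omega

theorem IsHalfIntegral.exists_integral {V : Type*} [Fintype V] [DecidableEq V]
    {F : SimpleGraph V} {a : V → ℕ} (ha : Even (∑ i, a i)) {W : Set V}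
    (hW : ∀ i ∈ W, ∀ j ∈ W, ¬ F.Adj i j) {c : V}
    (hc : ∀ i ∉ W, ∀ j ∉ W, i ≠ j → ¬ F.Adj i j → i = c ∨ j = c) (N : ℕ) (x : V → V → ℤ)
    (hN : #{e : V × V | x e.1 e.2 = 1} ≤ N) (hx : IsHalfIntegral F a x) :
    ∃ x', IsHalfIntegral F a x' ∧ ∀ i j, x' i j ≠ 1 := by
  induction N generalizing x with
  | zero =>
    refine ⟨x, hx, fun i j hij => ?_⟩
    have h : (i, j) ∈ ({e : V × V | x e.1 e.2 = 1} : Finset (V × V)) := by simpa using hij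
    rw [card_eq_zero.1 (Nat.le_zero.1 hN)] at h
    exact notMem_empty _ h
  | succ N ih =>
    by_cases hone : ∃ i j, x i j = 1
    · obtain ⟨i, j, hij⟩ := hone
      obtain ⟨x', hx', hlt⟩ := hx.exists_lt ha hW hc hij
      exact ih x' (by omega) hx'
    · push Not at hone
      exact ⟨x, hx, hone⟩

/-- A degree-constrained supergraph of `F` exists as soon as the associated bipartite cut
condition holds, if `W` is independent in `F` and the complement of `F` outside `W` is a star. -/
theorem exists_supergraph_of_cut {V : Type*} [Fintype V] [DecidableEq V] {F : SimpleGraph V}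
    {a : V → ℕ} (ha : Even (∑ i, a i)) {W : Set V} (hW : ∀ i ∈ W, ∀ j ∈ W, ¬ F.Adj i j) {c : V}
    (hc : ∀ i ∉ W, ∀ j ∉ W, i ≠ j → ¬ F.Adj i j → i = c ∨ j = c)
    (hcut : ∀ S T : Finset V, ∑ i ∈ S, a i ≤
      ∑ j ∈ T, a j + #{e ∈ S ×ˢ Tᶜ | e.1 ≠ e.2 ∧ ¬ F.Adj e.1 e.2}) :
    ∃ G : SimpleGraph V, F ≤ G ∧ ∀ v, G.degree v = F.degree v + a v := by
  obtain ⟨M, hMR, hMr, hMc⟩ := exists_relation_of_cut (fun i j => i ≠ j ∧ ¬ F.Adj i j) a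
    fun S T => by convert hcut S T
  have hind : ∀ i j, (if M i j then (1 : ℤ) else 0) = 0 ∨ (if M i j then (1 : ℤ) else 0) = 1 := by
    intro i j; split_ifs <;> simp
  have hx : IsHalfIntegral F a
      fun i j => (if M i j then (1 : ℤ) else 0) + if M j i then (1 : ℤ) else 0 := by
    refine ⟨fun i j => add_comm _ _, fun i => ?_, fun i j hij => ?_, fun i j => ?_, fun i => ?_⟩
    · have h : ¬ M i i := fun h => (hMR _ _ h).1 rfl
      simp [h]
    · have h : ¬ M i j := fun h => (hMR _ _ h).2 hij
      have h' : ¬ M j i := fun h => (hMR _ _ h).2 hij.symm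
      simp [h, h']
    · have := hind i j
      have := hind j i
      omega
    · rw [sum_add_distrib, sum_boole, sum_boole, hMr, hMc]
      ring
  obtain ⟨x, hx, hx1⟩ := IsHalfIntegral.exists_integral ha hW hc _ _ le_rfl hx
  have hrange : ∀ i j, x i j = 0 ∨ x i j = 2 := fun i j => by
    have := hx.range i j
    have := hx1 i j
    omega
  refine ⟨⟨fun i j => F.Adj i j ∨ x i j = 2, ⟨fun i j h => ?_⟩, ⟨fun i h => ?_⟩⟩, ?_, fun v => ?_⟩
  · rw [F.adj_comm, hx.symm]; exact h
  · simp [hx.diag] at h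
  · intro i j h
    exact Or.inl h
  · have hcard : #{j | x v j = 2} = a v := by
      have h := hx.sum v
      rw [sum_congr rfl (g := fun j => 2 * if x v j = 2 then (1 : ℤ) else 0) fun j _ => by
        rcases hrange v j with h | h <;> simp [h], ← mul_sum, sum_boole] at h
      exact_mod_cast (mul_left_cancel₀ two_ne_zero h)
    rw [← hcard, ← card_neighborFinset_eq_degree, ← card_neighborFinset_eq_degree,
      ← card_union_of_disjoint]
    · congr 1
      ext j
      simp
    · rw [Finset.disjoint_left]
      intro j hj hj'
      have := hx.adj v j (by simpa using hj)
      simp [this] at hj'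

/-- The largest number of edges from `b` to `v` that leave room at `v` for the edges of `F` to
vertices outside `b`. -/
noncomputable def residualCap {V : Type*} [Fintype V] [DecidableEq V] (F : SimpleGraph V)
    (d : V → ℕ) (b : Finset V) (v : V) : ℤ :=
  min (#b : ℤ) (d v - #{u ∈ bᶜ | F.Adj v u})

theorem cut_of_residualCap {V : Type*} [Fintype V] [DecidableEq V] {F : SimpleGraph V}
    {d a : V → ℕ} (hd : ∀ v, d v = F.degree v + a v)
    (hF : ∀ b : Finset V, (∑ v ∈ b, d v : ℤ) ≤ #b * (#b - 1) + ∑ v ∈ bᶜ, residualCap F d b v)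
    (S T : Finset V) : ∑ i ∈ S, a i ≤
      ∑ j ∈ T, a j + #{e ∈ S ×ˢ Tᶜ | e.1 ≠ e.2 ∧ ¬ F.Adj e.1 e.2} := by
  set φ : V → V → ℤ := fun i j => if F.Adj i j then 1 else 0 with hφ
  set η : V → V → ℤ := fun i j => if i ≠ j ∧ ¬ F.Adj i j then 1 else 0 with hη
  have hφs : ∀ i j, φ i j = φ j i := fun i j => by simp only [hφ, F.adj_comm]
  have hηs : ∀ i j, η i j = η j i := fun i j => by simp only [hη, F.adj_comm, ne_comm]
  have hη0 : ∀ i j, 0 ≤ η i j := fun i j => by simp only [hη]; split_ifs <;> simp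
  have hηφ : ∀ i j, η i j = 1 - (if i = j then 1 else 0) - φ i j := by
    intro i j
    by_cases h : i = j
    · simp [hη, hφ, h]
    · by_cases h' : F.Adj i j <;> simp [hη, hφ, h, h']
  have ha : ∀ v, (a v : ℤ) = d v - ∑ u, φ v u := by
    intro v
    have : (∑ u, φ v u) = F.degree v := by
      simp only [hφ, sum_boole, ← card_neighborFinset_eq_degree, neighborFinset_eq_filter]
    rw [this, hd]
    push_cast
    ring
  have hcard : (#{e ∈ S ×ˢ Tᶜ | e.1 ≠ e.2 ∧ ¬ F.Adj e.1 e.2} : ℤ) =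
      ∑ i ∈ S, ∑ j ∈ Tᶜ, η i j := by
    rw [← sum_product', ← sum_boole]
  have hsplit : ∀ f : V → ℤ, ∑ i ∈ S, f i = ∑ i ∈ S \ T, f i + ∑ i ∈ S ∩ T, f i := fun f => by
    rw [← sum_union (disjoint_sdiff_inter S T), sdiff_union_inter]
  have hsplit' : ∀ f : V → ℤ, ∑ i ∈ T, f i = ∑ i ∈ T \ S, f i + ∑ i ∈ S ∩ T, f i := fun f => by
    rw [inter_comm, ← sum_union (disjoint_sdiff_inter T S), sdiff_union_inter]
  have hη1 : ∑ i ∈ S \ T, ∑ j ∈ (T \ S)ᶜ, η i j ≤ ∑ i ∈ S, ∑ j ∈ Tᶜ, η i j := by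
    have h1 : (T \ S)ᶜ = Tᶜ ∪ (S ∩ T) := by
      ext v; simp only [mem_compl, mem_sdiff, mem_union, mem_inter]; tauto
    have h2 : Disjoint Tᶜ (S ∩ T) := by
      rw [Finset.disjoint_left]; intro v; simp only [mem_compl, mem_inter]; tauto
    have h3 : S \ T ⊆ Tᶜ := fun v => by simp only [mem_sdiff, mem_compl]; tauto
    rw [h1, sum_congr rfl fun i _ => sum_union h2, sum_add_distrib, hsplit,
      sum_comm (s := S \ T) (t := S ∩ T), sum_congr rfl fun i _ => sum_congr rfl fun j _ => hηs j i]
    gcongr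
  have hbc : S \ T ⊆ (T \ S)ᶜ := fun v => by simp only [mem_sdiff, mem_compl]; tauto
  have hcb : T \ S ⊆ (S \ T)ᶜ := fun v => by simp only [mem_sdiff, mem_compl]; tauto
  have hη2 : ∑ i ∈ S \ T, ∑ j ∈ (T \ S)ᶜ, η i j =
      #(S \ T) * (#(T \ S)ᶜ - 1) - ∑ i ∈ S \ T, ∑ j ∈ (T \ S)ᶜ, φ i j := by
    rw [← nsmul_eq_mul, ← sum_const, ← sum_sub_distrib]
    refine sum_congr rfl fun i hi => ?_
    simp only [hηφ, sum_sub_distrib, sum_ite_eq, if_pos (hbc hi), sum_const, nsmul_eq_mul, mul_one]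
  have hcap : ∑ v ∈ (S \ T)ᶜ, residualCap F d (S \ T) v ≤
      #(S \ T) * #((S \ T)ᶜ \ (T \ S)) +
        ∑ v ∈ T \ S, ((d v : ℤ) - ∑ u ∈ (S \ T)ᶜ, φ v u) := by
    rw [← sum_sdiff hcb, mul_comm, ← nsmul_eq_mul, ← sum_const]
    refine add_le_add (sum_le_sum fun v _ => min_le_left _ _) (sum_le_sum fun v _ => ?_)
    rw [hφ]
    simp only [sum_boole]
    exact min_le_right _ _
  have hb := hF (S \ T)
  have hc1 : (#(T \ S)ᶜ : ℤ) = #(S \ T) + #((S \ T)ᶜ \ (T \ S)) := by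
    have : (T \ S)ᶜ = (S \ T) ∪ ((S \ T)ᶜ \ (T \ S)) := by
      ext v; simp only [mem_compl, mem_sdiff, mem_union]; tauto
    rw [this, card_union_of_disjoint, Nat.cast_add]
    rw [Finset.disjoint_left]; intro v; simp only [mem_compl, mem_sdiff]; tauto
  have hφb : ∑ i ∈ S \ T, ∑ j, φ i j =
      ∑ i ∈ S \ T, ∑ j ∈ T \ S, φ i j + ∑ i ∈ S \ T, ∑ j ∈ (T \ S)ᶜ, φ i j := by
    rw [← sum_add_distrib]
    exact sum_congr rfl fun i _ => (sum_add_sum_compl _ _).symm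
  have hφc : ∑ i ∈ T \ S, ∑ j, φ i j =
      ∑ i ∈ S \ T, ∑ j ∈ T \ S, φ i j + ∑ i ∈ T \ S, ∑ j ∈ (S \ T)ᶜ, φ i j := by
    rw [sum_comm (s := S \ T) (t := T \ S), ← sum_add_distrib]
    refine sum_congr rfl fun i _ => ?_
    rw [← sum_add_sum_compl (S \ T), sum_congr rfl fun j _ => hφs i j]
  zify
  rw [hcard, hsplit fun i => a i, hsplit' fun i => a i]
  simp only [ha, sum_sub_distrib] at hcap ⊢
  rw [hc1] at hη2
  linarith

/-- Extension of `F` to a realization of `d`, from an inequality for each set of vertices. -/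
theorem exists_supergraph_of_residualCap {V : Type*} [Fintype V] [DecidableEq V]
    {F : SimpleGraph V} {d : V → ℕ} {G : SimpleGraph V} (hG : ∀ v, G.degree v = d v)
    (hdF : ∀ v, F.degree v ≤ d v) {W : Set V}
    (hW : ∀ i ∈ W, ∀ j ∈ W, ¬ F.Adj i j) {c : V}
    (hc : ∀ i ∉ W, ∀ j ∉ W, i ≠ j → ¬ F.Adj i j → i = c ∨ j = c)
    (hF : ∀ b : Finset V, (∑ v ∈ b, d v : ℤ) ≤ #b * (#b - 1) + ∑ v ∈ bᶜ, residualCap F d b v) :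
    ∃ G' : SimpleGraph V, F ≤ G' ∧ ∀ v, G'.degree v = d v := by
  have hd : ∀ v, d v = F.degree v + (d v - F.degree v) := fun v => by have := hdF v; omega
  have heven : Even (∑ v, (d v - F.degree v)) := by
    have h1 : ∑ v, d v = ∑ v, F.degree v + ∑ v, (d v - F.degree v) := by
      rw [← sum_add_distrib]; exact sum_congr rfl fun v _ => hd v
    have h2 : ∑ v, d v = 2 * #G.edgeFinset := by
      rw [← sum_degrees_eq_twice_card_edges]; exact sum_congr rfl fun v _ => (hG v).symm
    rw [sum_degrees_eq_twice_card_edges] at h1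
    exact ⟨#G.edgeFinset - #F.edgeFinset, by omega⟩
  obtain ⟨G', hFG, hG'⟩ := exists_supergraph_of_cut heven hW hc
    fun S T => by convert cut_of_residualCap hd hF S T
  exact ⟨G', hFG, fun v => (hG' v).trans (hd v).symm⟩

/-- The Erdős–Gallai inequality for a set of vertices. -/
theorem sum_degree_le_of_realization {V : Type*} [Fintype V] [DecidableEq V] {d : V → ℕ}
    {G : SimpleGraph V} (hG : ∀ v, G.degree v = d v) (α : Finset V) :
    (∑ v ∈ α, d v : ℤ) ≤ #α * (#α - 1) + ∑ v ∈ αᶜ, min (#α : ℤ) (d v) := by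
  set φ : V → V → ℤ := fun i j => if G.Adj i j then 1 else 0 with hφ
  have hφ01 : ∀ i j, 0 ≤ φ i j ∧ φ i j ≤ 1 := fun i j => by
    simp only [hφ]; split_ifs <;> simp
  have hd : ∀ v, (d v : ℤ) = ∑ u, φ v u := by
    intro v
    simp only [hφ, sum_boole, ← hG, ← card_neighborFinset_eq_degree, neighborFinset_eq_filter]
  have hin : ∀ v ∈ α, ∑ u ∈ α, φ v u ≤ #α - 1 := by
    intro v hv
    rw [← add_sum_erase _ _ hv]
    have h0 : φ v v = 0 := by simp [hφ]
    have h1 := sum_le_card_nsmul (α.erase v) (φ v) 1 fun u _ => (hφ01 v u).2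
    rw [card_erase_of_mem hv, nsmul_one, Nat.cast_sub (card_pos.2 ⟨v, hv⟩), Nat.cast_one] at h1
    linarith
  have hout : ∀ v ∈ αᶜ, ∑ u ∈ α, φ u v ≤ min (#α : ℤ) (d v) := by
    intro v _
    refine le_min ?_ ?_
    · have h1 := sum_le_card_nsmul α (fun u => φ u v) 1 fun u _ => (hφ01 u v).2
      simpa using h1
    · rw [hd, sum_congr rfl fun u _ => show φ u v = φ v u by simp only [hφ, G.adj_comm]]
      exact sum_le_sum_of_subset_of_nonneg (subset_univ α) fun u _ _ => (hφ01 v u).1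
  calc (∑ v ∈ α, d v : ℤ) = ∑ v ∈ α, ∑ u ∈ α, φ v u + ∑ v ∈ αᶜ, ∑ u ∈ α, φ u v := by
        rw [sum_comm (s := αᶜ), ← sum_add_distrib]
        exact sum_congr rfl fun v _ => (hd v).trans (sum_add_sum_compl _ _).symm
    _ ≤ _ := by
        refine add_le_add ((sum_le_sum hin).trans ?_) (sum_le_sum hout)
        rw [sum_const, nsmul_eq_mul]

/-- The first `m` vertices. -/
def initialVertices (n m : ℕ) : Finset (Fin n) := {i | i.val < m}

theorem mem_initialVertices {n m : ℕ} {i : Fin n} : i ∈ initialVertices n m ↔ i.val < m := by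
  simp [initialVertices]

theorem card_initialVertices {n m : ℕ} (h : m ≤ n) : #(initialVertices n m) = m := by
  rw [initialVertices, Fin.card_filter_val_lt, min_eq_right h]

/-- The clique on the vertices `0, …, r`, with the edges from `r` to `s, …, r - 1` removed. -/
def cliqueMinusStar (n r s : ℕ) : SimpleGraph (Fin n) where
  Adj i j := i ≠ j ∧ i.val ≤ r ∧ j.val ≤ r ∧ (i.val = r → j.val < s) ∧ (j.val = r → i.val < s)
  symm := ⟨fun _ _ h => ⟨h.1.symm, h.2.2.1, h.2.1, h.2.2.2.2, h.2.2.2.1⟩⟩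
  loopless := ⟨fun _ h => h.1 rfl⟩

/-- A degree sequence for which `cliqueMinusStar n r s` is not excluded for trivial reasons. -/
structure IsAdmissible {n : ℕ} (r s : ℕ) (d : Fin n → ℕ) : Prop where
  anti : Antitone d
  realizable : ∃ G : SimpleGraph (Fin n), ∀ v, G.degree v = d v
  two_mul_le : 2 * r + 2 ≤ n
  pos : 1 ≤ s
  lt : s < r
  high : ∀ i : Fin n, i.val < s → r ≤ d i
  low : ∀ i : Fin n, i.val < 2 * r + 2 → r ≤ d i + 1

/-- The inequality that a set `b` of vertices imposes on realizations of `d` containing `F`. -/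
def CapInequality {V : Type*} [Fintype V] [DecidableEq V] (F : SimpleGraph V) (d : V → ℕ)
    (b : Finset V) : Prop :=
  (∑ v ∈ b, d v : ℤ) ≤ #b * (#b - 1) + ∑ v ∈ bᶜ, residualCap F d b v

theorem IsAdmissible.sum_le {n r s : ℕ} {d : Fin n → ℕ} (h : IsAdmissible r s d)
    (α : Finset (Fin n)) :
    (∑ v ∈ α, d v : ℤ) ≤ #α * (#α - 1) + ∑ v ∈ αᶜ, min (#α : ℤ) (d v) :=
  let ⟨_, hG⟩ := h.realizable
  sum_degree_le_of_realization hG α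

theorem card_adj_eq_zero {n r s : ℕ} {b : Finset (Fin n)} {v : Fin n} (hv : r < v.val) :
    #{u ∈ bᶜ | (cliqueMinusStar n r s).Adj v u} = 0 := by
  rw [card_eq_zero, filter_eq_empty_iff]
  intro u _ h
  have := h.2.1
  omega

theorem residualCap_of_lt {n r s : ℕ} {d : Fin n → ℕ} {b : Finset (Fin n)} {v : Fin n}
    (hv : r < v.val) : residualCap (cliqueMinusStar n r s) d b v = min (#b : ℤ) (d v) := by
  rw [residualCap, card_adj_eq_zero hv, Nat.cast_zero, sub_zero]

theorem card_adj_add_card_inter_le {n r s : ℕ} (hn : r < n) {b : Finset (Fin n)} {v : Fin n}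
    (hv : v.val ≤ r) (hvb : v ∉ b) :
    #{u ∈ bᶜ | (cliqueMinusStar n r s).Adj v u} + #(b ∩ initialVertices n (r + 1)) ≤ r := by
  have hvC : v ∈ initialVertices n (r + 1) := mem_initialVertices.2 (by omega)
  have hcard : #((initialVertices n (r + 1)).erase v) = r := by
    rw [card_erase_of_mem hvC, card_initialVertices (by omega), Nat.add_sub_cancel]
  rw [← card_union_of_disjoint]
  · refine (card_le_card fun u hu => ?_).trans hcard.le
    rw [mem_union, mem_filter, mem_inter] at hu
    rw [mem_erase]
    rcases hu with ⟨-, hu⟩ | ⟨hub, hu⟩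
    · exact ⟨hu.1.symm, mem_initialVertices.2 (by have := hu.2.2.1; omega)⟩
    · exact ⟨fun h => hvb (h ▸ hub), hu⟩
  · rw [Finset.disjoint_left]
    intro u hu hu'
    exact (mem_compl.1 (mem_filter.1 hu).1) (mem_inter.1 hu').1

theorem card_adj_add_card_inter_le_of_last {n r : ℕ} (hn : r < n) (hr : 1 ≤ r)
    {b : Finset (Fin n)} {v : Fin n} (hv : v.val = r ∨ v.val = r - 1) :
    #{u ∈ bᶜ | (cliqueMinusStar n r (r - 1)).Adj v u} + #(b ∩ initialVertices n (r - 1)) ≤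
      r - 1 := by
  rw [← card_union_of_disjoint]
  · refine (card_le_card fun u hu => ?_).trans (card_initialVertices (n := n) (by omega)).le
    rw [mem_union, mem_filter, mem_inter] at hu
    rcases hu with ⟨-, hu⟩ | ⟨-, hu⟩
    · refine mem_initialVertices.2 ?_
      obtain ⟨h1, h2, h3, h4, h5⟩ := hu
      have : v.val ≠ u.val := fun h => h1 (Fin.ext h)
      omega
    · exact hu
  · rw [Finset.disjoint_left]
    intro u hu hu'
    exact (mem_compl.1 (mem_filter.1 hu).1) (mem_inter.1 hu').1

theorem IsAdmissible.capInequality_of_min_le {n r s : ℕ} {d : Fin n → ℕ} (h : IsAdmissible r s d)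
    {b : Finset (Fin n)}
    (hb : ∀ v ∉ b, v.val ≤ r →
      min (#b : ℤ) (d v) ≤ (d v : ℤ) - #{u ∈ bᶜ | (cliqueMinusStar n r s).Adj v u}) :
    CapInequality (cliqueMinusStar n r s) d b := by
  refine (h.sum_le b).trans ?_
  refine add_le_add_right (sum_le_sum fun v hv => ?_) _
  by_cases hvr : v.val ≤ r
  · exact le_min (min_le_left _ _) (hb v (mem_compl.1 hv) hvr)
  · rw [residualCap_of_lt (by omega)]

theorem IsAdmissible.degree_le {n r s : ℕ} {d : Fin n → ℕ} (h : IsAdmissible r s d) (v : Fin n) :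
    (cliqueMinusStar n r s).degree v ≤ d v := by
  have hn := h.two_mul_le
  have hs := h.lt
  have hdeg : (cliqueMinusStar n r s).degree v =
      #{u ∈ (∅ : Finset (Fin n))ᶜ | (cliqueMinusStar n r s).Adj v u} := by
    rw [← card_neighborFinset_eq_degree, neighborFinset_eq_filter, compl_empty]
  by_cases hvr : v.val ≤ r
  · by_cases hvs : v.val < s
    · have := card_adj_add_card_inter_le (s := s) (by omega) hvr (notMem_empty v)
      have := h.high v hvs
      omega
    · have hle : (cliqueMinusStar n r s).degree v ≤ r - 1 := by
        rw [← card_neighborFinset_eq_degree]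
        by_cases hv : v.val = r
        · refine (card_le_card (t := initialVertices n s) fun u hu => ?_).trans
            ((card_initialVertices (by omega)).le.trans (by omega))
          rw [mem_neighborFinset] at hu
          exact mem_initialVertices.2 (hu.2.2.2.1 hv)
        · have hvm : v ∈ initialVertices n r := mem_initialVertices.2 (by omega)
          refine (card_le_card (t := (initialVertices n r).erase v) fun u hu => ?_).trans
            (by rw [card_erase_of_mem hvm, card_initialVertices (by omega)])
          rw [mem_neighborFinset] at hu
          rw [mem_erase, mem_initialVertices]
          refine ⟨hu.1.symm, ?_⟩
          have := hu.2.2.1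
          have := hu.2.2.2.2
          omega
      have := h.low v (by omega)
      omega
  · rw [hdeg, card_adj_eq_zero (by omega)]
    exact Nat.zero_le _

theorem IsAdmissible.capInequality_of_subset {n r s : ℕ} {d : Fin n → ℕ} (h : IsAdmissible r s d)
    {b : Finset (Fin n)} (hb : b ⊆ initialVertices n s) :
    CapInequality (cliqueMinusStar n r s) d b := by
  have hs := h.lt
  refine h.capInequality_of_min_le fun v hvb hvr => ?_
  have hsplit : (cliqueMinusStar n r s).degree v =
      #{u ∈ bᶜ | (cliqueMinusStar n r s).Adj v u} + #b := by
    rw [← card_neighborFinset_eq_degree, ← card_union_of_disjoint]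
    · congr 1
      ext u
      rw [mem_neighborFinset, mem_union, mem_filter, mem_compl]
      refine ⟨fun hu => ?_, fun hu => hu.elim (fun hu => hu.2) fun hu => ?_⟩
      · by_cases hub : u ∈ b
        · exact Or.inr hub
        · exact Or.inl ⟨hub, hu⟩
      · have hus := mem_initialVertices.1 (hb hu)
        exact ⟨fun h => hvb (h ▸ hu), hvr, by omega, fun _ => hus, by omega⟩
    · rw [Finset.disjoint_left]
      intro u hu hu'
      exact (mem_compl.1 (mem_filter.1 hu).1) hu'
  have := h.degree_le v
  refine (min_le_left _ _).trans ?_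
  omega

theorem sum_compl_eq_add {V M : Type*} [Fintype V] [DecidableEq V] [AddCommMonoid M] (b C : Finset V)
    (f : V → M) : ∑ v ∈ bᶜ, f v = ∑ v ∈ bᶜ \ C, f v + ∑ v ∈ C \ b, f v := by
  rw [← sum_sdiff (inter_subset_left : bᶜ ∩ C ⊆ bᶜ), sdiff_inter_self_left]
  congr 2
  ext v
  simp only [mem_inter, mem_compl, mem_sdiff]
  tauto

theorem IsAdmissible.mul_le_sum {n r s : ℕ} {d : Fin n → ℕ} (h : IsAdmissible r s d)
    (b : Finset (Fin n)) {f : Fin n → ℤ} {c : ℤ} (hc : 0 ≤ c)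
    (h0 : ∀ v ∉ b, r < v.val → 0 ≤ f v)
    (hf : ∀ v ∉ b, r < v.val → v.val < 2 * r + 2 → c ≤ f v) :
    (r + 1 - #(b \ initialVertices n (r + 1)) : ℤ) * c ≤
      ∑ v ∈ bᶜ \ initialVertices n (r + 1), f v := by
  have hn := h.two_mul_le
  set C := initialVertices n (r + 1) with hC
  set Q := initialVertices n (2 * r + 2) \ C with hQ
  have hmemC : ∀ {v}, v ∉ C → r < v.val := fun {v} hv => by
    rw [hC, mem_initialVertices] at hv; omega
  have hcardQ : #Q = r + 1 := by
    rw [hQ, card_sdiff_of_subset, card_initialVertices hn, card_initialVertices (by omega)]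
    · omega
    · intro v hv
      rw [mem_initialVertices] at hv ⊢
      omega
  have hsub : Q \ b ⊆ bᶜ \ C := fun v hv => by
    simp only [hQ, mem_sdiff, mem_compl] at hv ⊢
    tauto
  have hcard : #Q ≤ #(Q \ b) + #(b \ C) := by
    rw [← card_sdiff_add_card_inter Q b]
    refine Nat.add_le_add_left (card_le_card fun v hv => ?_) _
    simp only [hQ, mem_sdiff, mem_inter] at hv ⊢
    tauto
  calc (r + 1 - #(b \ C) : ℤ) * c ≤ #(Q \ b) * c := by
        gcongr
        omega
    _ ≤ ∑ v ∈ Q \ b, f v := by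
        rw [← nsmul_eq_mul]
        refine card_nsmul_le_sum _ _ _ fun v hv => ?_
        simp only [hQ, mem_sdiff, mem_initialVertices] at hv
        exact hf v hv.2 (hmemC hv.1.2) hv.1.1
    _ ≤ _ := by
        refine sum_le_sum_of_subset_of_nonneg hsub fun v hv _ => ?_
        simp only [mem_sdiff, mem_compl] at hv
        exact h0 v hv.1 (hmemC hv.2)

theorem residualCap_erase_le {V : Type*} [Fintype V] [DecidableEq V] (F : SimpleGraph V) (d : V → ℕ)
    (b : Finset V) (w v : V) : residualCap F d (b.erase w) v ≤ residualCap F d b v := by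
  refine min_le_min ?_ ?_
  · exact_mod_cast card_le_card (erase_subset w b)
  · gcongr
    exact erase_subset w b

theorem IsAdmissible.capInequality_of_erase {n r s : ℕ} {d : Fin n → ℕ} (h : IsAdmissible r s d)
    {b : Finset (Fin n)} {w : Fin n} (hw : w ∈ b) (hdw : d w < r)
    (hb : CapInequality (cliqueMinusStar n r s) d (b.erase w)) :
    CapInequality (cliqueMinusStar n r s) d b := by
  set F := cliqueMinusStar n r s with hF
  unfold CapInequality at hb ⊢
  have hk : #(b.erase w) + 1 = #b := card_erase_add_one hw
  have hkz : (#(b.erase w) : ℤ) = #b - 1 := by omega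
  have hcompl : (b.erase w)ᶜ = insert w bᶜ := by
    ext v; simp only [mem_compl, mem_erase, mem_insert]; tauto
  have hdec : (∑ v ∈ b, d v : ℤ) = d w + ∑ v ∈ b.erase w, (d v : ℤ) := by
    rw [add_sum_erase _ (fun v => (d v : ℤ)) hw]
  rw [hcompl, sum_insert (by simpa using hw), hkz] at hb
  have hcapw : residualCap F d (b.erase w) w ≤ #b - 1 := (min_le_left _ _).trans hkz.le
  have hgain : ∑ v ∈ bᶜ, residualCap F d (b.erase w) v + max 0 (d w - (#b - 1) : ℤ) ≤
      ∑ v ∈ bᶜ, residualCap F d b v := by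
    rcases le_or_gt (d w : ℤ) (#b - 1) with hle | hle
    · rw [max_eq_left (by linarith), add_zero]
      exact sum_le_sum fun v _ => residualCap_erase_le F d b w v
    · rw [max_eq_right (by linarith)]
      have h1 := h.mul_le_sum b (c := 1)
        (f := fun v => residualCap F d b v - residualCap F d (b.erase w) v) zero_le_one
        (fun v _ _ => sub_nonneg.2 (residualCap_erase_le F d b w v)) (fun v _ hv hv' => by
          have := h.low v hv'
          rw [hF, residualCap_of_lt hv, residualCap_of_lt hv, hkz, min_eq_left (by omega),
            min_eq_left (by omega)]
          omega)
      have h2 : 0 ≤ ∑ v ∈ initialVertices n (r + 1) \ b,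
          (residualCap F d b v - residualCap F d (b.erase w) v) :=
        sum_nonneg fun v _ => sub_nonneg.2 (residualCap_erase_le F d b w v)
      have h3 := sum_compl_eq_add b (initialVertices n (r + 1))
        fun v => residualCap F d b v - residualCap F d (b.erase w) v
      rw [sum_sub_distrib] at h3
      have h4 : #(b \ initialVertices n (r + 1)) ≤ #b := card_le_card sdiff_subset
      rw [mul_one] at h1
      omega
  have hmax := le_max_right (0 : ℤ) (d w - (#b - 1))
  have hmax' := le_max_left (0 : ℤ) (d w - (#b - 1))
  rw [hdec]
  nlinarith

/-- It suffices to consider sets of vertices of degree at least `r`. -/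
theorem IsAdmissible.capInequality_of_high {n r s : ℕ} {d : Fin n → ℕ} (h : IsAdmissible r s d)
    (hhigh : ∀ b : Finset (Fin n), (∀ w ∈ b, r ≤ d w) →
      CapInequality (cliqueMinusStar n r s) d b) (b : Finset (Fin n)) :
    CapInequality (cliqueMinusStar n r s) d b := by
  induction b using Finset.strongInduction with
  | H b ih =>
    by_cases hb : ∀ w ∈ b, r ≤ d w
    · exact hhigh b hb
    · push Not at hb
      obtain ⟨w, hw, hdw⟩ := hb
      exact h.capInequality_of_erase hw hdw (ih _ (erase_ssubset hw))

/-- A boundary case in which the Erdős–Gallai inequality is strict. -/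
theorem IsAdmissible.sum_lt {n r s : ℕ} {d : Fin n → ℕ} (h : IsAdmissible r s d)
    {b : Finset (Fin n)} {x y : Fin n} (hx : x.val + 1 = r) (hy : y.val = r) (hxb : x ∈ b)
    (hb : b ⊆ initialVertices n r) (hdx : r ≤ d x) (hdy : d y + 1 = r) (hk : #b < r) :
    (∑ v ∈ b, d v : ℤ) < #b * (#b - 1) + ∑ v ∈ bᶜ, min (#b : ℤ) (d v) := by
  by_contra! hcon
  have hn := h.two_mul_le
  set Z := initialVertices n r with hZ
  have hZcard : #Z = r := card_initialVertices (by omega)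
  have hdZ : ∀ v ∈ Z, d x ≤ d v := fun v hv => h.anti (Fin.le_def.2 (by
    rw [hZ, mem_initialVertices] at hv; omega))
  have hyZ : y ∈ Zᶜ := by rw [mem_compl, hZ, mem_initialVertices]; omega
  have hxc : x ∉ bᶜ := by simpa using hxb
  have hk1 : #(b.erase x) + 1 = #b := card_erase_add_one hxb
  have hkz : (#(b.erase x) : ℤ) = #b - 1 := by omega
  have hcompl : (b.erase x)ᶜ = insert x bᶜ := by
    ext v; simp only [mem_compl, mem_erase, mem_insert]; tauto
  have hbZ : bᶜ \ Z = Zᶜ := by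
    ext v; simp only [mem_compl, mem_sdiff]; exact ⟨fun h => h.2, fun h => ⟨fun h' => h (hb h'), h⟩⟩
  have hcardZb : (#(Z \ b) : ℤ) = r - #b := by
    have := card_sdiff_add_card_eq_card hb
    omega
  have hmin : ∀ m : ℤ, m ≤ #b →
      ∑ v ∈ bᶜ, min m (d v) = ∑ v ∈ Zᶜ, min m (d v) + (r - #b) * m := by
    intro m hm
    rw [sum_compl_eq_add b Z, hbZ, ← hcardZb, ← nsmul_eq_mul, ← sum_const]
    congr 1
    refine sum_congr rfl fun v hv => min_eq_left ?_
    have := hdZ v (mem_sdiff.1 hv).1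
    omega
  have h1 := h.sum_le (b.erase x)
  rw [hcompl, sum_insert hxc, hkz, hmin _ (by omega), min_eq_left (by omega)] at h1
  rw [hmin _ le_rfl, ← add_sum_erase _ _ hxb] at hcon
  have hlow : (r - #b : ℤ) * d x ≤ ∑ v ∈ Z \ b, (d v : ℤ) := by
    rw [← hcardZb, ← nsmul_eq_mul]
    exact card_nsmul_le_sum _ _ _ fun v hv => by exact_mod_cast hdZ v (mem_sdiff.1 hv).1
  have h2 := h.sum_le Z
  rw [← sum_sdiff hb, hZcard, ← add_sum_erase _ _ hxb] at h2
  have hpt : ∑ v ∈ Zᶜ, min (r : ℤ) (d v) < ∑ v ∈ Zᶜ, (min (#b : ℤ) (d v) +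
      (r - #b) * (min (#b : ℤ) (d v) - min (#b - 1 : ℤ) (d v))) := by
    refine sum_lt_sum (fun v _ => ?_) ⟨y, hyZ, ?_⟩
    · rcases lt_or_ge (d v) #b with hv | hv
      · rw [min_eq_right (by omega), min_eq_right (by omega), min_eq_right (by omega)]
        simp
      · rw [min_eq_left (a := (#b : ℤ)) (by omega), min_eq_left (a := (#b - 1 : ℤ)) (by omega)]
        refine (min_le_left _ _).trans ?_
        linarith
    · rw [min_eq_right (by omega), min_eq_left (by omega), min_eq_left (by omega)]
      linarith
  rw [sum_add_distrib, ← mul_sum, sum_sub_distrib] at hpt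
  have hpos : (0 : ℤ) ≤ r - #b := by omega
  set M := ∑ v ∈ Zᶜ, min (#b : ℤ) (d v)
  set M' := ∑ v ∈ Zᶜ, min (#b - 1 : ℤ) (d v)
  have hdx' : (r - 1 + (M - M') : ℤ) ≤ d x := by linarith
  have := mul_le_mul_of_nonneg_left hdx' hpos
  linarith

theorem IsAdmissible.capInequality_of_subset_clique {n r : ℕ} {d : Fin n → ℕ}
    (h : IsAdmissible r (r - 1) d) {b : Finset (Fin n)} (hhigh : ∀ w ∈ b, r ≤ d w)
    (hb : b ⊆ initialVertices n (r + 1)) : CapInequality (cliqueMinusStar n r (r - 1)) d b := by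
  have hn := h.two_mul_le
  have hs := h.lt
  by_cases hbA : b ⊆ initialVertices n (r - 1)
  · exact h.capInequality_of_subset hbA
  obtain ⟨w, hwb, hwA⟩ := not_subset.1 hbA
  rw [mem_initialVertices] at hwA
  have hwC := mem_initialVertices.1 (hb hwb)
  have hle : ∀ v ∉ b, v.val ≤ r →
      #{u ∈ bᶜ | (cliqueMinusStar n r (r - 1)).Adj v u} + #b ≤ r := fun v hvb hvr => by
    have := card_adj_add_card_inter_le (s := r - 1) (by omega) hvr hvb
    rwa [inter_eq_left.2 hb] at this
  have hdr : ∀ v : Fin n, v.val < r → r ≤ d v := fun v hv =>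
    (hhigh w hwb).trans (h.anti (Fin.le_def.2 (by omega)))
  obtain ⟨x, hx⟩ : ∃ x : Fin n, x.val + 1 = r := ⟨⟨r - 1, by omega⟩, by simp only; omega⟩
  obtain ⟨y, hy⟩ : ∃ y : Fin n, y.val = r := ⟨⟨r, by omega⟩, rfl⟩
  by_cases hdy : r ≤ d y
  · refine h.capInequality_of_min_le fun v hvb hvr => (min_le_left _ _).trans ?_
    have := hle v hvb hvr
    have : r ≤ d v := hdy.trans (h.anti (Fin.le_def.2 (by omega)))
    omega
  have hyb : y ∉ b := fun hyb => hdy (hhigh y hyb)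
  have hne : ∀ v : Fin n, v.val ≤ r → v ≠ y → v.val < r := fun v hvr hvy => by
    have : v.val ≠ y.val := fun h => hvy (Fin.ext h)
    omega
  have hxb : x ∈ b := by
    have := hne w (by omega) (fun h => hyb (h ▸ hwb))
    rwa [show x = w from Fin.ext (by omega)]
  have hdy' : d y + 1 = r := by have := h.low y (by omega); omega
  rcases le_or_gt r #b with hk | hk
  · refine h.capInequality_of_min_le fun v hvb hvr => ?_
    have := hle v hvb hvr
    have h0 : #{u ∈ bᶜ | (cliqueMinusStar n r (r - 1)).Adj v u} = 0 := by omega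
    rw [h0, Nat.cast_zero, sub_zero]
    exact min_le_right _ _
  have hlt := h.sum_lt hx hy hxb (fun v hv => mem_initialVertices.2 (hne v
    (by have := mem_initialVertices.1 (hb hv); omega) fun h => hyb (h ▸ hv))) (hhigh x hxb) hdy' hk
  have hyc : y ∈ bᶜ := mem_compl.2 hyb
  have hrest : ∑ v ∈ bᶜ.erase y, min (#b : ℤ) (d v) ≤
      ∑ v ∈ bᶜ.erase y, residualCap (cliqueMinusStar n r (r - 1)) d b v := by
    refine sum_le_sum fun v hv => ?_
    obtain ⟨hvy, hvb⟩ := mem_erase.1 hv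
    by_cases hvr : v.val ≤ r
    · have := hle v (mem_compl.1 hvb) hvr
      have := hdr v (hne v hvr hvy)
      exact le_min (min_le_left _ _) ((min_le_left _ _).trans (by omega))
    · rw [residualCap_of_lt (by omega)]
  have hcy : min (#b : ℤ) (d y) ≤ residualCap (cliqueMinusStar n r (r - 1)) d b y + 1 := by
    have := hle y hyb hy.le
    rw [residualCap, ← sub_le_iff_le_add]
    have := min_le_left (#b : ℤ) (d y)
    exact le_min (by omega) (by omega)
  unfold CapInequality
  rw [← add_sum_erase _ _ hyc] at hlt ⊢
  linarith

theorem IsAdmissible.capInequality_of_card_eq {n r : ℕ} {d : Fin n → ℕ}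
    (h : IsAdmissible r (r - 1) d) {b : Finset (Fin n)} (hbr : #b = r) (hb : ¬ b ⊆ initialVertices n (r + 1))
    (hout : ∀ v ∈ b, r < v.val → d v = r) (hC : ∀ v : Fin n, v.val ≤ r → r ≤ d v) :
    CapInequality (cliqueMinusStar n r (r - 1)) d b := by
  have hn := h.two_mul_le
  have hs := h.lt
  set F := cliqueMinusStar n r (r - 1) with hF
  set C := initialVertices n (r + 1) with hCdef
  have hCcard : #C = r + 1 := card_initialVertices (by omega)
  have hmemC : ∀ {v}, v ∈ C ↔ v.val ≤ r := fun {v} => by rw [hCdef, mem_initialVertices]; omega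
  have hle : ∀ v ∉ b, v.val ≤ r → #{u ∈ bᶜ | F.Adj v u} + #(b ∩ C) ≤ r := fun v hvb hvr =>
    card_adj_add_card_inter_le (by omega) hvr hvb
  have hk : #(b \ C) + #(b ∩ C) = r := (card_sdiff_add_card_inter b C).trans hbr
  have hℓ : 1 ≤ #(b \ C) := card_pos.2 (sdiff_nonempty.2 hb)
  set α : Finset (Fin n) := {v ∈ b | r < d v} with hα
  have hαb : α ⊆ b := filter_subset _ _
  have hαC : α ⊆ b ∩ C := fun v hv => by
    rw [hα, mem_filter] at hv
    refine mem_inter.2 ⟨hv.1, hmemC.2 ?_⟩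
    by_contra hvr
    have := hout v hv.1 (by omega)
    omega
  have hj : #α ≤ #(b ∩ C) := card_le_card hαC
  have hbα : (#(b \ α) : ℤ) = r - #α := by
    have := card_sdiff_add_card_eq_card hαb
    omega
  have hcompl : αᶜ = bᶜ ∪ (b \ α) := by
    ext v
    have : v ∈ α → v ∈ b := fun hv => hαb hv
    simp only [mem_compl, mem_union, mem_sdiff]; tauto
  have hdisj : Disjoint bᶜ (b \ α) := by
    rw [Finset.disjoint_left]; intro v; simp only [mem_compl, mem_sdiff]; tauto
  have hEG := h.sum_le α
  rw [hcompl, sum_union hdisj] at hEG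
  have hb1 : ∑ v ∈ b \ α, min (#α : ℤ) (d v) ≤ (r - #α) * #α := by
    rw [← hbα, ← nsmul_eq_mul]
    exact sum_le_card_nsmul _ _ _ fun v _ => min_le_left _ _
  have hb2 : (∑ v ∈ b \ α, d v : ℤ) ≤ (r - #α) * r := by
    rw [← hbα, ← nsmul_eq_mul]
    refine sum_le_card_nsmul _ _ _ fun v hv => ?_
    rw [hα, mem_sdiff, mem_filter, not_and] at hv
    have := hv.2 hv.1
    omega
  have hbd := sum_sdiff hαb (f := fun v => (d v : ℤ))
  have hcapC : ∀ v ∈ C \ b, (#(b ∩ C) : ℤ) ≤ residualCap F d b v := by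
    intro v hv
    obtain ⟨hvC, hvb⟩ := mem_sdiff.1 hv
    have := hle v hvb (hmemC.1 hvC)
    have := hC v (hmemC.1 hvC)
    exact le_min (by omega) (by omega)
  have hnonneg : ∀ v ∈ C \ b, 0 ≤ residualCap F d b v - min (#α : ℤ) (d v) := fun v hv => by
    have := hcapC v hv
    have := min_le_left (#α : ℤ) (d v)
    omega
  have hgood : (r + 1 - #(b \ C) : ℤ) * (r - 1 - #α) ≤
      ∑ v ∈ bᶜ \ C, (residualCap F d b v - min (#α : ℤ) (d v)) := by
    refine h.mul_le_sum b (by omega) (fun v _ hv => ?_) fun v _ hv hv' => ?_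
    · rw [hF, residualCap_of_lt hv, sub_nonneg]
      exact min_le_min_right _ (by omega)
    · have := h.low v hv'
      rw [hF, residualCap_of_lt hv]
      omega
  have hinner : ∀ v ∈ C \ b, ∀ c : ℤ, c + #α ≤ residualCap F d b v →
      c ≤ ∑ v ∈ C \ b, (residualCap F d b v - min (#α : ℤ) (d v)) := fun v hv c hc => by
    refine le_trans ?_ (single_le_sum hnonneg hv)
    have := min_le_left (#α : ℤ) (d v)
    omega
  have hneed : (r - #α : ℤ) ≤ ∑ v ∈ bᶜ, (residualCap F d b v - min (#α : ℤ) (d v)) := by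
    obtain ⟨x, hx⟩ : ∃ x : Fin n, x.val + 1 = r := ⟨⟨r - 1, by omega⟩, by simp only; omega⟩
    obtain ⟨y, hy⟩ : ∃ y : Fin n, y.val = r := ⟨⟨r, by omega⟩, rfl⟩
    rw [sum_compl_eq_add b C]
    have hpos := sum_nonneg hnonneg
    by_cases hjr : #α + 1 = r
    · have hαeq : α = b ∩ C := eq_of_subset_of_card_le hαC (by omega)
      have hone : ∃ v ∈ C \ b, (1 + #α : ℤ) ≤ residualCap F d b v := by
        by_cases hxy : x ∈ b ∨ y ∈ b
        · obtain ⟨v, hvA, hvb⟩ : ∃ v : Fin n, v.val < r - 1 ∧ v ∉ b := by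
            by_contra! hall
            obtain ⟨z, hz, hzb⟩ : ∃ z : Fin n, r - 1 ≤ z.val ∧ z ∈ b ∩ C := by
              rcases hxy with hxb | hyb
              · exact ⟨x, by omega, mem_inter.2 ⟨hxb, hmemC.2 (by omega)⟩⟩
              · exact ⟨y, by omega, mem_inter.2 ⟨hyb, hmemC.2 (by omega)⟩⟩
            have hsub : insert z (initialVertices n (r - 1)) ⊆ b ∩ C := by
              intro u hu
              rcases mem_insert.1 hu with rfl | hu
              · exact hzb
              · rw [mem_initialVertices] at hu
                exact mem_inter.2 ⟨hall u hu, hmemC.2 (by omega)⟩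
            have := card_le_card hsub
            rw [card_insert_of_notMem (by rw [mem_initialVertices]; omega),
              card_initialVertices (by omega), ← hαeq] at this
            omega
          have hdv : r < d v := by
            have key : ∀ z ∈ b, z.val ≤ r → r - 1 ≤ z.val → r < d v := fun z hzb hzr hz => by
              have hzα : z ∈ α := hαeq ▸ mem_inter.2 ⟨hzb, hmemC.2 hzr⟩
              exact (mem_filter.1 hzα).2.trans_le (h.anti (Fin.le_def.2 (by omega)))
            rcases hxy with hxb | hyb
            · exact key x hxb (by omega) (by omega)
            · exact key y hyb (by omega) (by omega)
          refine ⟨v, mem_sdiff.2 ⟨hmemC.2 (by omega), hvb⟩, ?_⟩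
          have := hle v hvb (by omega)
          exact le_min (by omega) (by omega)
        · push Not at hxy
          refine ⟨y, mem_sdiff.2 ⟨hmemC.2 hy.le, hxy.2⟩, ?_⟩
          have hbA : b ∩ C ⊆ b ∩ initialVertices n (r - 1) := fun v hv => by
            obtain ⟨hvb, hvC⟩ := mem_inter.1 hv
            rw [hmemC] at hvC
            refine mem_inter.2 ⟨hvb, mem_initialVertices.2 ?_⟩
            have h1 : v.val ≠ x.val := fun h => hxy.1 (Fin.ext h ▸ hvb)
            have h2 : v.val ≠ y.val := fun h => hxy.2 (Fin.ext h ▸ hvb)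
            omega
          have h1 := card_le_card hbA
          have h2 := card_adj_add_card_inter_le_of_last (b := b) (r := r) (v := y) (by omega) (by omega)
            (Or.inl hy)
          have h3 := hC y hy.le
          rw [← hF] at h2
          exact le_min (by omega) (by omega)
      obtain ⟨v, hv, hv1⟩ := hone
      have := hinner v hv 1 hv1
      have hprod : (0 : ℤ) ≤ (r + 1 - #(b \ C) : ℤ) * (r - 1 - #α) :=
        mul_nonneg (by omega) (by omega)
      omega
    · by_cases hℓr : #(b \ C) = r
      · have hempty : b ∩ C = ∅ := card_eq_zero.1 (by omega)
        have hxC : x ∈ C := hmemC.2 (by omega)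
        have hxb : x ∉ b := fun hxb => notMem_empty x (hempty ▸ mem_inter.2 ⟨hxb, hxC⟩)
        have h1 := card_adj_add_card_inter_le_of_last (b := b) (r := r) (v := x) (by omega)
          (by omega)
          (Or.inr (by omega))
        have h2 := hC x (by omega)
        rw [← hF] at h1
        have := hinner x (mem_sdiff.2 ⟨hxC, hxb⟩) 1 (le_min (by omega) (by omega))
        rw [hℓr] at hgood
        linarith
      · have h1 : (2 : ℤ) ≤ r + 1 - #(b \ C) := by omega
        have h2 : (1 : ℤ) ≤ r - 1 - #α := by omega
        have := mul_le_mul_of_nonneg_right h1 (by omega : (0 : ℤ) ≤ r - 1 - #α)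
        linarith
  rw [sum_sub_distrib] at hneed
  unfold CapInequality
  rw [hbr, ← hbd]
  nlinarith

theorem IsAdmissible.capInequality_of_not_subset_clique {n r : ℕ} {d : Fin n → ℕ}
    (h : IsAdmissible r (r - 1) d) {b : Finset (Fin n)} (hhigh : ∀ w ∈ b, r ≤ d w)
    (hb : ¬ b ⊆ initialVertices n (r + 1)) :
    CapInequality (cliqueMinusStar n r (r - 1)) d b := by
  have hn := h.two_mul_le
  have hs := h.lt
  set F := cliqueMinusStar n r (r - 1) with hF
  set C := initialVertices n (r + 1) with hC
  have hCcard : #C = r + 1 := card_initialVertices (by omega)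
  have hmemC : ∀ {v}, v ∈ C ↔ v.val ≤ r := fun {v} => by rw [hC, mem_initialVertices]; omega
  obtain ⟨w, hw, hmax⟩ := exists_max_image (b \ C) d (sdiff_nonempty.2 hb)
  obtain ⟨hwb, hwC⟩ := mem_sdiff.1 hw
  have hdC : ∀ v ∈ C, d w ≤ d v := fun v hv => h.anti (Fin.le_def.2 (by
    rw [hmemC] at hv hwC; omega))
  have hdw := hhigh w hwb
  have hle : ∀ v ∉ b, v.val ≤ r → #{u ∈ bᶜ | F.Adj v u} + #(b ∩ C) ≤ r := fun v hvb hvr =>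
    card_adj_add_card_inter_le (by omega) hvr hvb
  have hk : #(b \ C) + #(b ∩ C) = #b := card_sdiff_add_card_inter b C
  have hℓ : 1 ≤ #(b \ C) := card_pos.2 ⟨w, hw⟩
  rcases le_or_gt (r + #(b \ C)) (d w) with hg | hg
  · refine h.capInequality_of_min_le fun v hvb hvr => (min_le_left _ _).trans ?_
    have := hle v hvb hvr
    have := hdC v (hmemC.2 hvr)
    rw [← hF]
    omega
  obtain ⟨g, hg'⟩ := Nat.exists_eq_add_of_le hdw
  have hcapC : ∀ v ∈ C \ b, (#(b ∩ C) + g : ℤ) ≤ residualCap F d b v := by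
    intro v hv
    obtain ⟨hvC, hvb⟩ := mem_sdiff.1 hv
    have := hle v hvb (hmemC.1 hvC)
    have := hdC v hvC
    exact le_min (by omega) (by omega)
  by_cases hspecial : #b = r ∧ g = 0
  · obtain ⟨hbr, rfl⟩ := hspecial
    refine h.capInequality_of_card_eq hbr hb (fun v hvb hv => ?_) fun v hv => ?_
    · have := hmax v (mem_sdiff.2 ⟨hvb, by rw [hmemC]; omega⟩)
      have := hhigh v hvb
      omega
    · exact hdw.trans (hdC v (hmemC.2 hv))
  have hα := h.sum_le (b ∩ C)
  have hcompl : (b ∩ C)ᶜ = bᶜ ∪ (b \ C) := by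
    ext v; simp only [mem_compl, mem_inter, mem_union, mem_sdiff]; tauto
  have hdisj : Disjoint bᶜ (b \ C) := by
    rw [Finset.disjoint_left]; intro v; simp only [mem_compl, mem_sdiff]; tauto
  rw [hcompl, sum_union hdisj, sum_compl_eq_add b C] at hα
  have hb1 : ∑ v ∈ b \ C, min (#(b ∩ C) : ℤ) (d v) ≤ #(b \ C) * #(b ∩ C) := by
    rw [← nsmul_eq_mul]
    exact sum_le_card_nsmul _ _ _ fun v _ => min_le_left _ _
  have hCb : (#(C \ b) : ℤ) = r + 1 - #(b ∩ C) := by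
    have := card_sdiff_add_card_inter C b
    rw [inter_comm] at this
    omega
  have hb2 : ∑ v ∈ C \ b, min (#(b ∩ C) : ℤ) (d v) ≤ (r + 1 - #(b ∩ C)) * #(b ∩ C) := by
    rw [← hCb, ← nsmul_eq_mul]
    exact sum_le_card_nsmul _ _ _ fun v _ => min_le_left _ _
  have hb3 : (r + 1 - #(b ∩ C)) * (#(b ∩ C) + g) ≤ ∑ v ∈ C \ b, residualCap F d b v := by
    rw [← hCb, ← nsmul_eq_mul]
    exact card_nsmul_le_sum _ _ _ hcapC
  have hb4 : (∑ v ∈ b \ C, d v : ℤ) ≤ #(b \ C) * (r + g) := by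
    rw [← nsmul_eq_mul]
    refine sum_le_card_nsmul _ _ _ fun v hv => ?_
    have := hmax v hv
    omega
  have hbd : (∑ v ∈ b, d v : ℤ) = ∑ v ∈ b \ C, (d v : ℤ) + ∑ v ∈ b ∩ C, (d v : ℤ) := by
    rw [← sum_union (disjoint_sdiff_inter b C), sdiff_union_inter]
  have hgood : ((r + 1 - #b) * (#(b \ C) - g) : ℤ) ≤
      ∑ v ∈ bᶜ \ C, (residualCap F d b v - min (#(b ∩ C) : ℤ) (d v)) := by
    have h0 : ∀ v ∉ b, r < v.val → 0 ≤ residualCap F d b v - min (#(b ∩ C) : ℤ) (d v) := by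
      intro v _ hv
      rw [hF, residualCap_of_lt hv, sub_nonneg]
      exact min_le_min_right _ (by omega)
    rcases lt_or_ge r #b with hrk | hrk
    · refine le_trans ?_ (sum_nonneg fun v hv => ?_)
      · exact mul_nonpos_of_nonpos_of_nonneg (by omega) (by omega)
      · rw [mem_sdiff, mem_compl, hmemC] at hv
        exact h0 v hv.1 (by omega)
    · rcases eq_or_lt_of_le hrk with hrk | hrk
      · have h1 := h.mul_le_sum b (c := #(b \ C) - 1) (by omega) h0 fun v _ hv hv' => by
          have := h.low v hv'
          rw [hF, residualCap_of_lt hv]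
          omega
        refine le_trans ?_ h1
        have hg1 : 1 ≤ g := by
          by_contra hg0
          exact hspecial ⟨hrk, by omega⟩
        rw [hrk, add_sub_cancel_left, one_mul]
        nlinarith
      · have h1 := h.mul_le_sum b (c := #(b \ C)) (by omega) h0 fun v _ hv hv' => by
          have := h.low v hv'
          rw [hF, residualCap_of_lt hv]
          omega
        refine le_trans ?_ h1
        nlinarith
  rw [sum_sub_distrib] at hgood
  unfold CapInequality
  rw [sum_compl_eq_add b C, hbd]
  have hkz : (#b : ℤ) = #(b \ C) + #(b ∩ C) := by omega
  rw [hkz] at hgood ⊢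
  nlinarith

theorem IsAdmissible.capInequality {n r s : ℕ} {d : Fin n → ℕ} (h : IsAdmissible r s d)
    (hs : s = r - 1 ∨ ∀ i : Fin n, s ≤ i.val → d i < r) (b : Finset (Fin n)) :
    CapInequality (cliqueMinusStar n r s) d b := by
  refine h.capInequality_of_high (fun b hb => ?_) b
  rcases hs with rfl | hs
  · by_cases hbC : b ⊆ initialVertices n (r + 1)
    · exact h.capInequality_of_subset_clique hb hbC
    · exact h.capInequality_of_not_subset_clique hb hbC
  · refine h.capInequality_of_subset fun v hv => mem_initialVertices.2 ?_
    by_contra hvs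
    have := hs v (by omega)
    have := hb v hv
    omega

theorem IsAdmissible.exists_realization {n r s : ℕ} {d : Fin n → ℕ} (h : IsAdmissible r s d)
    (hs : s = r - 1 ∨ ∀ i : Fin n, s ≤ i.val → d i < r) :
    ∃ G : SimpleGraph (Fin n), cliqueMinusStar n r s ≤ G ∧ ∀ v, G.degree v = d v := by
  obtain ⟨G, hG⟩ := h.realizable
  have hn := h.two_mul_le
  refine exists_supergraph_of_residualCap hG h.degree_le (W := {i | r < i.val})
    (c := ⟨r, by omega⟩) (fun i hi j _ hij => ?_) (fun i hi j hj hne hij => ?_)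
    fun b => h.capInequality hs b
  · exact absurd hij.2.1 (not_le.2 hi)
  · simp only [Set.mem_ofPred_eq, not_lt] at hi hj
    simp only [Fin.ext_iff]
    by_contra! hcon
    exact hij ⟨hne, hi, hj, fun h => absurd h hcon.1, fun h => absurd h hcon.2⟩

theorem containsCopy_of_cliqueMinusStar_le {n r s t : ℕ} (hn : r < n) (htr : t + 1 ≤ r + 1)
    (hs : r ≤ s + t) {G : SimpleGraph (Fin n)} (hG : cliqueMinusStar n r s ≤ G) :
    ContainsCopy G (KsubH (r + 1) (t + 1) htr (starGraph t)) := by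
  refine ⟨⟨fun u => ⟨r - u.val, by omega⟩, fun u v huv => ?_⟩, fun u v huv => hG ?_⟩
  · have := Fin.ext_iff.1 huv
    simp only at this
    exact Fin.ext (by omega)
  have key : ∀ u v : Fin (r + 1), (KsubH (r + 1) (t + 1) htr (starGraph t)).Adj u v →
      r - u.val = r → r - v.val < s := by
    intro u v huv hu
    rw [KsubH, sdiff_adj, top_adj] at huv
    obtain ⟨hne, hstar⟩ := huv
    have hne' : u.val ≠ v.val := fun h => hne (Fin.ext h)
    by_contra hv
    refine hstar ((map_adj _ _ _ _).2 ⟨0, ⟨v.val, by omega⟩, ?_, ?_, ?_⟩)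
    · rw [_root_.starGraph, fromEdgeSet_adj]
      have h0 : (⟨v.val, by omega⟩ : Fin (t + 1)) ≠ 0 := by
        simp only [ne_eq, Fin.ext_iff, Fin.val_zero]
        omega
      exact ⟨⟨_, h0, rfl⟩, h0.symm⟩
    · ext
      simp
      omega
    · ext
      simp
  refine ⟨fun h => ?_, ?_, ?_, key u v huv, key v u huv.symm⟩
  · have := Fin.ext_iff.1 h
    have hne : r - u.val = r - v.val := this
    exact huv.ne (Fin.ext (by omega))
  · exact Nat.sub_le _ _
  · exact Nat.sub_le _ _

/-- Lemma 3.4: let `1 ≤ t ≤ r - 1`, `n ≥ 2r + 2` and `π = (d₁, ..., dₙ)` be an `n`-term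
graphic sequence with `d_{r-t} ≥ r`. If `d_{2r+2} ≥ r - 1`, then `π` is potentially
`K_{r+1} - K_{1,t}`-graphic. -/
theorem stmt7 (r t n : ℕ) (ht1 : 1 ≤ t) (ht2 : t ≤ r - 1) (hn : 2 * r + 2 ≤ n)
    (d : Fin n → ℕ) (hgraphic : IsGraphic d)
    (h1 : r ≤ nth d (r - t)) (h2 : r - 1 ≤ nth d (2 * r + 2)) :
    PotentiallyGraphic d (KsubH (r + 1) (t + 1) (by omega) (starGraph t)) := by
  have hr : 2 ≤ r := by omega
  obtain ⟨hanti, G₀, hG₀⟩ := hgraphic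
  have hhigh : ∀ i : Fin n, i.val < r - t → r ≤ d i := fun i hi => by
    rw [nth, dif_pos (by omega)] at h1
    exact h1.trans (hanti (Fin.le_def.2 (by simp only; omega)))
  have hlow : ∀ i : Fin n, i.val < 2 * r + 2 → r ≤ d i + 1 := fun i hi => by
    rw [nth, dif_pos (by omega)] at h2
    have := h2.trans (hanti (show i ≤ ⟨2 * r + 2 - 1, by omega⟩ from
      Fin.le_def.2 (by simp only; omega)))
    omega
  obtain ⟨s, hts, hsr, hs, hmax⟩ : ∃ s, r - t ≤ s ∧ s ≤ r - 1 ∧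
      (∀ i : Fin n, i.val < s → r ≤ d i) ∧ (s = r - 1 ∨ ∀ i : Fin n, s ≤ i.val → d i < r) := by
    by_cases hall : ∀ i : Fin n, i.val < r - 1 → r ≤ d i
    · exact ⟨r - 1, by omega, le_rfl, hall, Or.inl rfl⟩
    · have hex : ∃ m, ∃ i : Fin n, i.val = m ∧ d i < r := by
        push Not at hall
        obtain ⟨i, -, hi⟩ := hall
        exact ⟨i, i, rfl, hi⟩
      obtain ⟨j, hj, hdj⟩ := Nat.find_spec hex
      refine ⟨Nat.find hex, ?_, ?_, fun i hi => ?_, Or.inr fun i hi => ?_⟩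
      · by_contra hlt
        have := hhigh j (by omega)
        omega
      · push Not at hall
        obtain ⟨i, hi, hdi⟩ := hall
        have := Nat.find_min' hex ⟨i, rfl, hdi⟩
        omega
      · by_contra hdi
        exact Nat.find_min hex hi ⟨i, rfl, by omega⟩
      · exact (hanti (Fin.le_def.2 (by omega))).trans_lt hdj
  obtain ⟨G, hFG, hG⟩ := IsAdmissible.exists_realization (r := r) (s := s)
    ⟨hanti, ⟨G₀, hG₀⟩, hn, by omega, by omega, hs, hlow⟩ hmax
  exact ⟨G, hG, containsCopy_of_cliqueMinusStar_le (by omega) _ (by omega) hFG⟩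
end

section
/- Let r ≥ 5 and n ≥ 2r+2 be integers, and let π = (d_1, d_2, ..., d_n) be an n-term graphic sequence with d_{r−4} ≥ r, and with σ(π) ≥ (r−1)(2n−r) − 3(n−r) − 1 if n−r is odd, and σ(π) ≥ (r−1)(2n−r) − 3(n−r) − 2 if n−r is even. If d_{2r+2} ≥ r−1, then π is potentially K_{r+1} − (P_2 ∪ K_2)-graphic. -/
open SimpleGraph Finset
open scoped Classical

/-- `P₂ ∪ K₂`: the disjoint union of a path on 3 vertices and a single edge. -/
def P2unionK2 : SimpleGraph (Fin 5) :=
  SimpleGraph.fromEdgeSet {s(0, 1), s(1, 2), s(3, 4)}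

section
set_option linter.unusedSectionVars false

variable {V : Type*} [Fintype V] [DecidableEq V]

/-- The number of vertices `u` with `s(v, u)` in a list of distinct loopless edges. -/
theorem card_filter_mem_edgeList (v : V) (L : List (V × V))
    (hnd : (L.map fun e => s(e.1, e.2)).Nodup) (hne : ∀ e ∈ L, e.1 ≠ e.2) :
    #{u | s(v, u) ∈ L.map fun e => s(e.1, e.2)} =
      (L.map fun e => (if v = e.1 then 1 else 0) + (if v = e.2 then 1 else 0)).sum := by
  induction L with
  | nil => simp
  | cons e L ih =>
    obtain ⟨a, b⟩ := e
    have hab : a ≠ b := hne (a, b) (by simp)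
    simp only [List.map_cons, List.nodup_cons] at hnd
    have hdisj : Disjoint ({u | s(v, u) = s(a, b)} : Finset V)
        ({u | s(v, u) ∈ L.map fun e => s(e.1, e.2)} : Finset V) := by
      rw [Finset.disjoint_left]
      intro u hu hu'
      simp only [Finset.mem_filter, Finset.mem_univ, true_and] at hu hu'
      exact hnd.1 (hu ▸ hu')
    have hsplit : ({u | s(v, u) ∈ ((a, b) :: L).map fun e => s(e.1, e.2)} : Finset V) =
        ({u | s(v, u) = s(a, b)} : Finset V) ∪
          ({u | s(v, u) ∈ L.map fun e => s(e.1, e.2)} : Finset V) := by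
      ext u
      simp
    have hone : #{u | s(v, u) = s(a, b)} = (if v = a then 1 else 0) + (if v = b then 1 else 0) := by
      by_cases hva : v = a
      · subst hva
        have : ({u | s(v, u) = s(v, b)} : Finset V) = {b} := by
          ext u; simp [hab]
        rw [this]; simp [hab]
      · by_cases hvb : v = b
        · subst hvb
          have : ({u | s(v, u) = s(a, v)} : Finset V) = {a} := by
            ext u
            simp only [Finset.mem_filter, Finset.mem_univ, true_and, Finset.mem_singleton,
              Sym2.eq_iff]
            tauto
          rw [this]; simp [hva]
        · have : ({u | s(v, u) = s(a, b)} : Finset V) = ∅ := by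
            ext u
            simp [hva, hvb]
          rw [this]; simp [hva, hvb]
    rw [hsplit, Finset.card_union_of_disjoint hdisj, hone,
      ih hnd.2 fun e he => hne e (List.mem_cons_of_mem _ he)]
    simp

/-- `G` has degree `d v` at each vertex `v`. -/
def Realizes (G : SimpleGraph V) (d : V → ℕ) : Prop :=
  ∀ v, #{u | G.Adj v u} = d v

/-- Exchanging the edges `R` for the non-edges `A`, where both lists cover every vertex equally
often, preserves all degrees. -/
theorem exists_exchange (G : SimpleGraph V) {d : V → ℕ} (hG : Realizes G d) (R A : List (V × V))
    (hR : ∀ e ∈ R, G.Adj e.1 e.2) (hRnd : (R.map fun e => s(e.1, e.2)).Nodup)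
    (hA : ∀ e ∈ A, e.1 ≠ e.2 ∧ ¬ G.Adj e.1 e.2) (hAnd : (A.map fun e => s(e.1, e.2)).Nodup)
    (hbal : ∀ φ : V → ℕ, (R.map fun e => φ e.1 + φ e.2).sum = (A.map fun e => φ e.1 + φ e.2).sum) :
    ∃ G' : SimpleGraph V, Realizes G' d ∧ ∀ u v, G'.Adj u v ↔
      (G.Adj u v ∧ s(u, v) ∉ R.map fun e => s(e.1, e.2)) ∨ s(u, v) ∈ A.map fun e => s(e.1, e.2) := by
  have hR' : ∀ u v, s(u, v) ∈ (R.map fun e => s(e.1, e.2)) → G.Adj u v := by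
    intro u v h
    obtain ⟨e, he, heq⟩ := List.mem_map.1 h
    rcases Sym2.eq_iff.1 heq with ⟨rfl, rfl⟩ | ⟨rfl, rfl⟩
    · exact hR e he
    · exact (hR e he).symm
  have hA' : ∀ u v, s(u, v) ∈ (A.map fun e => s(e.1, e.2)) → u ≠ v ∧ ¬ G.Adj u v := by
    intro u v h
    obtain ⟨e, he, heq⟩ := List.mem_map.1 h
    rcases Sym2.eq_iff.1 heq with ⟨rfl, rfl⟩ | ⟨rfl, rfl⟩
    · exact hA e he
    · exact ⟨(hA e he).1.symm, fun h' => (hA e he).2 h'.symm⟩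
  refine ⟨⟨fun u v => (G.Adj u v ∧ s(u, v) ∉ R.map fun e => s(e.1, e.2)) ∨
      s(u, v) ∈ A.map fun e => s(e.1, e.2), ⟨fun u v h => ?_⟩, ⟨fun u h => ?_⟩⟩, fun v => ?_,
      fun u v => Iff.rfl⟩
  · rw [Sym2.eq_swap, G.adj_comm]
    exact h
  · rcases h with h | h
    · exact G.loopless.irrefl u h.1
    · exact (hA' u u h).1 rfl
  · have hcR := card_filter_mem_edgeList v R hRnd fun e he => (hR e he).ne
    have hcA := card_filter_mem_edgeList v A hAnd fun e he => (hA e he).1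
    have hb := hbal fun u => if v = u then 1 else 0
    rw [← hcR, ← hcA] at hb
    have h1 : #{u | (G.Adj v u ∧ s(v, u) ∉ R.map fun e => s(e.1, e.2)) ∨
        s(v, u) ∈ A.map fun e => s(e.1, e.2)} =
        #{u | G.Adj v u ∧ s(v, u) ∉ R.map fun e => s(e.1, e.2)} +
        #{u | s(v, u) ∈ A.map fun e => s(e.1, e.2)} := by
      rw [Finset.filter_or, Finset.card_union_of_disjoint]
      rw [Finset.disjoint_left]
      intro u hu hu'
      simp only [Finset.mem_filter, Finset.mem_univ, true_and] at hu hu'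
      exact (hA' v u hu').2 hu.1
    have h2 : #{u | G.Adj v u} =
        #{u | G.Adj v u ∧ s(v, u) ∉ R.map fun e => s(e.1, e.2)} +
        #{u | s(v, u) ∈ R.map fun e => s(e.1, e.2)} := by
      rw [← Finset.card_union_of_disjoint]
      · congr 1
        ext u
        simp only [Finset.mem_filter, Finset.mem_univ, true_and, Finset.mem_union]
        constructor
        · intro h; by_cases h' : s(v, u) ∈ R.map fun e => s(e.1, e.2)
          · exact Or.inr h'
          · exact Or.inl ⟨h, h'⟩
        · rintro (h | h)
          · exact h.1
          · exact hR' v u h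
      · rw [Finset.disjoint_left]
        intro u hu hu'
        simp only [Finset.mem_filter, Finset.mem_univ, true_and] at hu hu'
        exact hu.2 hu'
    rw [← hG v, h2, hb, ← h1]
    congr!

/-- Some `r + 1` vertices of `G` span at least `K_{r+1} - (P₂ ∪ K₂)`. -/
def NearClique (r : ℕ) (G : SimpleGraph V) : Prop :=
  ∃ (R : Finset V) (v : Fin 5 → V), #R = r + 1 ∧ Function.Injective v ∧
    ∀ x ∈ R, ∀ y ∈ R, x ≠ y → ¬ G.Adj x y →
      s(x, y) = s(v 0, v 1) ∨ s(x, y) = s(v 1, v 2) ∨ s(x, y) = s(v 3, v 4)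

theorem nearClique_of_nodup {r : ℕ} {G : SimpleGraph V} {R : Finset V} (hR : #R = r + 1)
    (v₀ v₁ v₂ v₃ v₄ : V) (hnd : [v₀, v₁, v₂, v₃, v₄].Nodup)
    (h : ∀ x ∈ R, ∀ y ∈ R, x ≠ y → ¬ G.Adj x y →
      s(x, y) = s(v₀, v₁) ∨ s(x, y) = s(v₁, v₂) ∨ s(x, y) = s(v₃, v₄)) : NearClique r G := by
  refine ⟨R, ![v₀, v₁, v₂, v₃, v₄], hR, ?_, h⟩
  simp only [List.nodup_cons, List.mem_cons, not_or] at hnd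
  intro i j
  fin_cases i <;> fin_cases j <;> simp <;> grind

/-- A set of `r + 1` vertices with at most two non-adjacent pairs suffices. -/
theorem nearClique_of_two_holes {r : ℕ} {G : SimpleGraph V} (hV : 7 ≤ Fintype.card V)
    {R : Finset V} (hR : #R = r + 1) {a b c e : V} (hab : a ≠ b) (hce : c ≠ e)
    (h : ∀ x ∈ R, ∀ y ∈ R, x ≠ y → ¬ G.Adj x y → s(x, y) = s(a, b) ∨ s(x, y) = s(c, e)) :
    NearClique r G := by
  have hfresh : ∀ s : Finset V, #s ≤ 6 → ∃ v, v ∉ s := fun s hs => by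
    by_contra! hall
    have : s = Finset.univ := Finset.eq_univ_iff_forall.2 hall
    rw [this, Finset.card_univ] at hs
    omega
  obtain ⟨f, hf⟩ := hfresh {a, b, c, e} (Finset.card_le_four.trans (by norm_num))
  obtain ⟨g, hg⟩ := hfresh {a, b, c, e, f} (Finset.card_le_five.trans (by norm_num))
  obtain ⟨k, hk⟩ := hfresh {a, b, c, e, f, g} Finset.card_le_six
  simp only [Finset.mem_insert, Finset.mem_singleton, not_or] at hf hg hk
  by_cases hac : a = c
  · subst hac
    by_cases hbe : b = e
    · subst hbe
      exact nearClique_of_nodup hR a b f g k (by grind) (by grind)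
    · exact nearClique_of_nodup hR b a e f g (by grind) (by grind [Sym2.eq_swap])
  by_cases hae : a = e
  · subst hae
    by_cases hbc : b = c
    · subst hbc
      exact nearClique_of_nodup hR a b f g k (by grind) (by grind [Sym2.eq_swap])
    · exact nearClique_of_nodup hR b a c f g (by grind) (by grind [Sym2.eq_swap])
  by_cases hbc : b = c
  · subst hbc
    exact nearClique_of_nodup hR a b e f g (by grind) (by grind)
  by_cases hbe : b = e
  · subst hbe
    exact nearClique_of_nodup hR a b c f g (by grind) (by grind [Sym2.eq_swap])
  exact nearClique_of_nodup hR a b f c e (by grind) (by grind)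

/-- The number of ordered adjacent pairs inside `S`. -/
noncomputable def innerCount (S : Finset V) (G : SimpleGraph V) : ℕ :=
  #{e ∈ S ×ˢ S | G.Adj e.1 e.2}

/-- A realization of `d` with as many edges as possible inside `S`, while no realization of `d`
contains `K_{r+1} - (P₂ ∪ K₂)`. -/
structure Extremal (r : ℕ) (d : V → ℕ) (S : Finset V) (G : SimpleGraph V) : Prop where
  realizes : Realizes G d
  innerCount_le : ∀ G', Realizes G' d → innerCount S G' ≤ innerCount S G
  not_nearClique : ∀ G', Realizes G' d → ¬ NearClique r G'

variable {r : ℕ} {d : V → ℕ} {S : Finset V} {G : SimpleGraph V}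

/-- No exchange in an extremal realization removes only edges leaving `S` and adds an edge
inside `S`. -/
theorem Extremal.no_exchange (hG : Extremal r d S G) (R A : List (V × V))
    (hR : ∀ e ∈ R, G.Adj e.1 e.2 ∧ (e.1 ∉ S ∨ e.2 ∉ S))
    (hRnd : (R.map fun e => s(e.1, e.2)).Nodup)
    (hA : ∀ e ∈ A, e.1 ≠ e.2 ∧ ¬ G.Adj e.1 e.2) (hAnd : (A.map fun e => s(e.1, e.2)).Nodup)
    (hbal : ∀ φ : V → ℕ, (R.map fun e => φ e.1 + φ e.2).sum = (A.map fun e => φ e.1 + φ e.2).sum)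
    (hAS : ∃ e ∈ A, e.1 ∈ S ∧ e.2 ∈ S) : False := by
  obtain ⟨G', hreal, hadj⟩ := exists_exchange G hG.realizes R A (fun e he => (hR e he).1) hRnd hA
    hAnd hbal
  obtain ⟨e, heA, heS⟩ := hAS
  refine absurd (hG.innerCount_le G' hreal) (not_le.2 (Finset.card_lt_card ?_))
  rw [Finset.ssubset_iff_of_subset]
  · refine ⟨e, ?_, ?_⟩
    · simp only [Finset.mem_filter, Finset.mem_product, hadj]
      exact ⟨heS, Or.inr (List.mem_map.2 ⟨e, heA, rfl⟩)⟩
    · simp only [Finset.mem_filter, not_and]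
      exact fun _ => (hA e heA).2
  · intro f hf
    simp only [Finset.mem_filter, Finset.mem_product, hadj] at hf ⊢
    refine ⟨hf.1, Or.inl ⟨hf.2, fun h => ?_⟩⟩
    obtain ⟨e', he', heq⟩ := List.mem_map.1 h
    rcases Sym2.eq_iff.1 heq with ⟨h1, h2⟩ | ⟨h1, h2⟩ <;> have := (hR e' he').2 <;> grind

/-- Two outer neighbours of the ends of a hole in `S` are adjacent. -/
theorem Extremal.adj_of_hole (hG : Extremal r d S G) {x y a b : V} (hx : x ∈ S) (hy : y ∈ S)
    (hxy : x ≠ y) (hn : ¬ G.Adj x y) (ha : a ∉ S) (hb : b ∉ S) (hxa : G.Adj x a) (hyb : G.Adj y b)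
    (hab : a ≠ b) : G.Adj a b := by
  by_contra hnab
  refine hG.no_exchange [(x, a), (y, b)] [(x, y), (a, b)] ?_ ?_ ?_ ?_ ?_ ?_
  · simp [*]
  · simp; grind
  · simp [*]
  · simp; grind
  · intro φ; simp; ring
  · simp [*]

/-- An edge not inside `S` cannot link non-neighbours of outer neighbours of a hole. -/
theorem Extremal.no_link (hG : Extremal r d S G) {x y a b c e : V} (hx : x ∈ S) (hy : y ∈ S)
    (hxy : x ≠ y) (hn : ¬ G.Adj x y) (ha : a ∉ S) (hb : b ∉ S) (hxa : G.Adj x a) (hyb : G.Adj y b)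
    (hca : c ≠ a) (hnca : ¬ G.Adj c a) (heb : e ≠ b) (hneb : ¬ G.Adj e b) (hce : G.Adj c e)
    (hS : c ∉ S ∨ e ∉ S) : False := by
  have hcb : c ≠ b := by
    rintro rfl; exact hneb hce.symm
  have hea : e ≠ a := by
    rintro rfl; exact hnca hce
  have hne := hce.ne
  have hnca' : ¬ G.Adj a c := fun h => hnca h.symm
  refine hG.no_exchange [(x, a), (c, e), (b, y)] [(a, c), (e, b), (x, y)] ?_ ?_ ?_ ?_ ?_ ?_
  · simp [*, hyb.symm]
  · simp; grind
  · simp [*]; grind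
  · simp; grind [G.adj_comm]
  · intro φ; simp; ring
  · simp [*]

/-- The exchange along two edges at non-neighbours of outer neighbours of a
hole. -/
theorem Extremal.adj_of_adj (hG : Extremal r d S G) {x y a b w w' u u' : V} (hx : x ∈ S)
    (hy : y ∈ S) (hxy : x ≠ y) (hn : ¬ G.Adj x y) (ha : a ∉ S) (hb : b ∉ S) (hxa : G.Adj x a)
    (hyb : G.Adj y b) (hw : w ∉ S) (hw' : w' ∉ S) (hww' : w ≠ w') (hwa : w ≠ a)
    (hnwa : ¬ G.Adj w a) (hwb : w' ≠ b) (hnwb : ¬ G.Adj w' b) (hu : G.Adj w u)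
    (hu' : G.Adj w' u') (huu' : u ≠ u') : G.Adj u u' ∨ (u = x ∧ u' = y) := by
  by_contra! h
  have hune := hu.ne
  have hu'ne := hu'.ne
  have h1 := hG.adj_of_hole hx hy hxy hn ha hb hxa hyb
  have h2 := hG.adj_of_hole hx hy hxy hn ha hw' hxa
  have h3 := hG.adj_of_hole hx hy hxy hn hw hb
  have h4 := hG.adj_of_hole hx hy hxy hn hw' hb
  have h5 := hG.adj_of_hole hx hy hxy hn ha hw hxa
  have hxs : ∀ v, G.Adj v x ↔ G.Adj x v := fun v => G.adj_comm v x
  have hys : ∀ v, G.Adj v y ↔ G.Adj y v := fun v => G.adj_comm v y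
  have has : ∀ v, G.Adj v a ↔ G.Adj a v := fun v => G.adj_comm v a
  refine hG.no_exchange [(x, a), (w, u), (u', w'), (b, y)] [(a, w), (u, u'), (w', b), (x, y)]
    ?_ ?_ ?_ ?_ ?_ ?_
  · simp [*, hyb.symm, hu'.symm]
  · simp; grind [G.adj_comm]
  · simp [*]; grind
  · simp; grind [G.adj_comm]
  · intro φ; simp; ring
  · simp [*]

theorem Extremal.adj_of_adj_of_adj (hG : Extremal r d S G) {x y a b w w' u v u' : V} (hx : x ∈ S)
    (hy : y ∈ S) (hxy : x ≠ y) (hn : ¬ G.Adj x y) (ha : a ∉ S) (hb : b ∉ S) (hxa : G.Adj x a)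
    (hyb : G.Adj y b) (hw : w ∉ S) (hw' : w' ∉ S) (hww' : w ≠ w') (hwa : w ≠ a)
    (hnwa : ¬ G.Adj w a) (hwb : w' ≠ b) (hnwb : ¬ G.Adj w' b) (hu : G.Adj w u) (hv : G.Adj w v)
    (huv : u ≠ v) (hu' : G.Adj w' u') (hu'w : u' ≠ w) (hnu'w : ¬ G.Adj w u') (hu'a : u' ≠ a) :
    G.Adj u v ∨ s(u, v) = s(w', b) := by
  rw [Sym2.eq_iff]
  by_contra! h
  have hune := hu.ne
  have hu'ne := hu'.ne
  have hvne := hv.ne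
  have h2 := hG.adj_of_hole hx hy hxy hn ha hw' hxa
  have h3 := hG.adj_of_hole hx hy hxy hn hw hb
  have h5 := hG.adj_of_hole hx hy hxy hn ha hw hxa
  have h1 := hG.adj_of_hole hx hy hxy hn ha hb hxa hyb
  refine hG.no_exchange [(x, a), (w, u), (v, w), (u', w'), (b, y)]
    [(a, w), (u, v), (w, u'), (w', b), (x, y)] ?_ ?_ ?_ ?_ ?_ ?_
  · simp [*, hyb.symm, hu'.symm, hv.symm]
  · simp; grind [G.adj_comm]
  · simp [*]; grind [G.adj_comm]
  · simp; grind [G.adj_comm]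
  · intro φ; simp; ring
  · simp [*]

theorem Extremal.neighbor_sub_of_nonadj (hG : Extremal r d S G) {x y a b w w' : V} (hx : x ∈ S)
    (hy : y ∈ S) (hxy : x ≠ y) (hn : ¬ G.Adj x y) (ha : a ∉ S) (hb : b ∉ S) (hxa : G.Adj x a)
    (hyb : G.Adj y b) (hw : w ∉ S) (hw' : w' ∉ S) (hww' : w ≠ w') (hwa : w ≠ a)
    (hnwa : ¬ G.Adj w a) (hwb : w' ≠ b) (hnwb : ¬ G.Adj w' b) (hr : 1 ≤ r)
    (hdw : r ≤ #{u | G.Adj w u} + 1) {u' : V} (hu' : G.Adj w' u') :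
    G.Adj w u' ∨ u' = w ∨ u' = a := by
  by_contra! h
  have hxw' : ¬ G.Adj w' x := fun hxw => hnwb
    (hG.adj_of_hole hx hy hxy hn hw' hb hxw.symm hyb hwb)
  have hw'ne := hu'.ne
  have hwb' : w ≠ b := by
    rintro rfl
    exact hnwa (hG.adj_of_hole hx hy hxy hn ha hb hxa hyb hwa.symm).symm
  obtain ⟨R₀, hR₀, hcard⟩ := Finset.exists_subset_card_eq
    (show r - 1 ≤ #{u | G.Adj w u} by omega)
  have hmem : ∀ u ∈ R₀, G.Adj w u := fun u hu => by simpa using hR₀ hu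
  have hwR : w ∉ R₀ := fun hw => (hmem w hw).ne rfl
  have hu'R : u' ∉ R₀ := fun hu => h.1 (hmem u' hu)
  refine hG.not_nearClique G hG.realizes
    (nearClique_of_nodup (R := insert w (insert u' R₀)) ?_ w u' x w' b ?_ ?_)
  · rw [Finset.card_insert_of_notMem, Finset.card_insert_of_notMem hu'R, hcard]
    · omega
    · simp [hwR, h.2.1.symm]
  · grind [G.adj_comm]
  · have hC : ∀ u ∈ R₀, G.Adj u u' ∨ u = x := fun u hu =>
      (hG.adj_of_adj hx hy hxy hn ha hb hxa hyb hw hw' hww' hwa hnwa hwb hnwb (hmem u hu) hu'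
        (by rintro rfl; exact hu'R hu)).imp_right And.left
    have hF : ∀ u ∈ R₀, ∀ v ∈ R₀, u ≠ v → G.Adj u v ∨ s(u, v) = s(w', b) := fun u hu v hv huv =>
      hG.adj_of_adj_of_adj hx hy hxy hn ha hb hxa hyb hw hw' hww' hwa hnwa hwb hnwb (hmem u hu)
        (hmem v hv) huv hu' h.2.1 h.1 h.2.2
    intro p hp q hq hpq hnadj
    simp only [Finset.mem_insert] at hp hq
    grind [G.adj_comm, Sym2.eq_swap]

/-- Two outer vertices of large degree cannot be missed by outer neighbours of the two ends of a
hole. -/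
theorem Extremal.no_missed_pair (hG : Extremal r d S G) (hV : 7 ≤ Fintype.card V)
    {x y a b w w' : V} (hx : x ∈ S)
    (hy : y ∈ S) (hxy : x ≠ y) (hn : ¬ G.Adj x y) (ha : a ∉ S) (hb : b ∉ S) (hxa : G.Adj x a)
    (hyb : G.Adj y b) (hw : w ∉ S) (hw' : w' ∉ S) (hww' : w ≠ w') (hwa : w ≠ a)
    (hnwa : ¬ G.Adj w a) (hwb : w' ≠ b) (hnwb : ¬ G.Adj w' b) (hr : 5 ≤ r)
    (hdw : r ≤ #{u | G.Adj w u} + 1) (hdw' : r ≤ #{u | G.Adj w' u} + 1) : False := by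
  have hsub' : ∀ u, G.Adj w' u → G.Adj w u ∨ u = w ∨ u = a := fun u hu =>
    hG.neighbor_sub_of_nonadj hx hy hxy hn ha hb hxa hyb hw hw' hww' hwa hnwa hwb hnwb
      (by omega) hdw hu
  have hsub : ∀ u, G.Adj w u → G.Adj w' u ∨ u = w' ∨ u = b := fun u hu =>
    hG.neighbor_sub_of_nonadj hy hx hxy.symm (fun h => hn h.symm) hb ha hyb hxa hw' hw hww'.symm
      hwb hnwb hwa hnwa (by omega) hdw' hu
  have hxw' : ¬ G.Adj w' x := fun hxw => hnwb
    (hG.adj_of_hole hx hy hxy hn hw' hb hxw.symm hyb hwb)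
  have hC : ∀ u u', G.Adj w u → G.Adj w' u' → u ≠ u' → G.Adj u u' := fun u u' hu hu' huu' => by
    rcases hG.adj_of_adj hx hy hxy hn ha hb hxa hyb hw hw' hww' hwa hnwa hwb hnwb hu hu' huu' with
      h | ⟨rfl, rfl⟩
    · exact h
    · rcases hsub u hu with h | rfl | rfl
      · exact absurd h hxw'
      · exact absurd hx hw'
      · exact absurd hx hb
  set I : Finset V := {u | G.Adj w u ∧ G.Adj w' u} with hI
  have hmemI : ∀ u, u ∈ I ↔ G.Adj w u ∧ G.Adj w' u := fun u => by simp [hI]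
  have haI : a ∉ I := fun h => hnwa ((hmemI a).1 h).1
  have hbI : b ∉ I := fun h => hnwb ((hmemI b).1 h).2
  have hwI : w ∉ I := fun h => ((hmemI w).1 h).1.ne rfl
  have hw'I : w' ∉ I := fun h => ((hmemI w').1 h).2.ne rfl
  have hwin := hG.not_nearClique G hG.realizes
  by_cases hlarge : r - 1 ≤ #I
  · obtain ⟨R₀, hR₀, hcard⟩ := Finset.exists_subset_card_eq hlarge
    refine hwin (nearClique_of_two_holes hV (R := insert w (insert w' R₀)) ?_ hww' hww' ?_)
    · rw [Finset.card_insert_of_notMem, Finset.card_insert_of_notMem (fun h => hw'I (hR₀ h)), hcard]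
      · omega
      · simp only [Finset.mem_insert, not_or]
        exact ⟨hww', fun h => hwI (hR₀ h)⟩
    · intro p hp q hq hpq hnadj
      have h1 : ∀ u ∈ R₀, G.Adj w u ∧ G.Adj w' u := fun u hu => (hmemI u).1 (hR₀ hu)
      simp only [Finset.mem_insert] at hp hq
      grind [G.adj_comm, Sym2.eq_swap]
  by_cases hadj : G.Adj w w'
  · by_cases hmid : r - 2 ≤ #I
    · have haw' : a ≠ w' := by
        rintro rfl; exact hnwa hadj
      refine hwin (nearClique_of_two_holes hV (R := insert w (insert w' (insert a I))) ?_
        hwa.symm haw' ?_)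
      · rw [Finset.card_insert_of_notMem, Finset.card_insert_of_notMem,
          Finset.card_insert_of_notMem haI]
        · omega
        · simp [haw'.symm, hw'I]
        · simp [hww', hwa, hwI]
      · have haI' : ∀ u ∈ I, G.Adj u a := fun u hu => by
          by_contra hua
          exact hG.no_link hx hy hxy hn ha hb hxa hyb (by rintro rfl; exact haI hu) hua hwb hnwb
            ((hmemI u).1 hu).2.symm (Or.inr hw')
        intro p hp q hq hpq hnadj
        simp only [Finset.mem_insert] at hp hq
        grind [G.adj_comm, Sym2.eq_swap]
    · have hN : ({u | G.Adj w u} : Finset V) ⊆ insert w' (I ∪ {b}) := fun u hu => by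
        simp only [Finset.mem_filter, Finset.mem_univ, true_and] at hu
        have := hsub u hu
        simp only [Finset.mem_insert, Finset.mem_union, Finset.mem_singleton, hmemI]
        tauto
      have hN' : ({u | G.Adj w' u} : Finset V) ⊆ insert w (I ∪ {a}) := fun u hu => by
        simp only [Finset.mem_filter, Finset.mem_univ, true_and] at hu
        have := hsub' u hu
        simp only [Finset.mem_insert, Finset.mem_union, Finset.mem_singleton, hmemI]
        tauto
      have hcard : #(I ∪ {b}) ≤ #I + 1 := Finset.card_union_le _ _
      have hwb' : G.Adj w b := by
        by_contra hnb
        have : ({u | G.Adj w u} : Finset V) ⊆ insert w' I := fun u hu => by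
          have h1 := hN hu
          simp only [Finset.mem_filter, Finset.mem_univ, true_and] at hu
          simp only [Finset.mem_insert, Finset.mem_union, Finset.mem_singleton] at h1 ⊢
          grind
        have := Finset.card_le_card this
        have := Finset.card_insert_le w' I
        omega
      have hwa' : G.Adj w' a := by
        by_contra hna
        have : ({u | G.Adj w' u} : Finset V) ⊆ insert w I := fun u hu => by
          have h1 := hN' hu
          simp only [Finset.mem_filter, Finset.mem_univ, true_and] at hu
          simp only [Finset.mem_insert, Finset.mem_union, Finset.mem_singleton] at h1 ⊢
          grind
        have := Finset.card_le_card this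
        have := Finset.card_insert_le w I
        omega
      have hcardI : r - 3 ≤ #I := by
        have := Finset.card_le_card hN
        have := Finset.card_insert_le w' (I ∪ {b})
        omega
      have hab : a ≠ b := by
        rintro rfl; exact hnwb hwa'
      have haw' := hwa'.ne
      have hbw := hwb'.ne
      refine hwin (nearClique_of_two_holes hV (R := insert w (insert w' (insert a (insert b I)))) ?_
        hwa hwb ?_)
      · rw [Finset.card_insert_of_notMem, Finset.card_insert_of_notMem,
          Finset.card_insert_of_notMem, Finset.card_insert_of_notMem hbI]
        · omega
        · simp [hab, haI]
        · simp [haw', hwb, hw'I]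
        · simp [hww', hwa, hbw, hwI]
      · have := hC b a hwb' hwa' hab.symm
        intro p hp q hq hpq hnadj
        simp only [Finset.mem_insert, hmemI] at hp hq
        grind [G.adj_comm, Sym2.eq_swap]
  · have hN : ({u | G.Adj w u} : Finset V) ⊆ insert b I := fun u hu => by
      simp only [Finset.mem_filter, Finset.mem_univ, true_and] at hu
      have := hsub u hu
      simp only [Finset.mem_insert, hmemI]
      grind
    have hN' : ({u | G.Adj w' u} : Finset V) ⊆ insert a I := fun u hu => by
      simp only [Finset.mem_filter, Finset.mem_univ, true_and] at hu
      have := hsub' u hu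
      simp only [Finset.mem_insert, hmemI]
      grind [G.adj_comm]
    have hwb' : G.Adj w b := by
      by_contra hnb
      have : ({u | G.Adj w u} : Finset V) ⊆ I := fun u hu => by
        have h1 := hN hu
        simp only [Finset.mem_filter, Finset.mem_univ, true_and] at hu
        simp only [Finset.mem_insert] at h1
        grind
      have := Finset.card_le_card this
      omega
    have hwa' : G.Adj w' a := by
      by_contra hna
      have : ({u | G.Adj w' u} : Finset V) ⊆ I := fun u hu => by
        have h1 := hN' hu
        simp only [Finset.mem_filter, Finset.mem_univ, true_and] at hu
        simp only [Finset.mem_insert] at h1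
        grind
      have := Finset.card_le_card this
      omega
    have hcardI : r - 2 ≤ #I := by
      have := Finset.card_le_card hN
      have := Finset.card_insert_le b I
      omega
    have hab : a ≠ b := by
      rintro rfl; exact hnwb hwa'
    have hbw := hwb'.ne
    refine hwin (nearClique_of_two_holes hV (R := insert w (insert a (insert b I))) ?_
      hwa hwa ?_)
    · rw [Finset.card_insert_of_notMem, Finset.card_insert_of_notMem,
        Finset.card_insert_of_notMem hbI]
      · omega
      · simp [hab, haI]
      · simp [hwa, hbw, hwI]
    · have := hC b a hwb' hwa' hab.symm
      intro p hp q hq hpq hnadj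
      simp only [Finset.mem_insert, hmemI] at hp hq
      grind [G.adj_comm, Sym2.eq_swap]

/-- The number of neighbours of `v` in `A`. -/
noncomputable def degIn (A : Finset V) (G : SimpleGraph V) (v : V) : ℕ :=
  #{u ∈ A | G.Adj v u}

theorem Realizes.degIn_add_degIn_compl (hG : Realizes G d) (S : Finset V) (v : V) :
    degIn S G v + degIn Sᶜ G v = d v := by
  rw [← hG v, degIn, degIn, ← Finset.card_union_of_disjoint]
  · congr 1
    ext u
    simp only [Finset.mem_union, Finset.mem_filter, Finset.mem_compl, Finset.mem_univ, true_and]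
    tauto
  · rw [Finset.disjoint_left]
    intro u hu hu'
    simp only [Finset.mem_filter, Finset.mem_compl] at hu hu'
    exact hu'.1 hu.1

theorem degIn_pos {A : Finset V} {v u : V} (hu : u ∈ A) (h : G.Adj v u) : 1 ≤ degIn A G v :=
  Finset.card_pos.2 ⟨u, by simp [hu, h]⟩

theorem exists_adj_of_degIn_pos {A : Finset V} {v : V} (h : 1 ≤ degIn A G v) :
    ∃ u ∈ A, G.Adj v u := by
  obtain ⟨u, hu⟩ := Finset.card_pos.1 h
  exact ⟨u, by simpa using hu⟩

/-- Two graphs that differ only by edges between `S` and its complement, with the same degrees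
in both parts. -/
structure SameProfile (S : Finset V) (G G' : SimpleGraph V) : Prop where
  adj_inside : ∀ u ∈ S, ∀ v ∈ S, (G'.Adj u v ↔ G.Adj u v)
  adj_outside : ∀ u ∉ S, ∀ v ∉ S, (G'.Adj u v ↔ G.Adj u v)
  degIn_eq : ∀ v, degIn S G' v = degIn S G v
  degIn_compl_eq : ∀ v, degIn Sᶜ G' v = degIn Sᶜ G v

/-- Switching two edges between `S` and its complement. -/
theorem Extremal.exists_switch (hG : Extremal r d S G) {p p' q q' : V} (hp : p ∈ S) (hp' : p' ∈ S)
    (hq : q ∉ S) (hq' : q' ∉ S) (hpq : G.Adj p q) (hpq' : G.Adj p' q') (hn : ¬ G.Adj p q')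
    (hn' : ¬ G.Adj p' q) :
    ∃ G', Extremal r d S G' ∧ SameProfile S G G' ∧
      ∀ u v, G'.Adj u v ↔ (G.Adj u v ∧ s(u, v) ≠ s(p, q) ∧ s(u, v) ≠ s(p', q')) ∨
        s(u, v) = s(p, q') ∨ s(u, v) = s(p', q) := by
  have hpp : p ≠ p' := by
    rintro rfl; exact hn hpq'
  have hqq : q ≠ q' := by
    rintro rfl; exact hn hpq
  obtain ⟨G', hreal, hadj⟩ := exists_exchange G hG.realizes [(p, q), (p', q')] [(p, q'), (p', q)]
    (by simp [*]) (by simp; grind) (by simp [*]; grind) (by simp; grind)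
    (by intro φ; simp; ring)
  have hadj' : ∀ u v, G'.Adj u v ↔ (G.Adj u v ∧ s(u, v) ≠ s(p, q) ∧ s(u, v) ≠ s(p', q')) ∨
        s(u, v) = s(p, q') ∨ s(u, v) = s(p', q) := fun u v => by
    rw [hadj]; simp only [List.map_cons, List.map_nil, List.mem_cons, List.not_mem_nil, or_false,
      not_or, ne_eq]
  have hin : ∀ u ∈ S, ∀ v ∈ S, (G'.Adj u v ↔ G.Adj u v) := fun u hu v hv => by
    rw [hadj']; simp only [ne_eq, Sym2.eq_iff]; grind
  have hout : ∀ u ∉ S, ∀ v ∉ S, (G'.Adj u v ↔ G.Adj u v) := fun u hu v hv => by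
    rw [hadj']; simp only [ne_eq, Sym2.eq_iff]; grind
  have hdin : ∀ v ∈ S, degIn S G' v = degIn S G v := fun v hv => by
    unfold degIn
    congr 1
    exact Finset.filter_congr fun u hu => hin v hv u hu
  have hdout : ∀ v ∉ S, degIn Sᶜ G' v = degIn Sᶜ G v := fun v hv => by
    unfold degIn
    congr 1
    exact Finset.filter_congr fun u hu => hout v hv u (Finset.mem_compl.1 hu)
  have hsum : ∀ v, degIn S G' v + degIn Sᶜ G' v = degIn S G v + degIn Sᶜ G v := fun v => by
    rw [hreal.degIn_add_degIn_compl, hG.realizes.degIn_add_degIn_compl]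
  refine ⟨G', ⟨hreal, fun G'' h => (hG.innerCount_le G'' h).trans_eq ?_, hG.not_nearClique⟩,
    ⟨hin, hout, fun v => ?_, fun v => ?_⟩, hadj'⟩
  · unfold innerCount
    congr 1
    refine Finset.filter_congr fun e he => ?_
    rw [Finset.mem_product] at he
    exact (hin _ he.1 _ he.2).symm
  · by_cases hv : v ∈ S
    · exact hdin v hv
    · have := hdout v hv
      have := hsum v
      omega
  · by_cases hv : v ∈ S
    · have := hdin v hv
      have := hsum v
      omega
    · exact hdout v hv

/-- The vertex sets and degree bounds: `S` consists of `r + 1` vertices of largest degree and `W`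
of `r + 1` further vertices. -/
structure DegreeSetup (r : ℕ) (d : V → ℕ) (S W : Finset V) : Prop where
  five_le : 5 ≤ r
  card_S : #S = r + 1
  card_W : #W = r + 1
  notMem : ∀ w ∈ W, w ∉ S
  top : ∀ p ∈ S, ∀ q ∉ S, d q ≤ d p
  degree_W : ∀ w ∈ W, r ≤ d w + 1

variable {W : Finset V}

theorem DegreeSetup.seven_le_card (h : DegreeSetup r d S W) : 7 ≤ Fintype.card V := by
  have hd : Disjoint S W := Finset.disjoint_left.2 fun v hv hw => h.notMem v hw hv
  have h1 := Finset.card_le_univ (S ∪ W)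
  rw [Finset.card_union_of_disjoint hd, h.card_S, h.card_W] at h1
  have := h.five_le
  omega

/-- A hole `xy` in `S` with outer neighbours `a` of `x` and `b` of `y`, where `a` has as many
neighbours as possible in `S` and then outside `S`. -/
structure Anchored (S : Finset V) (G : SimpleGraph V) (x y a b : V) : Prop where
  hx : x ∈ S
  hy : y ∈ S
  hxy : x ≠ y
  hn : ¬ G.Adj x y
  ha : a ∉ S
  hb : b ∉ S
  hxa : G.Adj x a
  hyb : G.Adj y b
  max : ∀ q ∉ S, degIn S G q < degIn S G a ∨
    (degIn S G q = degIn S G a ∧ degIn Sᶜ G q ≤ degIn Sᶜ G a)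

variable {x y a b : V}

theorem Anchored.degIn_le (h : Anchored S G x y a b) {q : V} (hq : q ∉ S) :
    degIn S G q ≤ degIn S G a := by
  rcases h.max q hq with h | h <;> omega

theorem SameProfile.anchored {G' : SimpleGraph V} (hP : SameProfile S G G')
    (h : Anchored S G x y a b) {b' : V} (hb' : b' ∉ S) (hxa : G'.Adj x a) (hyb : G'.Adj y b') :
    Anchored S G' x y a b' where
  hx := h.hx
  hy := h.hy
  hxy := h.hxy
  hn := by rw [hP.adj_inside x h.hx y h.hy]; exact h.hn
  ha := h.ha
  hb := hb'
  hxa := hxa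
  hyb := hyb
  max := by simpa only [hP.degIn_eq, hP.degIn_compl_eq] using h.max

theorem exists_adj_of_degIn_le {q q' y : V} (hle : degIn S G q' ≤ degIn S G q) (hy : y ∈ S)
    (hyq' : G.Adj y q') (hnyq : ¬ G.Adj y q) : ∃ p ∈ S, G.Adj p q ∧ ¬ G.Adj p q' := by
  by_contra! hall
  refine absurd hle (not_le.2 (Finset.card_lt_card ?_))
  rw [Finset.ssubset_iff_of_subset]
  · exact ⟨y, by simp [hy, hyq'.symm], by simpa [hy, G.adj_comm] using hnyq⟩
  · intro p hp
    simp only [Finset.mem_filter] at hp ⊢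
    exact ⟨hp.1, (hall p hp.1 hp.2.symm).symm⟩

theorem Extremal.exists_anchored (hG : Extremal r d S G) (hx : x ∈ S) (hy : y ∈ S) (hxy : x ≠ y)
    (hn : ¬ G.Adj x y) (hex : 1 ≤ degIn Sᶜ G x) (hey : 1 ≤ degIn Sᶜ G y) :
    ∃ G' a b, Extremal r d S G' ∧ Anchored S G' x y a b := by
  obtain ⟨c, hc, hxc⟩ := exists_adj_of_degIn_pos hex
  obtain ⟨a, ha, hmax⟩ := Finset.exists_max_image Sᶜ
    (fun q => toLex (degIn S G q, degIn Sᶜ G q)) ⟨c, hc⟩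
  rw [Finset.mem_compl] at ha hc
  have hmax' : ∀ q ∉ S, degIn S G q < degIn S G a ∨
      (degIn S G q = degIn S G a ∧ degIn Sᶜ G q ≤ degIn Sᶜ G a) := fun q hq => by
    simpa [Prod.Lex.le_iff] using hmax q (Finset.mem_compl.2 hq)
  by_cases hxa : G.Adj x a
  · obtain ⟨b, hb, hyb⟩ := exists_adj_of_degIn_pos hey
    exact ⟨G, a, b, hG, hx, hy, hxy, hn, ha, Finset.mem_compl.1 hb, hxa, hyb, hmax'⟩
  · have hle : degIn S G c ≤ degIn S G a := by
      rcases hmax' c hc with h | h <;> omega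
    obtain ⟨p, hp, hpa, hpc⟩ := exists_adj_of_degIn_le hle hx hxc hxa
    obtain ⟨G', hG', hP, hadj⟩ := hG.exists_switch hp hx ha hc hpa hxc hpc hxa
    rw [← hP.degIn_compl_eq] at hey
    obtain ⟨b, hb, hyb⟩ := exists_adj_of_degIn_pos hey
    refine ⟨G', a, b, hG', hx, hy, hxy, ?_, ha, Finset.mem_compl.1 hb, ?_, hyb, ?_⟩
    · rwa [hP.adj_inside x hx y hy]
    · rw [hadj]; exact Or.inr (Or.inr rfl)
    · simpa only [hP.degIn_eq, hP.degIn_compl_eq] using hmax'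

/-- The vertices of `W` other than `a` not adjacent to `a`. -/
noncomputable def missed (W : Finset V) (G : SimpleGraph V) (a : V) : Finset V :=
  {w ∈ W | w ≠ a ∧ ¬ G.Adj w a}

theorem mem_missed {w : V} : w ∈ missed W G a ↔ w ∈ W ∧ w ≠ a ∧ ¬ G.Adj w a := by
  simp [missed]

theorem DegreeSetup.sub_neighbors (hS : DegreeSetup r d S W) (G : SimpleGraph V) (a : V) :
    (W.erase a) \ missed W G a ⊆ {u ∈ Sᶜ | G.Adj a u} := fun w hw => by
  simp only [Finset.mem_sdiff, Finset.mem_erase, mem_missed, not_and, not_not] at hw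
  simp only [Finset.mem_filter, Finset.mem_compl]
  exact ⟨hS.notMem w hw.1.2, (hw.2 hw.1.2 hw.1.1).symm⟩

theorem DegreeSetup.le_degIn_compl_add (hS : DegreeSetup r d S W) (G : SimpleGraph V) (a : V) :
    r ≤ degIn Sᶜ G a + #(missed W G a) := by
  have h1 := Finset.card_le_card (hS.sub_neighbors G a)
  have h2 := Finset.le_card_sdiff (missed W G a) (W.erase a)
  have h3 := Finset.pred_card_le_card_erase (s := W) (a := a)
  have h4 := hS.card_W
  unfold degIn
  omega

theorem Extremal.missed_eq (hG : Extremal r d S G) (hS : DegreeSetup r d S W)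
    (h : Anchored S G x y a b) {w w' : V} (hw : w ∈ missed W G a) (hw' : w' ∈ missed W G b) :
    w = w' := by
  by_contra hne
  rw [mem_missed] at hw hw'
  have hdeg : ∀ w ∈ W, r ≤ #{u | G.Adj w u} + 1 := fun w hw => by
    rw [hG.realizes w]; exact hS.degree_W w hw
  exact hG.no_missed_pair hS.seven_le_card h.hx h.hy h.hxy h.hn h.ha h.hb h.hxa h.hyb
    (hS.notMem w hw.1) (hS.notMem w' hw'.1) hne hw.2.1 hw.2.2 hw'.2.1 hw'.2.2 hS.five_le
    (hdeg w hw.1) (hdeg w' hw'.1)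

theorem Extremal.card_missed_le_one (hG : Extremal r d S G) (hS : DegreeSetup r d S W)
    (h : Anchored S G x y a b) (hlt : degIn Sᶜ G a < r) : #(missed W G a) ≤ 1 := by
  by_contra hcard
  obtain ⟨w, hw, w', hw', hne⟩ := Finset.one_lt_card.1 (not_le.1 hcard)
  by_cases hya : G.Adj y a
  · exact hne (hG.missed_eq hS { h with hb := h.ha, hyb := hya } hw hw')
  have hempty : missed W G b = ∅ := by
    by_contra hne'
    obtain ⟨v, hv⟩ := Finset.nonempty_iff_ne_empty.2 hne'
    exact hne ((hG.missed_eq hS h hw hv).trans (hG.missed_eq hS h hw' hv).symm)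
  have hout : r ≤ degIn Sᶜ G b := by
    have := hS.le_degIn_compl_add G b
    rwa [hempty, Finset.card_empty] at this
  have hin : degIn S G b < degIn S G a := by
    rcases h.max b h.hb with h | h <;> omega
  obtain ⟨p, hp, hpx, hpa, hpb⟩ : ∃ p ∈ S, p ≠ x ∧ G.Adj p a ∧ ¬ G.Adj p b := by
    by_contra! hall
    have hsub : ({u ∈ S | G.Adj a u} : Finset V) ⊆
        insert x (({u ∈ S | G.Adj b u} : Finset V).erase y) := fun p hp => by
      simp only [Finset.mem_filter, Finset.mem_insert, Finset.mem_erase] at hp ⊢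
      by_cases hpx : p = x
      · exact Or.inl hpx
      · refine Or.inr ⟨?_, hp.1, (hall p hp.1 hpx hp.2.symm).symm⟩
        rintro rfl
        exact hya hp.2.symm
    have h1 := Finset.card_le_card hsub
    have h2 := Finset.card_insert_le x (({u ∈ S | G.Adj b u} : Finset V).erase y)
    have h3 := Finset.card_erase_add_one (s := ({u ∈ S | G.Adj b u} : Finset V)) (a := y)
      (by simp [h.hy, h.hyb.symm])
    unfold degIn at hin
    omega
  obtain ⟨G', hG', hP, hadj⟩ := hG.exists_switch hp h.hy h.ha h.hb hpa h.hyb hpb hya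
  have hmissed : missed W G' a = missed W G a := by
    ext v
    simp only [mem_missed]
    refine and_congr_right fun hv => ?_
    rw [hP.adj_outside v (hS.notMem v hv) a h.ha]
  have hxa : G'.Adj x a := by
    rw [hadj]
    refine Or.inl ⟨h.hxa, ?_, ?_⟩ <;> simp only [ne_eq, Sym2.eq_iff]
    · have := h.hx; have := h.ha; grind
    · have := h.hx; have := h.hb; have := h.hxy; grind
  have hA := hP.anchored h h.ha hxa (by rw [hadj]; exact Or.inr (Or.inr rfl))
  rw [← hmissed] at hw hw'
  exact hne (hG'.missed_eq hS hA hw hw')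

/-- The vertices of `S` with an outer neighbour that is neither `a` nor adjacent to `a`. -/
noncomputable def escaping (S : Finset V) (G : SimpleGraph V) (a : V) : Finset V :=
  {p ∈ S | ∃ q, q ∉ S ∧ G.Adj p q ∧ q ≠ a ∧ ¬ G.Adj q a}

theorem mem_escaping {p : V} :
    p ∈ escaping S G a ↔ p ∈ S ∧ ∃ q, q ∉ S ∧ G.Adj p q ∧ q ≠ a ∧ ¬ G.Adj q a := by
  simp [escaping]

theorem Extremal.adj_of_mem_escaping (hG : Extremal r d S G) (h : Anchored S G x y a b) {p : V}
    (hp : p ∈ escaping S G a) : G.Adj p b := by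
  obtain ⟨hpS, q, hq, hpq, hqa, hnqa⟩ := mem_escaping.1 hp
  by_contra hpb
  refine hG.no_link h.hx h.hy h.hxy h.hn h.ha h.hb h.hxa h.hyb hqa hnqa ?_ hpb hpq.symm (Or.inl hq)
  rintro rfl
  exact h.hb hpS

theorem Extremal.notMem_escaping (hG : Extremal r d S G) (h : Anchored S G x y a b) :
    y ∉ escaping S G a := fun hy => by
  obtain ⟨hpS, q, hq, hpq, hqa, hnqa⟩ := mem_escaping.1 hy
  exact hnqa (hG.adj_of_hole h.hx h.hy h.hxy h.hn h.ha hq h.hxa hpq hqa.symm).symm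

theorem Extremal.escaping_subset (hG : Extremal r d S G) (h : Anchored S G x y a b) :
    escaping S G a ⊆ {u ∈ S | G.Adj b u} := fun p hp => by
  simp only [Finset.mem_filter]
  exact ⟨(mem_escaping.1 hp).1, (hG.adj_of_mem_escaping h hp).symm⟩

theorem Extremal.card_escaping_le (hG : Extremal r d S G) (h : Anchored S G x y a b) :
    #(escaping S G a) ≤ degIn S G a :=
  (Finset.card_le_card (hG.escaping_subset h)).trans (h.degIn_le h.hb)

theorem Extremal.card_sdiff_escaping_add_le (hG : Extremal r d S G) (h : Anchored S G x y a b)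
    {q : V} (hq : q ∉ S) :
    #({u ∈ S | G.Adj q u} \ escaping S G a) + #(escaping S G a) ≤ degIn S G a := by
  by_contra hgt
  set D := escaping S G a with hD
  obtain ⟨δ, hδ, hδq⟩ : ∃ δ ∈ D, ¬ G.Adj q δ := by
    by_contra! hall
    have hsub : D ⊆ {u ∈ S | G.Adj q u} := fun p hp => by
      simp only [Finset.mem_filter]
      exact ⟨(mem_escaping.1 hp).1, hall p hp⟩
    rw [Finset.card_sdiff_add_card_eq_card hsub] at hgt
    exact hgt (h.degIn_le hq)
  have hδb := hG.adj_of_mem_escaping h hδ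
  have hyD : y ∉ D := hG.notMem_escaping h
  have hDb := Finset.card_sdiff_add_card_eq_card (hG.escaping_subset h)
  rw [← hD] at hDb
  have hba := h.degIn_le h.hb
  unfold degIn at hba hgt
  obtain ⟨p, hp, hpq, hpD, hpb, hpx⟩ :
      ∃ p ∈ S, G.Adj q p ∧ p ∉ D ∧ ¬ G.Adj b p ∧ (q = a → p ≠ x) := by
    by_contra! hall
    by_cases hqa : q = a
    · subst hqa
      have hya : ¬ G.Adj q y := fun hya => hδq
        (hG.adj_of_mem_escaping { h with hb := h.ha, hyb := hya.symm } hδ).symm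
      have hsub : ({u ∈ S | G.Adj q u} \ D : Finset V) ⊆
          insert x (({u ∈ S | G.Adj b u} \ D : Finset V).erase y) := fun p hp => by
        simp only [Finset.mem_sdiff, Finset.mem_filter, Finset.mem_insert, Finset.mem_erase] at hp ⊢
        by_cases hpb : G.Adj b p
        · refine Or.inr ⟨?_, ⟨hp.1.1, hpb⟩, hp.2⟩
          rintro rfl
          exact hya hp.1.2
        · exact Or.inl (hall p hp.1.1 hp.1.2 hp.2 hpb).2
      have h1 := Finset.card_le_card hsub
      have h2 := Finset.card_insert_le x (({u ∈ S | G.Adj b u} \ D : Finset V).erase y)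
      have h3 := Finset.card_erase_add_one (s := ({u ∈ S | G.Adj b u} \ D : Finset V)) (a := y)
        (by simp [h.hy, h.hyb.symm, hyD])
      omega
    · have hsub : ({u ∈ S | G.Adj q u} \ D : Finset V) ⊆ ({u ∈ S | G.Adj b u} \ D : Finset V) :=
        fun p hp => by
          simp only [Finset.mem_sdiff, Finset.mem_filter] at hp ⊢
          by_cases hpb : G.Adj b p
          · exact ⟨⟨hp.1.1, hpb⟩, hp.2⟩
          · exact absurd (hall p hp.1.1 hp.1.2 hp.2 hpb).1 hqa
      have h1 := Finset.card_le_card hsub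
      omega
  obtain ⟨hδS, c, hc, hδc, hca, hnca⟩ := mem_escaping.1 hδ
  obtain ⟨G', hG', hP, hadj⟩ := hG.exists_switch hδS hp h.hb hq hδb hpq.symm
    (fun h => hδq h.symm) (fun h => hpb h.symm)
  have hbq : b ≠ q := by
    rintro rfl; exact hδq hδb.symm
  have hcb : c ≠ b := by
    rintro rfl
    exact hnca (hG.adj_of_hole h.hx h.hy h.hxy h.hn h.ha h.hb h.hxa h.hyb hca.symm).symm
  have hδp : δ ≠ p := by
    rintro rfl; exact hpD hδ
  have hyδ : y ≠ δ := by
    rintro rfl; exact hyD hδ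
  have hxδ : ¬ (x = δ ∧ a = b) := by
    rintro ⟨rfl, rfl⟩
    exact hnca (hG.adj_of_hole h.hx h.hy h.hxy h.hn hc h.ha hδc h.hyb hca)
  have hneS : ∀ u v, u ∈ S → v ∉ S → u ≠ v := fun u v hu hv huv => hv (huv ▸ hu)
  have hxa : G'.Adj x a := by
    rw [hadj]
    refine Or.inl ⟨h.hxa, ?_, ?_⟩ <;> simp only [ne_eq, Sym2.eq_iff]
    · have := hneS x b h.hx h.hb; grind
    · have := hneS x q h.hx hq; grind
  have hyb : G'.Adj y b := by
    rw [hadj]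
    refine Or.inl ⟨h.hyb, ?_, ?_⟩ <;> simp only [ne_eq, Sym2.eq_iff]
    · have := hneS y b h.hy h.hb; grind
    · have := hneS y q h.hy hq; grind
  have hδc' : G'.Adj δ c := by
    rw [hadj]
    refine Or.inl ⟨hδc, ?_, ?_⟩ <;> simp only [ne_eq, Sym2.eq_iff]
    · have := hneS δ b hδS h.hb; grind
    · have := hneS δ q hδS hq; grind
  have hδb' : ¬ G'.Adj δ b := by
    rw [hadj]
    simp only [ne_eq, Sym2.eq_iff]
    have := hneS δ q hδS hq
    grind
  refine hδb' (hG'.adj_of_mem_escaping (hP.anchored h h.hb hxa hyb) (mem_escaping.2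
    ⟨hδS, c, hc, hδc', hca, ?_⟩))
  rwa [hP.adj_outside c hc a h.ha]

theorem sum_degIn_comm (A B : Finset V) (G : SimpleGraph V) :
    ∑ p ∈ A, degIn B G p = ∑ q ∈ B, degIn A G q := by
  have h := Finset.sum_card_bipartiteAbove_eq_sum_card_bipartiteBelow (s := A) (t := B) G.Adj
  simp only [Finset.bipartiteAbove, Finset.bipartiteBelow] at h
  unfold degIn
  rw [h]
  exact Finset.sum_congr rfl fun q _ => by
    congr 1
    exact Finset.filter_congr fun p _ => G.adj_comm p q

/-- Edges from `S` outside the escaping vertices go to `a` and its neighbours only. -/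
theorem sum_degIn_compl_sdiff_escaping (ha : a ∉ S) :
    ∑ p ∈ S \ escaping S G a, degIn Sᶜ G p =
      ∑ q ∈ insert a ({u ∈ Sᶜ | G.Adj a u} : Finset V), degIn (S \ escaping S G a) G q := by
  rw [sum_degIn_comm]
  symm
  refine Finset.sum_subset ?_ ?_
  · intro q hq
    simp only [Finset.mem_insert, Finset.mem_filter] at hq
    rcases hq with rfl | hq
    · exact Finset.mem_compl.2 ha
    · exact hq.1
  · intro q hq hq'
    simp only [Finset.mem_insert, Finset.mem_filter, not_or, not_and] at hq'
    rw [degIn, Finset.card_eq_zero, Finset.filter_eq_empty_iff]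
    intro p hp hqp
    rw [Finset.mem_sdiff, mem_escaping] at hp
    exact hp.2 ⟨hp.1, q, Finset.mem_compl.1 hq, hqp.symm, hq'.1, fun h => hq'.2 hq h.symm⟩

theorem degIn_sdiff (A D : Finset V) (v : V) :
    degIn (A \ D) G v = #({u ∈ A | G.Adj v u} \ D) := by
  unfold degIn
  congr 1
  ext u
  simp only [Finset.mem_filter, Finset.mem_sdiff]
  tauto

theorem card_insert_neighbors (a : V) :
    #(insert a ({u ∈ Sᶜ | G.Adj a u} : Finset V)) = degIn Sᶜ G a + 1 := by
  rw [Finset.card_insert_of_notMem (by simp), degIn]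

theorem DegreeSetup.degIn_le (hS : DegreeSetup r d S W) {p : V} (hp : p ∈ S) :
    degIn S G p ≤ r := by
  have h1 : ({u ∈ S | G.Adj p u} : Finset V) ⊆ S.erase p := fun u hu => by
    simp only [Finset.mem_filter, Finset.mem_erase] at hu ⊢
    exact ⟨hu.2.ne.symm, hu.1⟩
  have := Finset.card_le_card h1
  rw [Finset.card_erase_of_mem hp, hS.card_S] at this
  exact this

theorem DegreeSetup.degIn_lt (hS : DegreeSetup r d S W) {p q : V} (hp : p ∈ S) (hq : q ∈ S)
    (hpq : p ≠ q) (hn : ¬ G.Adj p q) : degIn S G p + 1 ≤ r := by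
  have h1 : ({u ∈ S | G.Adj p u} : Finset V) ⊆ (S.erase p).erase q := fun u hu => by
    simp only [Finset.mem_filter, Finset.mem_erase] at hu ⊢
    exact ⟨by rintro rfl; exact hn hu.2, hu.2.ne.symm, hu.1⟩
  have := Finset.card_le_card h1
  rw [Finset.card_erase_of_mem (by simp [hq, hpq.symm]), Finset.card_erase_of_mem hp,
    hS.card_S] at this
  unfold degIn
  have := hS.five_le
  omega

theorem Extremal.degree_le (hG : Extremal r d S G) (hS : DegreeSetup r d S W) (ha : a ∉ S)
    {p : V} (hp : p ∈ S) :
    degIn S G a + degIn Sᶜ G a ≤ degIn S G p + degIn Sᶜ G p := by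
  rw [hG.realizes.degIn_add_degIn_compl, hG.realizes.degIn_add_degIn_compl]
  exact hS.top p hp a ha

theorem Extremal.degIn_compl_add_escaping_lt (hG : Extremal r d S G) (hS : DegreeSetup r d S W)
    (h : Anchored S G x y a b) : degIn Sᶜ G a + #(escaping S G a) < r := by
  by_contra! hge
  set D := escaping S G a with hD
  set F := degIn S G a with hF
  set t := degIn Sᶜ G a with ht
  have hkF : #D ≤ F := hG.card_escaping_le h
  have hFr : F ≤ r + 1 := by
    rw [← hS.card_S]; exact Finset.card_filter_le _ _
  have hDS : D ⊆ S := fun p hp => (mem_escaping.1 hp).1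
  have hcard : (#(S \ D) : ℤ) = r + 1 - #D := by
    have := Finset.card_sdiff_add_card_eq_card hDS
    rw [hS.card_S] at this
    omega
  have hyD : y ∈ S \ D := Finset.mem_sdiff.2 ⟨h.hy, hG.notMem_escaping h⟩
  have hlow : #(S \ D) * ((F : ℤ) + t - r) < ∑ p ∈ S \ D, (degIn Sᶜ G p : ℤ) := by
    rw [← nsmul_eq_mul, ← Finset.sum_const]
    refine Finset.sum_lt_sum (fun p hp => ?_) ⟨y, hyD, ?_⟩
    · have hp' := (Finset.mem_sdiff.1 hp).1
      have h1 := hG.degree_le hS h.ha hp'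
      have h2 := hS.degIn_le (G := G) hp'
      omega
    · have h1 := hG.degree_le hS h.ha h.hy
      have h2 := hS.degIn_lt h.hy h.hx h.hxy.symm fun h' => h.hn h'.symm
      omega
  have hup : ∑ p ∈ S \ D, (degIn Sᶜ G p : ℤ) ≤ (t + 1) * ((F : ℤ) - #D) := by
    have h1 := sum_degIn_compl_sdiff_escaping (G := G) h.ha
    have h2 : ∑ q ∈ insert a ({u ∈ Sᶜ | G.Adj a u} : Finset V), degIn (S \ D) G q ≤
        (t + 1) * (F - #D) := by
      rw [← card_insert_neighbors, ← smul_eq_mul]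
      refine Finset.sum_le_card_nsmul _ _ _ fun q hq => ?_
      have hqS : q ∉ S := by
        simp only [Finset.mem_insert, Finset.mem_filter, Finset.mem_compl] at hq
        rcases hq with rfl | hq
        · exact h.ha
        · exact hq.1
      rw [degIn_sdiff]
      have := hG.card_sdiff_escaping_add_le h hqS
      rw [← hD] at this
      omega
    rw [← h1] at h2
    zify [hkF] at h2
    exact h2
  rw [hcard] at hlow
  have h0 : (0 : ℤ) ≤ (t - (r - #D)) * (r + 1 - F) :=
    mul_nonneg (by zify at hge; linarith) (by zify at hFr; linarith)
  nlinarith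

theorem Extremal.no_twin (hG : Extremal r d S G) (hS : DegreeSetup r d S W) {w q : V}
    (h : Anchored S G x y a q) (hqa : q ≠ a) (hmissed : missed W G a = {w})
    (hN : ({u ∈ Sᶜ | G.Adj a u} : Finset V) ⊆ (W.erase a).erase w) (haW : a ∈ W)
    (hwS : degIn S G w = 0) (hq : degIn Sᶜ G q < r) : False := by
  have hwm : w ∈ missed W G a := by simp [hmissed]
  obtain ⟨hwW, hwa, hnwa⟩ := mem_missed.1 hwm
  have hwq : w ∈ missed W G q := by
    have h1 := hS.le_degIn_compl_add G q
    obtain ⟨w', hw'⟩ : (missed W G q).Nonempty := Finset.card_pos.1 (by omega)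
    rwa [hG.missed_eq hS h hwm hw']
  obtain ⟨-, hwq, hnwq⟩ := mem_missed.1 hwq
  have haq : G.Adj a q := hG.adj_of_hole h.hx h.hy h.hxy h.hn h.ha h.hb h.hxa h.hyb hqa.symm
  have hsub : ({u ∈ Sᶜ | G.Adj w u} : Finset V) ⊆ ((W.erase a).erase w).erase q := fun c hc => by
    simp only [Finset.mem_filter, Finset.mem_compl] at hc
    have hca : c ≠ a := by
      rintro rfl; exact hnwa hc.2
    have hac : G.Adj a c := by
      by_contra hnac
      exact hG.no_link h.hx h.hy h.hxy h.hn h.ha h.hb h.hxa h.hyb hca (fun h => hnac h.symm) hwq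
        hnwq hc.2.symm (Or.inl hc.1)
    refine Finset.mem_erase.2 ⟨?_, hN (by simp [hc.1, hac])⟩
    rintro rfl
    exact hnwq hc.2
  have hqmem : q ∈ (W.erase a).erase w := hN (by simp [h.hb, haq])
  have h1 := Finset.card_le_card hsub
  rw [Finset.card_erase_of_mem hqmem, Finset.card_erase_of_mem (by simp [hwW, hwa]),
    Finset.card_erase_of_mem haW, hS.card_W] at h1
  have h2 := hG.realizes.degIn_add_degIn_compl S w
  have h3 := hS.degree_W w hwW
  have h4 := hS.five_le
  rw [hwS, degIn] at h2
  omega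

theorem Extremal.escaping_nonempty (hG : Extremal r d S G) (hS : DegreeSetup r d S W)
    (h : Anchored S G x y a b) (hlt : degIn Sᶜ G a < r) : (escaping S G a).Nonempty := by
  rw [Finset.nonempty_iff_ne_empty]
  intro hD
  have hzero : ∀ q ∉ S, q ≠ a → ¬ G.Adj a q → degIn S G q = 0 := fun q hq hqa hnaq => by
    rw [degIn, Finset.card_eq_zero, Finset.filter_eq_empty_iff]
    intro p hp hqp
    have : p ∈ escaping S G a :=
      mem_escaping.2 ⟨hp, q, hq, hqp.symm, hqa, fun h => hnaq h.symm⟩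
    rw [hD] at this
    exact Finset.notMem_empty p this
  have hle := hG.card_missed_le_one hS h hlt
  have hge := hS.le_degIn_compl_add G a
  obtain ⟨w, hw⟩ := Finset.card_eq_one.1 (show #(missed W G a) = 1 by omega)
  obtain ⟨hwW, hwa, hnwa⟩ := mem_missed.1 (hw ▸ Finset.mem_singleton_self w)
  have hsub := hS.sub_neighbors G a
  rw [hw, Finset.sdiff_singleton_eq_erase] at hsub
  have hcard := Finset.card_le_card hsub
  rw [Finset.card_erase_of_mem (by simp [hwW, hwa])] at hcard
  have haW : a ∈ W := by
    by_contra haW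
    rw [Finset.erase_eq_of_notMem haW, hS.card_W] at hcard
    unfold degIn at hlt
    omega
  rw [Finset.card_erase_of_mem haW, hS.card_W] at hcard
  have hN : ({u ∈ Sᶜ | G.Adj a u} : Finset V) ⊆ (W.erase a).erase w := by
    refine (Finset.eq_of_subset_of_card_le hsub ?_).symm.subset
    rw [Finset.card_erase_of_mem (by simp [hwW, hwa]), Finset.card_erase_of_mem haW, hS.card_W]
    unfold degIn at hlt
    omega
  have hF : 1 ≤ degIn S G a := degIn_pos h.hx h.hxa.symm
  have hwS : degIn S G w = 0 := hzero w (hS.notMem w hwW) hwa fun h' => hnwa h'.symm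
  by_cases hex : ∃ q, q ∉ S ∧ q ≠ a ∧ degIn S G q = degIn S G a
  · obtain ⟨q, hq, hqa, hqF⟩ := hex
    have hqt : degIn Sᶜ G q < r := by
      rcases h.max q hq with h' | h' <;> omega
    by_cases hyq : G.Adj y q
    · exact hG.no_twin hS { h with hb := hq, hyb := hyq } hqa hw hN haW hwS hqt
    · obtain ⟨p, hp, hpq, hpb⟩ := exists_adj_of_degIn_le
        (by rw [hqF]; exact h.degIn_le h.hb) h.hy h.hyb hyq
      obtain ⟨G', hG', hP, hadj⟩ := hG.exists_switch hp h.hy hq h.hb hpq h.hyb hpb hyq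
      have hxa : G'.Adj x a := by
        rw [hadj]
        have hx := h.hx
        have hb := h.hb
        have hxy := h.hxy
        refine Or.inl ⟨h.hxa, ?_, ?_⟩ <;> simp only [ne_eq, Sym2.eq_iff] <;> grind
      refine hG'.no_twin hS (hP.anchored h hq hxa (by rw [hadj]; exact Or.inr (Or.inr rfl))) hqa
        (w := w) ?_ ?_ haW (by rw [hP.degIn_eq, hwS]) (by rwa [hP.degIn_compl_eq])
      · rw [← hw]
        ext v
        simp only [mem_missed]
        refine and_congr_right fun hv => ?_
        rw [hP.adj_outside v (hS.notMem v hv) a h.ha]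
      · rw [← Finset.filter_congr fun u hu =>
          (hP.adj_outside a h.ha u (Finset.mem_compl.1 hu)).symm]
        exact hN
  · push Not at hex
    have h1 := sum_degIn_compl_sdiff_escaping (G := G) h.ha
    rw [hD, Finset.sdiff_empty, Finset.sum_insert (by simp)] at h1
    have h2 : ∑ q ∈ ({u ∈ Sᶜ | G.Adj a u} : Finset V), degIn S G q ≤
        degIn Sᶜ G a * (degIn S G a - 1) := by
      rw [← smul_eq_mul, degIn]
      refine Finset.sum_le_card_nsmul _ _ _ fun q hq => ?_
      simp only [Finset.mem_filter, Finset.mem_compl] at hq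
      have := hex q hq.1 hq.2.ne.symm
      have := h.degIn_le hq.1
      omega
    have ht : degIn Sᶜ G a = r - 1 := by omega
    have hlow : ∀ p ∈ S, degIn S G a - 1 ≤ degIn Sᶜ G p := fun p hp => by
      have h1 := hG.degree_le hS h.ha hp
      have h2 := hS.degIn_le (G := G) hp
      omega
    have hx' : degIn S G a ≤ degIn Sᶜ G x := by
      have h1 := hG.degree_le hS h.ha h.hx
      have h2 := hS.degIn_lt h.hx h.hy h.hxy h.hn
      omega
    have hy' : degIn S G a ≤ degIn Sᶜ G y := by
      have h1 := hG.degree_le hS h.ha h.hy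
      have h2 := hS.degIn_lt h.hy h.hx h.hxy.symm fun h' => h.hn h'.symm
      omega
    have h3 : ((S.erase x).erase y).card • (degIn S G a - 1) ≤
        ∑ p ∈ (S.erase x).erase y, degIn Sᶜ G p :=
      Finset.card_nsmul_le_sum _ _ _ fun p hp =>
        hlow p (Finset.mem_of_mem_erase (Finset.mem_of_mem_erase hp))
    have hyx : y ∈ S.erase x := Finset.mem_erase.2 ⟨h.hxy.symm, h.hy⟩
    rw [← Finset.add_sum_erase S _ h.hx, ← Finset.add_sum_erase _ _ hyx] at h1
    rw [Finset.card_erase_of_mem hyx, Finset.card_erase_of_mem h.hx, hS.card_S, smul_eq_mul,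
      show r + 1 - 1 - 1 = r - 1 by omega] at h3
    rw [ht] at h2
    omega

/-- In an extremal realization, one end of every hole in `S` has no neighbour outside `S`. -/
theorem Extremal.no_rich_hole (hG : Extremal r d S G) (hS : DegreeSetup r d S W) (hx : x ∈ S)
    (hy : y ∈ S) (hxy : x ≠ y) (hn : ¬ G.Adj x y) (hex : 1 ≤ degIn Sᶜ G x)
    (hey : 1 ≤ degIn Sᶜ G y) : False := by
  obtain ⟨G', a, b, hG', h⟩ := hG.exists_anchored hx hy hxy hn hex hey
  have h1 := hG'.degIn_compl_add_escaping_lt hS h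
  have h2 := Finset.card_pos.2 (hG'.escaping_nonempty hS h (by omega))
  have h3 := hS.le_degIn_compl_add G' a
  have h4 := hG'.card_missed_le_one hS h (by omega)
  omega

/-- A pair of distinct non-adjacent vertices of `S`. -/
def Hole (S : Finset V) (G : SimpleGraph V) (p q : V) : Prop :=
  p ∈ S ∧ q ∈ S ∧ p ≠ q ∧ ¬ G.Adj p q

theorem Hole.symm {p q : V} (h : Hole S G p q) : Hole S G q p :=
  ⟨h.2.1, h.1, h.2.2.1.symm, fun hqp => h.2.2.2 hqp.symm⟩

/-- Each hole at a vertex of `S` lowers its degree within `S`. -/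
theorem DegreeSetup.degIn_add_card_le (hS : DegreeSetup r d S W) {p : V} (hp : p ∈ S)
    {H : Finset V} (hH : ∀ q ∈ H, Hole S G p q) : degIn S G p + #H ≤ r := by
  have hdisj : Disjoint ({u ∈ S | G.Adj p u} : Finset V) H :=
    Finset.disjoint_left.2 fun u hu hu' => (hH u hu').2.2.2 (Finset.mem_filter.1 hu).2
  have hsub : ({u ∈ S | G.Adj p u} : Finset V) ∪ H ⊆ S.erase p := fun u hu => by
    rw [Finset.mem_union, Finset.mem_filter] at hu
    rw [Finset.mem_erase]
    rcases hu with hu | hu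
    · exact ⟨hu.2.ne.symm, hu.1⟩
    · exact ⟨(hH u hu).2.2.1.symm, (hH u hu).2.1⟩
  have := Finset.card_le_card hsub
  rwa [Finset.card_union_of_disjoint hdisj, Finset.card_erase_of_mem hp, hS.card_S] at this

/-- Trading a hole with ends `z` and `c` for a hole with end `z` at a confined vertex. -/
theorem Extremal.exists_trade (hG : Extremal r d S G) {z z' c : V} (hz' : z' ∈ S)
    (hole : Hole S G z c) (hzz' : G.Adj z z') (ha : a ∉ S) (hca : G.Adj c a)
    (hdead : ∀ q ∉ S, ¬ G.Adj z' q) :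
    ∃ G', Extremal r d S G' ∧ ∀ u v, G'.Adj u v ↔
      (G.Adj u v ∧ s(u, v) ≠ s(c, a) ∧ s(u, v) ≠ s(z, z')) ∨
        s(u, v) = s(c, z) ∨ s(u, v) = s(z', a) := by
  obtain ⟨hz, hc, hzc, hnzc⟩ := hole
  have hne := hzz'.ne
  have hcz' : c ≠ z' := by
    rintro rfl; exact hnzc hzz'
  have hnz'a := hdead a ha
  have hnzc' : ¬ G.Adj c z := fun h => hnzc h.symm
  obtain ⟨G', hreal, hadj⟩ := exists_exchange G hG.realizes [(c, a), (z, z')] [(c, z), (z', a)]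
    (by simp [*]) (by simp; grind) (by simp [*]; grind) (by simp; grind)
    (by intro φ; simp; ring)
  have hadj' : ∀ u v, G'.Adj u v ↔
      (G.Adj u v ∧ s(u, v) ≠ s(c, a) ∧ s(u, v) ≠ s(z, z')) ∨
        s(u, v) = s(c, z) ∨ s(u, v) = s(z', a) := fun u v => by
    rw [hadj]; simp only [List.map_cons, List.map_nil, List.mem_cons, List.not_mem_nil, or_false,
      not_or, ne_eq]
  refine ⟨G', ⟨hreal, fun G'' h => (hG.innerCount_le G'' h).trans ?_, hG.not_nearClique⟩, hadj'⟩
  have hsub : ({e ∈ S ×ˢ S | G.Adj e.1 e.2} \ {(z, z'), (z', z)}) ∪ {(c, z), (z, c)} ⊆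
      {e ∈ S ×ˢ S | G'.Adj e.1 e.2} := by
    rintro ⟨u, v⟩ he
    simp only [Finset.mem_union, Finset.mem_sdiff, Finset.mem_filter, Finset.mem_product,
      Finset.mem_insert, Finset.mem_singleton, Prod.mk.injEq, not_or, hadj', ne_eq,
      Sym2.eq_iff] at he ⊢
    grind
  have hdisj : Disjoint ({e ∈ S ×ˢ S | G.Adj e.1 e.2} \ {(z, z'), (z', z)})
      ({(c, z), (z, c)} : Finset (V × V)) := by
    rw [Finset.disjoint_left]
    rintro ⟨u, v⟩ he he'
    simp only [Finset.mem_sdiff, Finset.mem_filter, Finset.mem_insert, Finset.mem_singleton,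
      Prod.mk.injEq] at he he'
    grind
  have h1 := Finset.card_le_card hsub
  have h2 : #({(c, z), (z, c)} : Finset (V × V)) = 2 := Finset.card_pair (by grind)
  have h3 := Finset.le_card_sdiff ({(z, z'), (z', z)} : Finset (V × V))
    {e ∈ S ×ˢ S | G.Adj e.1 e.2}
  have h4 : #({(z, z'), (z', z)} : Finset (V × V)) ≤ 2 := Finset.card_le_two
  rw [Finset.card_union_of_disjoint hdisj] at h1
  unfold innerCount
  omega

/-- Two holes whose other ends have different outer edges contradict extremality. -/
theorem Extremal.no_two_rich_holes (hG : Extremal r d S G) (hS : DegreeSetup r d S W)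
    {z z' c c' : V} (hole : Hole S G z c) (hole' : Hole S G z' c') (hzz' : G.Adj z z')
    (hdead : ∀ q ∉ S, ¬ G.Adj z' q) (ha : a ∉ S) (hca : G.Adj c a) (hb : b ∉ S)
    (hcb : G.Adj c' b) (hne : c ≠ c' ∨ a ≠ b) : False := by
  obtain ⟨G', hG', hadj⟩ := hG.exists_trade hole'.1 hole hzz' ha hca hdead
  obtain ⟨hz, hc, hzc, hnzc⟩ := hole
  obtain ⟨hz', hc', hzc', hnzc'⟩ := hole'
  have hcz' : c ≠ z' := by
    rintro rfl; exact hnzc hzz'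
  have hzz := hzz'.ne
  refine hG'.no_rich_hole hS hz' hc' hzc' ?_ (degIn_pos (Finset.mem_compl.2 ha) ?_)
    (degIn_pos (Finset.mem_compl.2 hb) ?_)
  · rw [hadj]; simp only [ne_eq, Sym2.eq_iff]; grind
  · rw [hadj]; exact Or.inr (Or.inr rfl)
  · rw [hadj]; simp only [ne_eq, Sym2.eq_iff]; grind

/-- `v` has no neighbour outside `S`. -/
def Confined (S : Finset V) (G : SimpleGraph V) (v : V) : Prop :=
  ∀ q ∉ S, ¬ G.Adj v q

theorem confined_iff_degIn_compl {v : V} : Confined S G v ↔ degIn Sᶜ G v = 0 := by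
  rw [degIn, Finset.card_eq_zero, Finset.filter_eq_empty_iff]
  simp [Confined]

theorem Extremal.confined_or_confined (hG : Extremal r d S G) (hS : DegreeSetup r d S W)
    {p q : V} (h : Hole S G p q) : Confined S G p ∨ Confined S G q := by
  simp only [confined_iff_degIn_compl]
  by_contra! hcon
  exact hG.no_rich_hole hS h.1 h.2.1 h.2.2.1 h.2.2.2 (by omega) (by omega)

theorem Extremal.card_holes_le (hG : Extremal r d S G) (hS : DegreeSetup r d S W)
    {p : V} (hp : p ∈ S) {H : Finset V} (hH : ∀ q ∈ H, Hole S G p q) :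
    d p + #H ≤ r + degIn Sᶜ G p := by
  have h1 := hS.degIn_add_card_le hp hH
  have h2 := hG.realizes.degIn_add_degIn_compl S p
  omega

theorem Extremal.hole_unique (hG : Extremal r d S G) (hS : DegreeSetup r d S W)
    (hdeg : ∀ p ∈ S, r ≤ d p + 1) {p q q' : V} (hp : Confined S G p) (h : Hole S G p q)
    (h' : Hole S G p q') : q = q' := by
  by_contra hne
  have h1 := hG.card_holes_le hS h.1 (H := {q, q'}) (by simp [h, h'])
  rw [Finset.card_pair hne, confined_iff_degIn_compl.1 hp] at h1
  have := hdeg p h.1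
  omega

theorem Extremal.mem_of_confined (hG : Extremal r d S G) (hS : DegreeSetup r d S W)
    {U : Finset V} (hdeg : ∀ p ∈ S, p ∉ U → r ≤ d p) {p q : V} (hp : Confined S G p)
    (h : Hole S G p q) : p ∈ U := by
  by_contra hne
  have h1 := hG.card_holes_le hS h.1 (H := {q}) (by simp [h])
  rw [Finset.card_singleton, confined_iff_degIn_compl.1 hp] at h1
  have := hdeg p h.1 hne
  omega

theorem length_le_card_of_nodup {U : Finset V} (l : List V) (hl : l.Nodup) (h : ∀ v ∈ l, v ∈ U) :
    l.length ≤ #U := by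
  rw [← List.toFinset_card_of_nodup hl]
  exact Finset.card_le_card fun v hv => h v (List.mem_toFinset.1 hv)

theorem not_extremal_of_hole_pair (hS : DegreeSetup r d S W) {p₁ p₂ p₃ p₄ : V} (h₁₂ : p₁ ≠ p₂)
    (h₃₄ : p₃ ≠ p₄)
    (h : ∀ p q, Hole S G p q → s(p, q) = s(p₁, p₂) ∨ s(p, q) = s(p₃, p₄)) :
    ¬ Extremal r d S G := fun hG =>
  hG.not_nearClique G hG.realizes (nearClique_of_two_holes hS.seven_le_card hS.card_S h₁₂ h₃₄
    fun p hp q hq hpq hn => h p q ⟨hp, hq, hpq, hn⟩)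

/-- Two unconfined ends of holes at different confined vertices coincide, and the common vertex
has a single neighbour outside `S`. -/
theorem Extremal.rich_holes_share (hG : Extremal r d S G) (hS : DegreeSetup r d S W)
    (hdeg : ∀ p ∈ S, r ≤ d p + 1) {z z' c c' : V} (hz : Confined S G z) (hz' : Confined S G z')
    (hc : ¬ Confined S G c) (hc' : ¬ Confined S G c') (hzc : Hole S G z c)
    (hzc' : Hole S G z' c') (hzz' : z ≠ z') : c = c' ∧ degIn Sᶜ G c = 1 := by
  have hadj : G.Adj z z' := by
    by_contra hn
    exact hc ((hG.hole_unique hS hdeg hz hzc ⟨hzc.1, hzc'.1, hzz', hn⟩) ▸ hz')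
  have hpair := fun a b ha hca hb hcb hne =>
    hG.no_two_rich_holes hS (a := a) (b := b) hzc hzc' hadj hz' ha hca hb hcb hne
  simp only [Confined, not_forall, not_not] at hc hc'
  obtain ⟨a, ha, hca⟩ := hc
  obtain ⟨b, hb, hcb⟩ := hc'
  have hcc : c = c' := by
    by_contra hne
    exact hpair a b ha hca hb hcb (Or.inl hne)
  subst hcc
  refine ⟨rfl, ?_⟩
  rw [degIn, Finset.card_eq_one]
  refine ⟨a, Finset.eq_singleton_iff_unique_mem.2 ⟨by simp [ha, hca], fun v hv => ?_⟩⟩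
  simp only [Finset.mem_filter, Finset.mem_compl] at hv
  by_contra hne
  exact hpair v a hv.1 hv.2 ha hca (Or.inr hne)

theorem mem_of_length_eq_five {U : Finset V} (hU : #U ≤ 5) {l : List V} (hl : l.Nodup)
    (hlen : l.length = 5) (hlU : ∀ v ∈ l, v ∈ U) {u : V} (hu : u ∈ U) : u ∈ l := by
  by_contra hul
  have := length_le_card_of_nodup (U := U) (u :: l) (List.nodup_cons.2 ⟨hul, hl⟩)
    (List.forall_mem_cons.2 ⟨hu, hlU⟩)
  rw [List.length_cons] at this
  omega

theorem Extremal.false_of_two_rich_holes (hG : Extremal r d S G) (hS : DegreeSetup r d S W)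
    {U : Finset V} (hU : #U ≤ 5) (hdeg : ∀ p ∈ S, r ≤ d p + 1)
    (hdegU : ∀ p ∈ S, p ∉ U → r ≤ d p) {z z' c c' : V} (hz : Confined S G z) (hz' : Confined S G z')
    (hc : ¬ Confined S G c) (hc' : ¬ Confined S G c') (hzc : Hole S G z c)
    (hzc' : Hole S G z' c') (hzz' : z ≠ z') : False := by
  have huniq : ∀ p q q', Confined S G p → Hole S G p q → Hole S G p q' → q = q' :=
    fun p q q' hp h h' => hG.hole_unique hS hdeg hp h h'
  have hmem : ∀ p q, Confined S G p → Hole S G p q → p ∈ U := fun p q hp h =>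
    hG.mem_of_confined hS hdegU hp h
  obtain ⟨rfl, hone⟩ := hG.rich_holes_share hS hdeg hz hz' hc hc' hzc hzc' hzz'
  have hcU : c ∈ U := by
    by_contra hcU
    have h1 := hG.card_holes_le hS hzc.2.1 (H := {z, z'}) (by simp [hzc.symm, hzc'.symm])
    have h2 := hdegU c hzc.2.1 hcU
    rw [Finset.card_pair hzz'] at h1
    omega
  have hc3 : ∀ v, Hole S G c v → v = z ∨ v = z' := fun v hv => by
    by_contra! hv'
    have h1 := hG.card_holes_le hS hzc.2.1 (H := {v, z, z'})
      (by simp [hzc.symm, hzc'.symm, hv])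
    have h2 := hdeg c hzc.2.1
    rw [Finset.card_insert_of_notMem (by simp [hv']), Finset.card_pair hzz'] at h1
    omega
  have hpoor : ∀ p q, Hole S G p q → p ≠ c → q ≠ c → Confined S G p := fun p q h hpc hqc => by
    by_contra hp
    have hq := (hG.confined_or_confined hS h).resolve_left hp
    have hzq : z ≠ q := by
      rintro rfl
      exact hpc (huniq z p c hq h.symm hzc)
    exact hpc (hG.rich_holes_share hS hdeg hz hq hc hp hzc h.symm hzq).1.symm
  by_cases hother : ∃ p q, Hole S G p q ∧ p ≠ c ∧ q ≠ c
  · obtain ⟨p, q, hpq, hpc, hqc⟩ := hother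
    have hp := hpoor p q hpq hpc hqc
    have hq := hpoor q p hpq.symm hqc hpc
    have hdisj : ∀ u, Confined S G u → Hole S G u c → u ≠ p ∧ u ≠ q := fun u hu huc =>
      ⟨by rintro rfl; exact hqc (huniq u q c hu hpq huc),
        by rintro rfl; exact hpc (huniq u p c hu hpq.symm huc)⟩
    have hnd : [z, c, z', p, q].Nodup := by
      have h1 := hdisj z hz hzc
      have h2 := hdisj z' hz' hzc'
      simp [hzc.2.2.1, hzz', h1, h2, hzc'.2.2.1.symm, hpc.symm, hqc.symm, hpq.2.2.1]
    refine hG.not_nearClique G hG.realizes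
      (nearClique_of_nodup hS.card_S z c z' p q hnd fun u hu v hv huv hn => ?_)
    have huv' : Hole S G u v := ⟨hu, hv, huv, hn⟩
    by_cases huc : u = c
    · rw [huc] at huv' ⊢
      rcases hc3 v huv' with h | h <;> rw [h]
      · exact Or.inl Sym2.eq_swap
      · exact Or.inr (Or.inl rfl)
    by_cases hvc : v = c
    · rw [hvc] at huv' ⊢
      rcases hc3 u huv'.symm with h | h <;> rw [h]
      · exact Or.inl rfl
      · exact Or.inr (Or.inl Sym2.eq_swap)
    have hu' := hpoor u v huv' huc hvc
    have hmem' := mem_of_length_eq_five hU hnd rfl (by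
      simp [hcU, hmem _ _ hz hzc, hmem _ _ hz' hzc', hmem _ _ hp hpq,
        hmem _ _ hq hpq.symm]) (hmem _ _ hu' huv')
    simp only [List.mem_cons, List.not_mem_nil, or_false] at hmem'
    rcases hmem' with rfl | rfl | rfl | rfl | rfl
    · exact absurd (huniq _ _ _ hu' huv' hzc) hvc
    · exact absurd rfl huc
    · exact absurd (huniq _ _ _ hu' huv' hzc') hvc
    · rw [huniq _ _ _ hu' huv' hpq]
      exact Or.inr (Or.inr rfl)
    · rw [huniq _ _ _ hu' huv' hpq.symm]
      exact Or.inr (Or.inr Sym2.eq_swap)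
  · push Not at hother
    refine not_extremal_of_hole_pair hS hzc.2.2.1 hzc'.2.2.1 (fun p q hpq => ?_) hG
    by_cases hpc : p = c
    · rw [hpc] at hpq ⊢
      rcases hc3 q hpq with h | h <;> rw [h]
      · exact Or.inl Sym2.eq_swap
      · exact Or.inr Sym2.eq_swap
    · have hqc := hother p q hpq hpc
      rw [hqc] at hpq ⊢
      rcases hc3 p hpq.symm with h | h <;> rw [h]
      · exact Or.inl rfl
      · exact Or.inr rfl

theorem Extremal.false_of_unique_rich_hole (hG : Extremal r d S G) (hS : DegreeSetup r d S W)
    {U : Finset V} (hU : #U ≤ 5) (hdeg : ∀ p ∈ S, r ≤ d p + 1)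
    (hdegU : ∀ p ∈ S, p ∉ U → r ≤ d p) {z c : V} (hz : Confined S G z)
    (hc : ¬ Confined S G c) (hzc : Hole S G z c)
    (hpoor : ∀ p q, Hole S G p q → p ≠ z → q ≠ z → Confined S G p) : False := by
  have huniq : ∀ p q q', Confined S G p → Hole S G p q → Hole S G p q' → q = q' :=
    fun p q q' hp h h' => hG.hole_unique hS hdeg hp h h'
  have hmem : ∀ p q, Confined S G p → Hole S G p q → p ∈ U := fun p q hp h =>
    hG.mem_of_confined hS hdegU hp h
  by_cases hsecond : ∃ p q, Hole S G p q ∧ p ≠ z ∧ q ≠ z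
  · obtain ⟨p₁, p₂, h₁₂, h₁, h₂⟩ := hsecond
    by_cases hthird : ∃ p q, Hole S G p q ∧ p ≠ z ∧ q ≠ z ∧ s(p, q) ≠ s(p₁, p₂)
    · obtain ⟨p₃, p₄, h₃₄, h₃, h₄, hne'⟩ := hthird
      have hc₁ := hpoor p₁ p₂ h₁₂ h₁ h₂
      have hc₂ := hpoor p₂ p₁ h₁₂.symm h₂ h₁
      have hc₃ := hpoor p₃ p₄ h₃₄ h₃ h₄
      have hc₄ := hpoor p₄ p₃ h₃₄.symm h₄ h₃
      rw [ne_eq, Sym2.eq_iff] at hne'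
      have hnd : [z, p₁, p₂, p₃, p₄].Nodup := by
        have := h₁₂.2.2.1
        have := h₃₄.2.2.1
        have h13 : p₁ ≠ p₃ := by
          rintro rfl; exact hne' (Or.inl ⟨rfl, huniq _ _ _ hc₁ h₃₄ h₁₂⟩)
        have h14 : p₁ ≠ p₄ := by
          rintro rfl; exact hne' (Or.inr ⟨huniq _ _ _ hc₁ h₃₄.symm h₁₂, rfl⟩)
        have h23 : p₂ ≠ p₃ := by
          rintro rfl; exact hne' (Or.inr ⟨rfl, huniq _ _ _ hc₂ h₃₄ h₁₂.symm⟩)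
        have h24 : p₂ ≠ p₄ := by
          rintro rfl; exact hne' (Or.inl ⟨huniq _ _ _ hc₂ h₃₄.symm h₁₂.symm, rfl⟩)
        simp [*, h₁.symm, h₂.symm, h₃.symm, h₄.symm]
      have hadj : G.Adj z p₁ := by
        by_contra hn
        exact hc (huniq z c p₁ hz hzc ⟨hzc.1, h₁₂.1, h₁.symm, hn⟩ ▸ hc₁)
      have hc' := hc
      simp only [Confined, not_forall, not_not] at hc'
      obtain ⟨a, ha, hca⟩ := hc'
      obtain ⟨G', hG', hadj'⟩ := hG.exists_trade h₁₂.1 hzc hadj ha hca hc₁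
      refine hG'.not_nearClique G' hG'.realizes
        (nearClique_of_nodup hS.card_S z p₁ p₂ p₃ p₄ hnd fun u hu v hv huv hn => ?_)
      rw [hadj'] at hn
      push Not at hn
      by_cases huv' : G.Adj u v
      · have h1 : s(u, v) ≠ s(c, a) := by
          rw [ne_eq, Sym2.eq_iff]; grind
        left
        by_contra h2
        exact absurd (hn.1 huv' h1) h2
      · have hole : Hole S G u v := ⟨hu, hv, huv, huv'⟩
        have hnzc : s(u, v) ≠ s(c, z) := hn.2.1
        have huz : u ≠ z := by
          rintro rfl
          exact hnzc (by rw [huniq _ _ _ hz hole hzc, Sym2.eq_swap])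
        have hvz : v ≠ z := by
          rintro rfl
          exact hnzc (by rw [huniq _ _ _ hz hole.symm hzc])
        have hcu := hpoor u v hole huz hvz
        have hmem' := mem_of_length_eq_five hU hnd rfl (by
          simp [hmem _ _ hz hzc, hmem _ _ hc₁ h₁₂, hmem _ _ hc₂ h₁₂.symm,
            hmem _ _ hc₃ h₃₄, hmem _ _ hc₄ h₃₄.symm]) (hmem _ _ hcu hole)
        simp only [List.mem_cons, List.not_mem_nil, or_false] at hmem'
        rcases hmem' with rfl | rfl | rfl | rfl | rfl
        · exact absurd rfl huz
        · rw [huniq _ _ _ hcu hole h₁₂]; tauto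
        · rw [huniq _ _ _ hcu hole h₁₂.symm, Sym2.eq_swap]; tauto
        · rw [huniq _ _ _ hcu hole h₃₄]; tauto
        · rw [huniq _ _ _ hcu hole h₃₄.symm, Sym2.eq_swap (a := u)]; tauto
    · push Not at hthird
      refine not_extremal_of_hole_pair hS hzc.2.2.1 h₁₂.2.2.1 (fun p q hpq => ?_) hG
      by_cases hpz : p = z
      · subst hpz
        rw [huniq p q c hz hpq hzc]
        exact Or.inl rfl
      by_cases hqz : q = z
      · subst hqz
        rw [huniq q p c hz hpq.symm hzc]
        exact Or.inl Sym2.eq_swap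
      exact Or.inr (hthird p q hpq hpz hqz)
  · push Not at hsecond
    refine not_extremal_of_hole_pair hS hzc.2.2.1 hzc.2.2.1 (fun p q hpq => ?_) hG
    left
    by_cases hpz : p = z
    · rw [hpz] at hpq ⊢
      rw [huniq z q c hz hpq hzc]
    · have hqz := hsecond p q hpq hpz
      rw [hqz] at hpq ⊢
      rw [huniq z p c hz hpq.symm hzc, Sym2.eq_swap]

theorem Extremal.false_of_poor_holes (hG : Extremal r d S G) (hS : DegreeSetup r d S W)
    {U : Finset V} (hU : #U ≤ 5) (hdeg : ∀ p ∈ S, r ≤ d p + 1)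
    (hdegU : ∀ p ∈ S, p ∉ U → r ≤ d p)
    (hpoor : ∀ p q, Hole S G p q → Confined S G p) : False := by
  have huniq : ∀ p q q', Confined S G p → Hole S G p q → Hole S G p q' → q = q' :=
    fun p q q' hp h h' => hG.hole_unique hS hdeg hp h h'
  have hmem : ∀ p q, Confined S G p → Hole S G p q → p ∈ U := fun p q hp h =>
    hG.mem_of_confined hS hdegU hp h
  have hV := hS.seven_le_card
  by_cases hfirst : ∃ p q, Hole S G p q
  · obtain ⟨p₁, p₂, h₁₂⟩ := hfirst
    by_cases hsecond : ∃ p q, Hole S G p q ∧ s(p, q) ≠ s(p₁, p₂)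
    · obtain ⟨p₃, p₄, h₃₄, hne'⟩ := hsecond
      refine not_extremal_of_hole_pair hS h₁₂.2.2.1 h₃₄.2.2.1 (fun p q hpq => ?_) hG
      rw [ne_eq, Sym2.eq_iff] at hne'
      have hdisj : ∀ u v u' v', Hole S G u v → Hole S G u' v' →
          s(u, v) = s(u', v') ∨ (u ≠ u' ∧ u ≠ v' ∧ v ≠ u' ∧ v ≠ v') := fun u v u' v' h h' => by
        have hu := hpoor u v h
        have hv := hpoor v u h.symm
        refine or_iff_not_imp_left.2 fun hne => ⟨?_, ?_, ?_, ?_⟩ <;> rintro rfl <;> apply hne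
        · rw [huniq u v v' hu h h']
        · rw [huniq u v u' hu h h'.symm, Sym2.eq_swap]
        · rw [huniq v u v' hv h.symm h', Sym2.eq_swap]
        · rw [huniq v u u' hv h.symm h'.symm]
      have h1 := hdisj _ _ _ _ hpq h₁₂
      have h2 := hdisj _ _ _ _ hpq h₃₄
      have h3 := hdisj _ _ _ _ h₁₂ h₃₄
      by_contra! hcon
      have h1' := h1.resolve_left hcon.1
      have h2' := h2.resolve_left hcon.2
      have h3' := h3.resolve_left fun h => hne' (Sym2.eq_iff.1 h.symm)
      have hmem' := mem_of_length_eq_five hU (l := [p₁, p₂, p₃, p₄, p])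
        (by simp [h₁₂.2.2.1, h₃₄.2.2.1, h3', h1'.1.symm, h1'.2.1.symm, h2'.1.symm, h2'.2.1.symm])
        rfl
        (by simp [hmem _ _ (hpoor _ _ h₁₂) h₁₂, hmem _ _ (hpoor _ _ h₁₂.symm) h₁₂.symm,
          hmem _ _ (hpoor _ _ h₃₄) h₃₄, hmem _ _ (hpoor _ _ h₃₄.symm) h₃₄.symm,
          hmem _ _ (hpoor _ _ hpq) hpq])
        (hmem _ _ (hpoor _ _ hpq.symm) hpq.symm)
      have := hpq.2.2.1.symm
      simp [*] at hmem'
    · push Not at hsecond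
      exact not_extremal_of_hole_pair hS h₁₂.2.2.1 h₁₂.2.2.1
        (fun p q hpq => Or.inl (hsecond p q hpq)) hG
  · push Not at hfirst
    obtain ⟨u, v, huv⟩ := Fintype.exists_pair_of_one_lt_card (α := V) (by omega)
    exact not_extremal_of_hole_pair hS huv huv (fun p q hpq => absurd hpq (hfirst p q)) hG

theorem not_extremal (hS : DegreeSetup r d S W) {U : Finset V} (hU : #U ≤ 5)
    (hdeg : ∀ p ∈ S, r ≤ d p + 1) (hdegU : ∀ p ∈ S, p ∉ U → r ≤ d p) :
    ¬ Extremal r d S G := fun hG => by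
  have hconf : ∀ p q, Hole S G p q → Confined S G p ∨ Confined S G q := fun p q h =>
    hG.confined_or_confined hS h
  by_cases hrich : ∃ z c, Confined S G z ∧ ¬ Confined S G c ∧ Hole S G z c
  · obtain ⟨z, c, hz, hc, hzc⟩ := hrich
    refine hG.false_of_unique_rich_hole hS hU hdeg hdegU hz hc hzc fun p q hpq hpz hqz => ?_
    by_contra hp
    have hq := (hconf p q hpq).resolve_left hp
    exact hG.false_of_two_rich_holes hS hU hdeg hdegU hz hq hc hp hzc hpq.symm hqz.symm
  · push Not at hrich
    refine hG.false_of_poor_holes hS hU hdeg hdegU fun p q hpq => ?_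
    by_contra hp
    exact hrich q p ((hconf p q hpq).resolve_left hp) hp hpq.symm

theorem exists_nearClique (hS : DegreeSetup r d S W) {U : Finset V} (hU : #U ≤ 5)
    (hdeg : ∀ p ∈ S, r ≤ d p + 1) (hdegU : ∀ p ∈ S, p ∉ U → r ≤ d p) (hG : Realizes G d) :
    ∃ G', Realizes G' d ∧ NearClique r G' := by
  by_contra! hno
  obtain ⟨G₀, hG₀, hmax⟩ := Finset.exists_max_image
    (Finset.univ.filter fun G' : SimpleGraph V => Realizes G' d) (innerCount S) ⟨G, by simpa⟩
  simp only [Finset.mem_filter, Finset.mem_univ, true_and] at hG₀ hmax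
  exact not_extremal hS hU hdeg hdegU ⟨hG₀, hmax, hno⟩

theorem NearClique.containsCopy (h : 5 ≤ r + 1) (hG : NearClique r G) :
    ContainsCopy G (KsubH (r + 1) 5 h P2unionK2) := by
  obtain ⟨R, v, hR, hv, hadj⟩ := hG
  let f : Fin (r + 1) → V := fun i => if hi : i.val < 5 then v ⟨i, hi⟩ else v 0
  have hf : ∀ k, f (Fin.castLE h k) = v k := fun k => by simp [f]
  let s : Finset (Fin (r + 1)) := (Finset.univ.filter fun k => v k ∈ R).map (Fin.castLEEmb h)
  have hs : ∀ i, i ∈ s ↔ ∃ k, v k ∈ R ∧ Fin.castLE h k = i := fun i => by simp [s]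
  obtain ⟨g, hg⟩ := Finset.exists_equiv_extend_of_card_eq (α := Fin (r + 1)) (t := R) (by simp [hR])
    (s := s) (f := f)
    (by
      intro x hx
      simp only [Finset.mem_image, hs] at hx
      obtain ⟨i, ⟨k, hk, rfl⟩, rfl⟩ := hx
      rwa [hf])
    (by
      intro i hi j hj hij
      obtain ⟨k, -, rfl⟩ := (hs i).1 hi
      obtain ⟨l, -, rfl⟩ := (hs j).1 hj
      rw [hf, hf] at hij
      rw [hv hij])
  have hgv : ∀ i k, (g i : V) = v k → i = Fin.castLE h k := fun i k hik => by
    have hk : v k ∈ R := hik ▸ (g i).2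
    have := hg _ ((hs _).2 ⟨k, hk, rfl⟩)
    rw [hf, ← hik] at this
    exact (g.injective (Subtype.ext this)).symm
  refine ⟨g.toEmbedding.trans (Function.Embedding.subtype _), fun i j hij => ?_⟩
  simp only [KsubH, SimpleGraph.sdiff_adj, SimpleGraph.top_adj] at hij
  by_contra hn
  have hpair : ∀ k l, P2unionK2.Adj k l → s((g i : V), (g j : V)) ≠ s(v k, v l) := by
    intro k l hkl heq
    rw [Sym2.eq_iff] at heq
    apply hij.2
    rcases heq with ⟨hi, hj⟩ | ⟨hi, hj⟩
    · exact ⟨hij.1, k, l, hkl, (hgv i k hi).symm, (hgv j l hj).symm⟩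
    · exact ⟨hij.1, l, k, hkl.symm, (hgv i l hi).symm, (hgv j k hj).symm⟩
  rcases hadj (g i) (g i).2 (g j) (g j).2
    (fun he => hij.1 (g.injective (Subtype.ext he))) hn with he | he | he
  · exact hpair 0 1 (by simp [P2unionK2]) he
  · exact hpair 1 2 (by simp [P2unionK2]) he
  · exact hpair 3 4 (by simp [P2unionK2]) he

theorem realizes_iff_isRealization {n : ℕ} {G : SimpleGraph (Fin n)} {d : Fin n → ℕ} :
    Realizes G d ↔ IsRealization G d := by
  refine forall_congr' fun i => ?_
  rw [← SimpleGraph.card_neighborFinset_eq_degree, SimpleGraph.neighborFinset_eq_filter]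

end

/-- Lemma 3.5: let `r ≥ 5`, `n ≥ 2r + 2` and `π = (d₁, ..., dₙ)` be an `n`-term graphic
sequence with `d_{r-4} ≥ r`, and `σ(π) ≥ (r-1)(2n-r) - 3(n-r) - 1` if `n - r` is odd,
and `σ(π) ≥ (r-1)(2n-r) - 3(n-r) - 2` if `n - r` is even. If `d_{2r+2} ≥ r - 1`, then
`π` is potentially `K_{r+1} - (P₂ ∪ K₂)`-graphic. -/
theorem stmt8 (r n : ℕ) (hr : 5 ≤ r) (hn : 2 * r + 2 ≤ n)
    (d : Fin n → ℕ) (hgraphic : IsGraphic d)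
    (h1 : r ≤ nth d (r - 4))
    (hσ : (if Odd (n - r)
        then ((r : ℤ) - 1) * (2 * (n : ℤ) - r) - 3 * ((n : ℤ) - r) - 1
        else ((r : ℤ) - 1) * (2 * (n : ℤ) - r) - 3 * ((n : ℤ) - r) - 2)
      ≤ ∑ i, (d i : ℤ))
    (h2 : r - 1 ≤ nth d (2 * r + 2)) :
    PotentiallyGraphic d (KsubH (r + 1) 5 (by omega) P2unionK2) := by
  obtain ⟨hanti, G, hG⟩ := hgraphic
  have hcard : ∀ a b, b ≤ n → #{i : Fin n | a ≤ i.val ∧ i.val < b} = b - a := fun a b hb => by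
    rw [← Nat.card_Ico, ← Finset.card_map Fin.valEmbedding]
    congr 1
    ext i
    simp only [Finset.mem_map, Finset.mem_filter, Finset.mem_univ, true_and,
      Fin.valEmbedding_apply, Finset.mem_Ico]
    exact ⟨fun ⟨k, hk, hki⟩ => hki ▸ hk, fun hi => ⟨⟨i, by omega⟩, hi, rfl⟩⟩
  rw [nth, dif_pos (by omega)] at h1 h2
  have hlow : ∀ i : Fin n, i.val < 2 * r + 2 → r ≤ d i + 1 := fun i hi => by
    have : d ⟨2 * r + 2 - 1, by omega⟩ ≤ d i := hanti (Fin.mk_le_mk.2 (by omega))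
    omega
  have hhigh : ∀ i : Fin n, i.val < r - 4 → r ≤ d i := fun i hi =>
    h1.trans (hanti (Fin.mk_le_mk.2 (by omega)))
  have hS : DegreeSetup r d ({i | 0 ≤ i.val ∧ i.val < r + 1} : Finset (Fin n))
      ({i | r + 1 ≤ i.val ∧ i.val < 2 * r + 2} : Finset (Fin n)) :=
    { five_le := hr
      card_S := hcard 0 (r + 1) (by omega)
      card_W := by rw [hcard _ _ hn]; omega
      notMem := fun w hw hw' => by simp at hw hw'; omega
      top := fun p hp q hq => hanti (Fin.mk_le_mk.2 (by simp at hp hq; omega))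
      degree_W := fun w hw => hlow w (by simp at hw; omega) }
  obtain ⟨G', hG', hnear⟩ := exists_nearClique hS
    (U := ({i | r - 4 ≤ i.val ∧ i.val < r + 1} : Finset (Fin n)))
    (by rw [hcard _ _ (by omega)]; omega)
    (fun p hp => hlow p (by simp at hp; omega))
    (fun p hp hpU => hhigh p (by simp at hp hpU; omega))
    (realizes_iff_isRealization.2 hG)
  exact ⟨G', realizes_iff_isRealization.1 hG', hnear.containsCopy _⟩
end

section
/- Let r ≥ 4 and n ≥ r+1 be integers. Then σ(K_{r+1} − K_4, n) ≥ (r−1)(2n−r) − 3(n−r) + 1 if n−r is odd, and σ(K_{r+1} − K_4, n) ≥ (r−1)(2n−r) − 3(n−r) + 2 if n−r is even. -/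
open SimpleGraph Finset
open scoped Classical

/-- Adjacency on `ℕ` of a cycle through `0, …, N - 1` together with the `N / 2` chords joining
`x` and `x + N / 2` for `x < N / 2`. -/
def ChordedCycleAdj (N x y : ℕ) : Prop :=
  y = x + 1 ∨ x = y + 1 ∨ (x = 0 ∧ y = N - 1) ∨ (y = 0 ∧ x = N - 1) ∨
    (y = x + N / 2 ∧ x < N / 2) ∨ (x = y + N / 2 ∧ y < N / 2)

/-- The join of the complete graph on the first `a` vertices with the chorded cycle on the
remaining `n - a` vertices. -/
def joinChordedCycle (a n : ℕ) : SimpleGraph (Fin n) where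
  Adj i j := i ≠ j ∧
    ((i : ℕ) < a ∨ (j : ℕ) < a ∨ ChordedCycleAdj (n - a) ((i : ℕ) - a) ((j : ℕ) - a))
  symm := ⟨by
    intro i j h
    unfold ChordedCycleAdj at *
    refine ⟨h.1.symm, ?_⟩
    have := h.2
    tauto⟩
  loopless := ⟨fun i h => h.1 rfl⟩

/-- The degree sequence of `joinChordedCycle a n`. -/
def joinChordedCycleDegree (a n i : ℕ) : ℕ :=
  if i < a then n - 1 else if i + 1 = n ∧ Odd (n - a) then a + 2 else a + 3

lemma degree_eq_card_of_adj_iff {n : ℕ} (G : SimpleGraph (Fin n)) (i : Fin n) (s : Finset ℕ)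
    (hs : ∀ x ∈ s, x < n) (h : ∀ j : Fin n, G.Adj i j ↔ (j : ℕ) ∈ s) : G.degree i = s.card := by
  rw [← G.card_neighborFinset_eq_degree, ← Finset.card_map Fin.valEmbedding]
  congr 1
  ext x
  simp only [Finset.mem_map, mem_neighborFinset, Fin.valEmbedding_apply]
  constructor
  · rintro ⟨j, hj, rfl⟩
    exact (h j).1 hj
  · intro hx
    exact ⟨⟨x, hs x hx⟩, (h _).2 hx, rfl⟩

lemma degree_joinChordedCycle {a n : ℕ} (hn : a + 4 ≤ n) (i : Fin n) :
    (joinChordedCycle a n).degree i = joinChordedCycleDegree a n i := by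
  obtain ⟨i, hi⟩ := i
  unfold joinChordedCycleDegree
  dsimp only
  by_cases hia : i < a
  · rw [if_pos hia, degree_eq_card_of_adj_iff _ _ ((Finset.range n).erase i)]
    · rw [Finset.card_erase_of_mem (by simpa using hi), Finset.card_range]
    · intro x hx
      simp only [Finset.mem_erase, Finset.mem_range] at hx
      exact hx.2
    · intro j
      simp [joinChordedCycle, hia, Fin.ext_iff, eq_comm]
  rw [if_neg hia]
  obtain ⟨N, rfl⟩ : ∃ N, n = a + N := ⟨n - a, by omega⟩
  obtain ⟨x, rfl⟩ : ∃ x, i = a + x := ⟨i - a, by omega⟩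
  set p := if x + 1 = N then a else a + x + 1 with hp
  set q := if x = 0 then a + N - 1 else a + x - 1 with hq
  set c := if x < N / 2 then a + x + N / 2 else a + x - N / 2 with hc
  by_cases hlast : a + x + 1 = a + N ∧ Odd (a + N - a)
  · rw [if_pos hlast, degree_eq_card_of_adj_iff _ _ (insert p (insert q (Finset.range a)))]
    · rw [Finset.card_insert_of_notMem, Finset.card_insert_of_notMem, Finset.card_range]
      · simp only [Finset.mem_range]; split_ifs at hq <;> omega
      · simp only [Finset.mem_insert, Finset.mem_range]
        split_ifs at hp hq <;> omega
    · intro y hy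
      simp only [Finset.mem_insert, Finset.mem_range] at hy
      split_ifs at hp hq <;> omega
    · rintro ⟨j, hj⟩
      rw [Nat.odd_iff] at hlast
      simp only [joinChordedCycle, ChordedCycleAdj, ne_eq, Fin.mk.injEq, Finset.mem_insert,
        Finset.mem_range]
      split_ifs at hp hq <;> omega
  · rw [if_neg hlast,
      degree_eq_card_of_adj_iff _ _ (insert p (insert q (insert c (Finset.range a))))]
    all_goals rw [Nat.odd_iff] at hlast
    · rw [Finset.card_insert_of_notMem, Finset.card_insert_of_notMem,
        Finset.card_insert_of_notMem, Finset.card_range]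
      · simp only [Finset.mem_range]
        split_ifs at hc <;> omega
      · simp only [Finset.mem_insert, Finset.mem_range]
        split_ifs at hc hq <;> omega
      · simp only [Finset.mem_insert, Finset.mem_range]
        split_ifs at hc hp hq <;> omega
    · intro y hy
      simp only [Finset.mem_insert, Finset.mem_range] at hy
      split_ifs at hc hp hq <;> omega
    · rintro ⟨j, hj⟩
      simp only [joinChordedCycle, ChordedCycleAdj, ne_eq, Fin.mk.injEq, Finset.mem_insert,
        Finset.mem_range]
      by_cases hja : j < a
      · simp only [hja, true_or, or_true, and_true, iff_true]
        omega
      obtain ⟨y, rfl⟩ : ∃ y, j = a + y := ⟨j - a, by omega⟩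
      simp only [hia, hja, Nat.add_sub_cancel_left, false_or, or_false, add_right_inj]
        at hlast ⊢
      clear_value p q c
      constructor
      · rintro ⟨hne, h | h | h | h | h | h⟩ <;> split_ifs at hc hp hq <;> omega
      · rintro (h | h | h) <;> split_ifs at hc hp hq <;> omega

lemma isGraphic_joinChordedCycleDegree {a n : ℕ} (hn : a + 4 ≤ n) :
    IsGraphic (fun i : Fin n => joinChordedCycleDegree a n i) := by
  refine ⟨?_, joinChordedCycle a n, degree_joinChordedCycle hn⟩
  intro i j hij
  have hij' : (i : ℕ) ≤ j := hij
  have := j.isLt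
  simp only [joinChordedCycleDegree, Nat.odd_iff]
  split_ifs <;> omega

lemma sum_joinChordedCycleDegree {a n : ℕ} (hn : a + 4 ≤ n) :
    ∑ i : Fin n, joinChordedCycleDegree a n i + (if Odd (n - a) then 1 else 0) =
      a * (n - 1) + (n - a) * (a + 3) := by
  obtain ⟨N, rfl⟩ : ∃ N, n = a + (N + 1) := ⟨n - a - 1, by omega⟩
  have h₁ : ∑ i ∈ Finset.range a, joinChordedCycleDegree a (a + (N + 1)) i = a * (a + N) := by
    rw [Finset.sum_congr rfl (g := fun _ => a + N)]
    · simp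
    · intro i hi
      rw [joinChordedCycleDegree, if_pos (Finset.mem_range.1 hi)]
      omega
  have h₂ : ∑ i ∈ Finset.range N, joinChordedCycleDegree a (a + (N + 1)) (a + i) =
      N * (a + 3) := by
    rw [Finset.sum_congr rfl (g := fun _ => a + 3)]
    · simp
    · intro i hi
      have := Finset.mem_range.1 hi
      rw [joinChordedCycleDegree, if_neg (by omega), if_neg (by omega)]
  have h₃ : joinChordedCycleDegree a (a + (N + 1)) (a + N) +
      (if Odd (N + 1) then 1 else 0) = a + 3 := by
    by_cases h : Odd (N + 1) <;> simp [joinChordedCycleDegree, h, add_assoc]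
  rw [Fin.sum_univ_eq_sum_range (fun i => joinChordedCycleDegree a (a + (N + 1)) i),
    Finset.sum_range_add, Finset.sum_range_succ, h₁, h₂, Nat.add_sub_cancel_left, add_assoc,
    add_assoc, h₃, ← add_assoc a N 1, Nat.add_sub_cancel]
  ring

lemma KsubH_top_adj {m k : ℕ} (h : k ≤ m) {u v : Fin m} (hu : k ≤ (u : ℕ)) (huv : u ≠ v) :
    (KsubH m k h ⊤).Adj u v := by
  simp only [KsubH, sdiff_adj, top_adj, map_adj]
  refine ⟨huv, ?_⟩
  rintro ⟨x, y, -, rfl, -⟩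
  have := x.isLt
  simp at hu
  omega

/-- A copy of `K_m - K_k` forces at least `m - k` vertices of degree at least `m - 1`. -/
lemma sub_le_card_of_containsCopy {n m k : ℕ} (h : k ≤ m) {G : SimpleGraph (Fin n)}
    (hG : ContainsCopy G (KsubH m k h ⊤)) :
    m - k ≤ (Finset.univ.filter fun i => m - 1 ≤ G.degree i).card := by
  obtain ⟨f, hf⟩ := hG
  let g : Fin (m - k) → Fin m := fun x => ⟨k + x, by omega⟩
  have hg : Function.Injective g := by
    intro x y hxy
    simp only [g, Fin.mk.injEq] at hxy
    ext
    omega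
  rw [← Fintype.card_fin (m - k), ← Finset.card_univ,
    ← Finset.card_image_of_injective _ (f.injective.comp hg)]
  apply Finset.card_le_card
  intro i hi
  obtain ⟨x, -, rfl⟩ := Finset.mem_image.1 hi
  simp only [Finset.mem_filter, Finset.mem_univ, true_and, Function.comp_apply]
  rw [← G.card_neighborFinset_eq_degree]
  calc m - 1 = ((Finset.univ.erase (g x)).map f).card := by simp
    _ ≤ _ := by
      apply Finset.card_le_card
      intro j hj
      obtain ⟨v, hv, rfl⟩ := Finset.mem_map.1 hj
      rw [mem_neighborFinset]
      exact hf _ _ (KsubH_top_adj h (by simp [g]) (Finset.ne_of_mem_erase hv).symm)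

lemma not_potentiallyGraphic_joinChordedCycleDegree {a n : ℕ} :
    ¬ PotentiallyGraphic (fun i : Fin n => joinChordedCycleDegree a n i)
      (KsubH (a + 4 + 1) 4 (by omega) (⊤ : SimpleGraph (Fin 4))) := by
  rintro ⟨G, hG, hcopy⟩
  have h := sub_le_card_of_containsCopy _ hcopy
  have hle : (Finset.univ.filter fun i => a + 4 + 1 - 1 ≤ G.degree i).card ≤ a := by
    rw [← Finset.card_map Fin.valEmbedding]
    conv_rhs => rw [← Finset.card_range a]
    apply Finset.card_le_card
    intro x hx
    obtain ⟨i, hi, rfl⟩ := Finset.mem_map.1 hx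
    have hi' := (Finset.mem_filter.1 hi).2
    rw [hG i] at hi'
    simp only [joinChordedCycleDegree] at hi'
    simp only [Fin.valEmbedding_apply, Finset.mem_range]
    split_ifs at hi' <;> omega
  omega


/-- For `r ≥ 4` and `n ≥ r + 1`, `σ(K_{r+1} - K₄, n) ≥ (r-1)(2n-r) - 3(n-r) + 1` if
`n - r` is odd, and `σ(K_{r+1} - K₄, n) ≥ (r-1)(2n-r) - 3(n-r) + 2` if `n - r` is even. -/
theorem stmt10 (r n : ℕ) (hr : 4 ≤ r) (hn : r + 1 ≤ n) (m : ℕ)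
    (hm : IsLeast (SigmaSet (KsubH (r + 1) 4 (by omega) (⊤ : SimpleGraph (Fin 4))) n) m) :
    (if Odd (n - r)
      then ((r : ℤ) - 1) * (2 * (n : ℤ) - r) - 3 * ((n : ℤ) - r) + 1
      else ((r : ℤ) - 1) * (2 * (n : ℤ) - r) - 3 * ((n : ℤ) - r) + 2) ≤ (m : ℤ) := by
  obtain ⟨a, rfl⟩ : ∃ a, r = a + 4 := ⟨r - 4, by omega⟩
  obtain ⟨k, rfl⟩ : ∃ k, n = a + 4 + k := ⟨n - (a + 4), by omega⟩
  obtain ⟨⟨heven, hmem⟩, -⟩ := hm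
  have hlt : ∑ i : Fin (a + 4 + k), joinChordedCycleDegree a (a + 4 + k) i < m := by
    by_contra! hle
    exact not_potentiallyGraphic_joinChordedCycleDegree
      (hmem _ (isGraphic_joinChordedCycleDegree (by omega)) hle)
  have hs : Even (∑ i : Fin (a + 4 + k), joinChordedCycleDegree a (a + 4 + k) i) := by
    rw [← Finset.sum_congr rfl fun i _ => degree_joinChordedCycle (by omega) i,
      sum_degrees_eq_twice_card_edges]
    exact even_two_mul _
  have hsum := sum_joinChordedCycleDegree (a := a) (n := a + 4 + k) (by omega)
  rw [show a + 4 + k - a = 4 + k by omega, show a + 4 + k - 1 = a + 3 + k by omega] at hsum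
  rw [Nat.add_sub_cancel_left]
  have hodd : Odd (4 + k) ↔ Odd k := by
    simp only [Nat.odd_iff]
    omega
  simp only [hodd] at hsum
  generalize ∑ i : Fin (a + 4 + k), joinChordedCycleDegree a (a + 4 + k) i = s at hlt hsum hs
  have hs2 : s + 2 ≤ m := by
    obtain ⟨x, hx⟩ := hs
    obtain ⟨y, hy⟩ := heven
    omega
  zify at hs2
  split_ifs at hsum ⊢ with hk <;> zify at hsum <;> push_cast <;> linarith
end
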